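/- Let Ω be a Runge domain in ℂ² and let h be a holomorphic function on Ω. Let M := { z ∈ Ω : |h(z)| = 1 } and assume dh(z) ≠ 0 for all z ∈ M. Then every totally real C²-smooth disc contained in M is polynomially convex. -/

import Mathlib

noncomputable section

/-- The polynomial (convex) hull of a set `K ⊆ ℂⁿ`:
`K̂ = { z : |p(z)| ≤ sup_K |p| for every holomorphic polynomial p }`. -/
def polyHull (n : ℕ) (K : Set (Fin n → ℂ)) : Set (Fin n → ℂ) :=
  {z | ∀ p : MvPolynomial (Fin n) ℂ,
    ‖MvPolynomial.eval z p‖ ≤ sSup ((fun w => ‖MvPolynomial.eval w p‖) '' K)}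

/-- A set `K ⊆ ℂⁿ` is polynomially convex if it equals its polynomial hull. -/
def PolyConvex (n : ℕ) (K : Set (Fin n → ℂ)) : Prop := polyHull n K = K

/-- A Runge domain in `ℂⁿ`: a domain on which every holomorphic function can be
approximated uniformly on compact subsets by holomorphic polynomials. -/
def RungeDomain (n : ℕ) (Ω : Set (Fin n → ℂ)) : Prop :=
  IsOpen Ω ∧ IsConnected Ω ∧
  ∀ f : (Fin n → ℂ) → ℂ, DifferentiableOn ℂ f Ω →
    ∀ K : Set (Fin n → ℂ), K ⊆ Ω → IsCompact K → ∀ ε : ℝ, 0 < ε →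
      ∃ p : MvPolynomial (Fin n) ℂ, ∀ z ∈ K, ‖f z - MvPolynomial.eval z p‖ ≤ ε

/-- `K ⊆ ℂⁿ` is a totally real `C²`-smooth disc: the image of the closed unit
disc in `ℝ²` under a `C²` embedding `φ` (defined on an open neighborhood `U` of
the closed disc) whose image is a totally real submanifold, i.e. at each point
the tangent plane `W = range (dφ)` satisfies `W ∩ i·W = {0}`. -/
def TotallyRealDisc (n : ℕ) (K : Set (Fin n → ℂ)) : Prop :=
  ∃ (U : Set (ℝ × ℝ)) (φ : ℝ × ℝ → (Fin n → ℂ)),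
    IsOpen U ∧ Metric.closedBall (0 : ℝ × ℝ) 1 ⊆ U ∧
    ContDiffOn ℝ 2 φ U ∧ Set.InjOn φ U ∧
    (∀ x ∈ U, Function.Injective (fderiv ℝ φ x)) ∧
    (∀ x ∈ U, ∀ v w : ℝ × ℝ,
      fderiv ℝ φ x v = Complex.I • fderiv ℝ φ x w → fderiv ℝ φ x v = 0) ∧
    K = φ '' Metric.closedBall (0 : ℝ × ℝ) 1

section Preliminaries

set_option linter.unusedSectionVars false

open Topology Metric

/-- The function `κ / (q - w)`, when `w` is not a value of `q` on the support of `κ`. -/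
def qdiv {X : Type*} [TopologicalSpace X] (κ q : C(X, ℂ)) (w : ℂ) : C(X, ℂ) :=
  open Classical in
  if h : Continuous fun x => κ x / (q x - w) then ⟨fun x => κ x / (q x - w), h⟩ else 0

section Qdiv

variable {X : Type*} [TopologicalSpace X] {κ q : C(X, ℂ)} {w : ℂ}

theorem continuous_div_sub_of_notMem (hw : w ∉ q '' tsupport κ) :
    Continuous fun x => κ x / (q x - w) := by
  rw [continuous_iff_continuousAt]
  intro x
  by_cases hx : x ∈ tsupport κ
  · refine (κ.continuous.continuousAt).div (q.continuous.continuousAt.sub continuousAt_const) ?_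
    intro h
    exact hw ⟨x, hx, by linear_combination h⟩
  · have h1 : κ =ᶠ[𝓝 x] 0 := notMem_tsupport_iff_eventuallyEq.mp hx
    have : (fun x => κ x / (q x - w)) =ᶠ[𝓝 x] fun _ => 0 := by
      filter_upwards [h1] with y hy
      simp [hy]
    exact continuousAt_const.congr this.symm

theorem qdiv_apply (hw : w ∉ q '' tsupport κ) (x : X) : qdiv κ q w x = κ x / (q x - w) := by
  rw [qdiv, dif_pos (continuous_div_sub_of_notMem hw)]
  rfl

theorem qdiv_sub_ne (hw : w ∉ q '' tsupport κ) {x : X} (hx : κ x ≠ 0) : q x - w ≠ 0 := by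
  intro h
  exact hw ⟨x, subset_tsupport _ hx, by linear_combination h⟩

theorem qdiv_mul (hw : w ∉ q '' tsupport κ) {x : X} : qdiv κ q w x * (q x - w) = κ x := by
  rw [qdiv_apply hw]
  by_cases hx : κ x = 0
  · simp [hx]
  · exact div_mul_cancel₀ _ (qdiv_sub_ne hw hx)

theorem isOpen_qdiv_dom [CompactSpace X] (κ q : C(X, ℂ)) : IsOpen {w | w ∉ q '' tsupport κ} := by
  have : IsCompact (q '' tsupport κ) :=
    ((isClosed_tsupport κ).isCompact).image q.continuous
  exact this.isClosed.isOpen_compl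

theorem contDiffAt_qdiv [CompactSpace X] {w₀ : ℂ} (hw : w₀ ∉ q '' tsupport κ) :
    ContDiffAt ℂ 1 (qdiv κ q) w₀ := by
  obtain ⟨d, hd, hball⟩ := Metric.isOpen_iff.1 (isOpen_qdiv_dom κ q) w₀ hw
  have hdist : ∀ x, κ x ≠ 0 → d ^ 2 ≤ Complex.normSq (q x - w₀) := by
    intro x hx
    by_contra! hlt
    rw [Complex.normSq_eq_norm_sq] at hlt
    have : q x ∈ ball w₀ d := by
      rw [mem_ball, dist_eq_norm]
      exact lt_of_pow_lt_pow_left₀ 2 hd.le hlt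
    exact hball this ⟨x, subset_tsupport _ hx, rfl⟩
  let e : C(X, ℂ) := ⟨fun x => (starRingEnd ℂ) (q x - w₀) /
      ((max (Complex.normSq (q x - w₀)) (d ^ 2) : ℝ) : ℂ), by
    refine Continuous.div (by fun_prop) ?_ ?_
    · refine Complex.continuous_ofReal.comp (Continuous.max ?_ continuous_const)
      exact Complex.continuous_normSq.comp (by fun_prop)
    · intro x
      have : (0 : ℝ) < max (Complex.normSq (q x - w₀)) (d ^ 2) := lt_max_of_lt_right (by positivity)
      exact_mod_cast this.ne'⟩
  have he : ∀ x, κ x ≠ 0 → e x * (q x - w₀) = 1 := by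
    intro x hx
    have h1 : (0 : ℝ) < Complex.normSq (q x - w₀) := lt_of_lt_of_le (by positivity) (hdist x hx)
    have h2 : ((Complex.normSq (q x - w₀) : ℝ) : ℂ) ≠ 0 := by exact_mod_cast h1.ne'
    change (starRingEnd ℂ) (q x - w₀) /
      ((max (Complex.normSq (q x - w₀)) (d ^ 2) : ℝ) : ℂ) * (q x - w₀) = 1
    rw [max_eq_left (hdist x hx), div_mul_eq_mul_div, mul_comm _ (q x - w₀), Complex.mul_conj,
      div_self h2]
  have hunit : ∀ᶠ w in 𝓝 w₀, IsUnit (1 - (w - w₀) • e) := by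
    have hc : ContinuousAt (fun w : ℂ => 1 - (w - w₀) • e) w₀ := by fun_prop
    exact hc.eventually_mem (Units.isOpen.mem_nhds (by simp))
  have heq : qdiv κ q =ᶠ[𝓝 w₀] fun w => (κ * e) * Ring.inverse (1 - (w - w₀) • e) := by
    filter_upwards [hunit, (isOpen_qdiv_dom κ q).mem_nhds hw] with w hu hwd
    ext x
    rw [qdiv_apply hwd]
    have h1 := congrArg (fun g : C(X, ℂ) => g x) (Ring.mul_inverse_cancel _ hu)
    simp only [ContinuousMap.mul_apply, ContinuousMap.sub_apply, ContinuousMap.one_apply,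
      ContinuousMap.smul_apply, smul_eq_mul] at h1 ⊢
    by_cases hx : κ x = 0
    · simp [hx]
    · have h2 := qdiv_sub_ne hwd hx
      have h3 := he x hx
      rw [div_eq_iff h2]
      set i := (Ring.inverse (1 - (w - w₀) • e)) x
      linear_combination (-κ x) * h1 - κ x * i * h3
  refine ContDiffAt.congr_of_eventuallyEq ?_ heq
  refine contDiffAt_const.mul ?_
  have h1 : ContDiffAt ℂ 1 (Ring.inverse : C(X, ℂ) → C(X, ℂ)) (1 - (w₀ - w₀) • e) := by
    simpa using contDiffAt_ringInverse ℂ (1 : C(X, ℂ)ˣ)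
  have h2 : ContDiffAt ℂ 1 (fun w : ℂ => 1 - (w - w₀) • e) w₀ := by fun_prop
  exact ContDiffAt.comp w₀ h1 h2

end Qdiv

section Sheet

variable {X : Type*} [TopologicalSpace X] [CompactSpace X]

/-- `q - w` and `f - s` generate the unit ideal of the algebra `A`. -/
def Unimodular (A : Subalgebra ℂ C(X, ℂ)) (f q : A) (s w : ℂ) : Prop :=
  ∃ a b : A, a * (q - algebraMap ℂ A w) + b * (f - algebraMap ℂ A s) = 1

/-- The kernel obtained by patching `1 / (q - w)` and `1 / (f - s)` along the cutoff `κ`. -/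
def patchKernel {A : Subalgebra ℂ C(X, ℂ)} (f q : A) (κ : C(X, ℂ)) (a b : A) (s w : ℂ) :
    C(X, ℂ) :=
  qdiv κ q w * (b : C(X, ℂ)) - qdiv (1 - κ) f s * (a : C(X, ℂ))

open Classical in
/-- The value of a functional on the patched kernel, for some choice of the coefficients. -/
def patchInt {A : Subalgebra ℂ C(X, ℂ)} (ν : C(X, ℂ) →L[ℂ] ℂ) (f q : A) (κ : C(X, ℂ))
    (z : ℂ × ℂ) : ℂ :=
  if h : Unimodular A f q z.1 z.2 then
    ν (patchKernel f q κ h.choose h.choose_spec.choose z.1 z.2) else 0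

variable {A : Subalgebra ℂ C(X, ℂ)} {ν : C(X, ℂ) →L[ℂ] ℂ} {f q : A} {κ : C(X, ℂ)}

theorem unimodular_apply {a b : A} {s w : ℂ}
    (h : a * (q - algebraMap ℂ A w) + b * (f - algebraMap ℂ A s) = 1) (x : X) :
    (a : C(X, ℂ)) x * ((q : C(X, ℂ)) x - w) + (b : C(X, ℂ)) x * ((f : C(X, ℂ)) x - s) = 1 := by
  have := congrArg (fun g : A => (g : C(X, ℂ)) x) h
  simpa using this

theorem patchInt_eq (hν : ∀ g ∈ A, ν g = 0) {s w : ℂ}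
    (hw : w ∉ (q : C(X, ℂ)) '' tsupport κ) (hs : s ∉ (f : C(X, ℂ)) '' tsupport (1 - κ : C(X, ℂ)))
    {a b : A} (h : a * (q - algebraMap ℂ A w) + b * (f - algebraMap ℂ A s) = 1) :
    patchInt ν f q κ (s, w) = ν (patchKernel f q κ a b s w) := by
  have hU : Unimodular A f q s w := ⟨a, b, h⟩
  rw [patchInt, dif_pos hU]
  set a₁ := hU.choose
  set b₁ := hU.choose_spec.choose
  have h₁ : a₁ * (q - algebraMap ℂ A w) + b₁ * (f - algebraMap ℂ A s) = 1 :=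
    hU.choose_spec.choose_spec
  have key : patchKernel f q κ a₁ b₁ s w - patchKernel f q κ a b s w =
      ((a * b₁ - a₁ * b : A) : C(X, ℂ)) := by
    ext x
    have e := unimodular_apply h x
    have e₁ := unimodular_apply h₁ x
    have p1 : qdiv κ q w x * ((b₁ : C(X, ℂ)) x - (b : C(X, ℂ)) x) =
        κ x * ((a : C(X, ℂ)) x * (b₁ : C(X, ℂ)) x - (a₁ : C(X, ℂ)) x * (b : C(X, ℂ)) x) := by
      rw [← qdiv_mul hw]
      linear_combination qdiv κ q w x * ((b : C(X, ℂ)) x * e₁ - (b₁ : C(X, ℂ)) x * e)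
    have p2 : qdiv (1 - κ) f s x * ((a₁ : C(X, ℂ)) x - (a : C(X, ℂ)) x) =
        -(1 - κ x) *
          ((a : C(X, ℂ)) x * (b₁ : C(X, ℂ)) x - (a₁ : C(X, ℂ)) x * (b : C(X, ℂ)) x) := by
      have : 1 - κ x = (1 - κ : C(X, ℂ)) x := rfl
      rw [this, ← qdiv_mul hs]
      linear_combination qdiv (1 - κ) f s x * ((a : C(X, ℂ)) x * e₁ - (a₁ : C(X, ℂ)) x * e)
    change qdiv κ q w x * (b₁ : C(X, ℂ)) x - qdiv (1 - κ) f s x * (a₁ : C(X, ℂ)) x -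
      (qdiv κ q w x * (b : C(X, ℂ)) x - qdiv (1 - κ) f s x * (a : C(X, ℂ)) x) =
        (a : C(X, ℂ)) x * (b₁ : C(X, ℂ)) x - (a₁ : C(X, ℂ)) x * (b : C(X, ℂ)) x
    linear_combination p1 - p2
  have := hν _ (a * b₁ - a₁ * b : A).2
  rw [← key, map_sub, sub_eq_zero] at this
  exact this

variable [CompleteSpace A]

theorem unimodular_local {s₀ w₀ : ℂ} {a b : A}
    (h : a * (q - algebraMap ℂ A w₀) + b * (f - algebraMap ℂ A s₀) = 1) :
    ∃ α β : ℂ × ℂ → A, ContDiffAt ℂ 1 α (s₀, w₀) ∧ ContDiffAt ℂ 1 β (s₀, w₀) ∧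
      ∀ᶠ z in 𝓝 (s₀, w₀),
        α z * (q - algebraMap ℂ A z.2) + β z * (f - algebraMap ℂ A z.1) = 1 := by
  let u : ℂ × ℂ → A := fun z => 1 - (z.2 - w₀) • a - (z.1 - s₀) • b
  have hu : ContDiff ℂ 1 u := by fun_prop
  have hu₀ : u (s₀, w₀) = 1 := by simp [u]
  have hi : ContDiffAt ℂ 1 (fun z => Ring.inverse (u z)) (s₀, w₀) := by
    have h1 : ContDiffAt ℂ 1 (Ring.inverse : A → A) (u (s₀, w₀)) := by
      rw [hu₀]
      simpa using contDiffAt_ringInverse ℂ (1 : Aˣ)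
    exact ContDiffAt.comp _ h1 hu.contDiffAt
  refine ⟨fun z => a * Ring.inverse (u z), fun z => b * Ring.inverse (u z),
    contDiffAt_const.mul hi, contDiffAt_const.mul hi, ?_⟩
  have hunit : ∀ᶠ z in 𝓝 (s₀, w₀), IsUnit (u z) :=
    hu.continuous.continuousAt.eventually_mem (Units.isOpen.mem_nhds (by simp [hu₀]))
  filter_upwards [hunit] with z hz
  have e : u z = a * (q - algebraMap ℂ A z.2) + b * (f - algebraMap ℂ A z.1) := by
    simp only [u, Algebra.smul_def, map_sub]
    linear_combination -h
  have e' := Ring.mul_inverse_cancel _ hz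
  linear_combination e' - Ring.inverse (u z) * e

theorem isOpen_unimodular (f q : A) : IsOpen {z : ℂ × ℂ | Unimodular A f q z.1 z.2} := by
  rw [isOpen_iff_mem_nhds]
  rintro ⟨s, w⟩ ⟨a, b, h⟩
  obtain ⟨α, β, -, -, hev⟩ := unimodular_local h
  filter_upwards [hev] with z hz
  exact ⟨_, _, hz⟩

theorem contDiffAt_patchInt (hν : ∀ g ∈ A, ν g = 0) {s₀ w₀ : ℂ}
    (hw : w₀ ∉ (q : C(X, ℂ)) '' tsupport κ) (hs : s₀ ∉ (f : C(X, ℂ)) '' tsupport (1 - κ : C(X, ℂ)))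
    (hU : Unimodular A f q s₀ w₀) : ContDiffAt ℂ 1 (patchInt ν f q κ) (s₀, w₀) := by
  obtain ⟨a, b, h⟩ := hU
  obtain ⟨α, β, hα, hβ, hev⟩ := unimodular_local h
  have c1 : ∀ᶠ z : ℂ × ℂ in 𝓝 (s₀, w₀), z.2 ∉ (q : C(X, ℂ)) '' tsupport κ :=
    (continuous_snd.tendsto (s₀, w₀)).eventually (IsOpen.mem_nhds (x := w₀) (isOpen_qdiv_dom κ (q : C(X, ℂ))) hw)
  have c2 : ∀ᶠ z : ℂ × ℂ in 𝓝 (s₀, w₀), z.1 ∉ (f : C(X, ℂ)) '' tsupport (1 - κ : C(X, ℂ)) :=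
    (continuous_fst.tendsto (s₀, w₀)).eventually (IsOpen.mem_nhds (x := s₀) (isOpen_qdiv_dom (1 - κ) (f : C(X, ℂ))) hs)
  have heq : patchInt ν f q κ =ᶠ[𝓝 (s₀, w₀)]
      fun z => ν (patchKernel f q κ (α z) (β z) z.1 z.2) := by
    filter_upwards [hev, c1, c2] with z hz h1 h2
    exact patchInt_eq hν h1 h2 hz
  refine ContDiffAt.congr_of_eventuallyEq ?_ heq
  refine ν.contDiff.contDiffAt.comp _ ?_
  have hval : ContDiff ℂ 1 (fun a : A => (a : C(X, ℂ))) :=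
    (Subalgebra.toSubmodule A).subtypeL.contDiff
  have k1 : ContDiffAt ℂ 1 (fun z : ℂ × ℂ => qdiv κ q z.2) (s₀, w₀) :=
    ContDiffAt.comp (s₀, w₀) (contDiffAt_qdiv hw) contDiffAt_snd
  have k2 : ContDiffAt ℂ 1 (fun z : ℂ × ℂ => qdiv (1 - κ) f z.1) (s₀, w₀) :=
    ContDiffAt.comp (s₀, w₀) (contDiffAt_qdiv hs) contDiffAt_fst
  exact (k1.mul (hval.contDiffAt.comp _ hβ)).sub (k2.mul (hval.contDiffAt.comp _ hα))

end Sheet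

theorem differentiableOn_circleIntegral {Φ : ℂ × ℂ → ℂ} {w₀ : ℂ} {r : ℝ} (hr : 0 ≤ r) {U : Set ℂ}
    (hU : IsOpen U) (h : ∀ s ∈ U, ∀ w ∈ sphere w₀ r, ContDiffAt ℂ 1 Φ (s, w)) :
    DifferentiableOn ℂ (fun s => ∮ w in C(w₀, r), Φ (s, w)) U := by
  intro s₀ hs₀
  obtain ⟨ε, hε, hεU⟩ := Metric.nhds_basis_closedBall.mem_iff.1 (hU.mem_nhds hs₀)
  have hsph : ∀ θ : ℝ, circleMap w₀ r θ ∈ sphere w₀ r := circleMap_mem_sphere w₀ hr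
  have hd : Continuous (deriv (circleMap w₀ r)) := by
    rw [show deriv (circleMap w₀ r) = fun θ => circleMap 0 r θ * Complex.I from
      funext (deriv_circleMap w₀ r)]
    fun_prop
  have hfd : ContinuousOn (fun z => fderiv ℂ Φ z (1, 0)) (closedBall s₀ ε ×ˢ sphere w₀ r) := by
    rintro ⟨s, w⟩ ⟨hs, hw⟩
    have := (h s (hεU hs) w hw).fderiv_right (m := 0) (by norm_num)
    exact ((this.continuousAt).clm_apply continuousAt_const).continuousWithinAt
  obtain ⟨M, hM⟩ := ((isCompact_closedBall s₀ ε).prod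
    (isCompact_sphere w₀ r)).exists_bound_of_continuousOn hfd
  have hcont : ∀ s ∈ U, Continuous fun θ : ℝ =>
      deriv (circleMap w₀ r) θ • Φ (s, circleMap w₀ r θ) := by
    intro s hs
    refine Continuous.smul hd ?_
    rw [continuous_iff_continuousAt]
    intro θ
    exact ContinuousAt.comp (f := fun θ : ℝ => (s, circleMap w₀ r θ))
      (h s hs _ (hsph θ)).continuousAt (by fun_prop)
  have hcont' : Continuous fun θ : ℝ =>
      deriv (circleMap w₀ r) θ • fderiv ℂ Φ (s₀, circleMap w₀ r θ) (1, 0) := by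
    refine Continuous.smul hd ?_
    exact hfd.comp_continuous (f := fun θ : ℝ => (s₀, circleMap w₀ r θ)) (by fun_prop)
      fun θ => ⟨mem_closedBall_self hε.le, hsph θ⟩
  have key := intervalIntegral.hasDerivAt_integral_of_dominated_loc_of_deriv_le
    (μ := MeasureTheory.volume) (a := 0) (b := 2 * Real.pi) (𝕜 := ℂ)
    (F := fun s θ => deriv (circleMap w₀ r) θ • Φ (s, circleMap w₀ r θ))
    (F' := fun s θ => deriv (circleMap w₀ r) θ • fderiv ℂ Φ (s, circleMap w₀ r θ) (1, 0))
    (x₀ := s₀) (s := closedBall s₀ ε) (bound := fun _ => r * M) (closedBall_mem_nhds s₀ hε)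
    (by
      filter_upwards [hU.mem_nhds hs₀] with s hs
      exact (hcont s hs).aestronglyMeasurable)
    ((hcont s₀ hs₀).intervalIntegrable _ _) hcont'.aestronglyMeasurable
    (Filter.Eventually.of_forall fun θ _ s hs => by
      rw [norm_smul]
      refine mul_le_mul ?_ (hM _ ⟨hs, hsph θ⟩) (norm_nonneg _) hr
      simp [deriv_circleMap, abs_of_nonneg hr])
    (by simp)
    (Filter.Eventually.of_forall fun θ _ s hs => by
      refine HasDerivAt.fun_const_smul _ ?_
      have h1 := ((h s (hεU hs) _ (hsph θ)).differentiableAt one_ne_zero).hasFDerivAt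
      have h2 : HasDerivAt (fun s : ℂ => (s, circleMap w₀ r θ)) ((1 : ℂ), (0 : ℂ)) s :=
        (hasDerivAt_id s).prodMk (hasDerivAt_const s _)
      exact h1.comp_hasDerivAt s h2)
  exact key.2.differentiableAt.differentiableWithinAt

theorem ContinuousLinearMap.circleIntegral_comm {E F : Type*} [NormedAddCommGroup E]
    [NormedSpace ℂ E] [CompleteSpace E] [NormedAddCommGroup F] [NormedSpace ℂ F] [CompleteSpace F]
    (L : E →L[ℂ] F) {w₀ : ℂ} {r : ℝ} {g : ℂ → E} (hg : CircleIntegrable g w₀ r) :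
    L (∮ w in C(w₀, r), g w) = ∮ w in C(w₀, r), L (g w) := by
  rw [circleIntegral, circleIntegral, ← L.intervalIntegral_comp_comm hg.out]
  simp

section Sheet

variable {X : Type*} [TopologicalSpace X] [CompactSpace X]

theorem tsupport_qdiv_subset {κ q : C(X, ℂ)} {w : ℂ} (hw : w ∉ q '' tsupport κ) :
    tsupport (qdiv κ q w) ⊆ tsupport κ := by
  refine closure_mono fun x hx => ?_
  intro h
  exact hx (by rw [qdiv_apply hw, h, zero_div])

theorem circleIntegrable_qdiv {γ q : C(X, ℂ)} {w₀ : ℂ} {r : ℝ} (hr : 0 ≤ r)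
    (hγ : ∀ w ∈ sphere w₀ r, w ∉ q '' tsupport γ) : CircleIntegrable (qdiv γ q) w₀ r := by
  refine ContinuousOn.circleIntegrable hr fun w hw => ?_
  exact (contDiffAt_qdiv (hγ w hw)).continuousAt.continuousWithinAt

theorem circleIntegral_qdiv {γ q : C(X, ℂ)} {w₀ : ℂ} {r : ℝ} (hr : 0 < r)
    (hγ : ∀ x ∈ tsupport γ, ‖q x - w₀‖ < r) :
    (∮ w in C(w₀, r), qdiv γ q w) = -(2 * Real.pi * Complex.I) • γ := by
  have hγ' : ∀ w ∈ sphere w₀ r, w ∉ q '' tsupport γ := by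
    rintro w hw ⟨x, hx, rfl⟩
    rw [mem_sphere, dist_eq_norm] at hw
    exact (hγ x hx).ne hw
  ext x
  have h1 := (ContinuousMap.evalCLM ℂ x : C(X, ℂ) →L[ℂ] ℂ).circleIntegral_comm
    (circleIntegrable_qdiv hr.le hγ')
  simp only [ContinuousMap.evalCLM_apply] at h1
  rw [h1]
  have h2 : (∮ w in C(w₀, r), qdiv γ q w x) = ∮ w in C(w₀, r), (-γ x) * (w - q x)⁻¹ := by
    refine circleIntegral.integral_congr hr.le fun w hw => ?_
    rw [qdiv_apply (hγ' w hw), ← neg_sub w (q x), div_neg, div_eq_mul_inv, neg_mul]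
  rw [h2, circleIntegral.integral_const_mul]
  by_cases hx : γ x = 0
  · simp [hx]
  · rw [circleIntegral.integral_sub_inv_of_mem_ball]
    · rw [ContinuousMap.smul_apply, smul_eq_mul]; ring
    · rw [mem_ball, dist_eq_norm]
      exact hγ x (subset_tsupport _ hx)

variable {A : Subalgebra ℂ C(X, ℂ)} {f q : A}

theorem patchKernel_sub {ρ β : C(X, ℂ)} {a b : A} {s w : ℂ}
    (h : a * (q - algebraMap ℂ A w) + b * (f - algebraMap ℂ A s) = 1)
    (hw : w ∉ (q : C(X, ℂ)) '' tsupport ρ) (hw' : w ∉ (q : C(X, ℂ)) '' tsupport β)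
    (hwκ : w ∉ (q : C(X, ℂ)) '' tsupport (ρ - β : C(X, ℂ)))
    (hs : s ∉ (f : C(X, ℂ)) '' tsupport (1 - ρ : C(X, ℂ)))
    (hs' : s ∉ (f : C(X, ℂ)) '' tsupport β)
    (hsκ : s ∉ (f : C(X, ℂ)) '' tsupport (1 - (ρ - β) : C(X, ℂ))) :
    patchKernel f q (ρ - β) a b s w = patchKernel f q ρ a b s w - qdiv (qdiv β f s) q w := by
  ext x
  have e := unimodular_apply h x
  have hD : w ∉ (q : C(X, ℂ)) '' tsupport (qdiv β f s) :=
    fun hx => hw' (Set.image_mono (tsupport_qdiv_subset hs') hx)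
  have e1 : qdiv β q w x = qdiv (qdiv β f s) q w x * ((f : C(X, ℂ)) x - s) := by
    rw [qdiv_apply hw', qdiv_apply hD, qdiv_apply hs']
    by_cases hx : β x = 0
    · simp [hx]
    · have h1 := qdiv_sub_ne hs' hx
      have h2 := qdiv_sub_ne hw' hx
      field_simp
  have e2 := qdiv_mul hD (x := x)
  have e3 : qdiv (ρ - β) q w x = qdiv ρ q w x - qdiv β q w x := by
    rw [qdiv_apply hwκ, qdiv_apply hw, qdiv_apply hw', ContinuousMap.sub_apply, sub_div]
  have e4 : qdiv (1 - (ρ - β)) f s x = qdiv (1 - ρ) f s x + qdiv β f s x := by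
    rw [qdiv_apply hsκ, qdiv_apply hs, qdiv_apply hs', ← add_div]
    simp only [ContinuousMap.sub_apply]
    ring
  change qdiv (ρ - β) q w x * (b : C(X, ℂ)) x - qdiv (1 - (ρ - β)) f s x * (a : C(X, ℂ)) x =
    qdiv ρ q w x * (b : C(X, ℂ)) x - qdiv (1 - ρ) f s x * (a : C(X, ℂ)) x -
      qdiv (qdiv β f s) q w x
  rw [e3, e4, e1, ← e2]
  linear_combination -(qdiv (qdiv β f s) q w x) * e

theorem patchKernel_mul {κ : C(X, ℂ)} {a b : A} {s w : ℂ}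
    (h : a * (q - algebraMap ℂ A w) + b * (f - algebraMap ℂ A s) = 1)
    (hw : w ∉ (q : C(X, ℂ)) '' tsupport κ)
    (hs : s ∉ (f : C(X, ℂ)) '' tsupport (1 - κ : C(X, ℂ))) :
    (f - algebraMap ℂ _ s) * patchKernel f q κ a b s w = qdiv κ q w - a := by
  ext x
  have e := unimodular_apply h x
  have e1 := qdiv_mul hw (x := x)
  have e2 := qdiv_mul hs (x := x)
  simp only [ContinuousMap.sub_apply, ContinuousMap.one_apply] at e2
  change ((f : C(X, ℂ)) x - s) *
    (qdiv κ q w x * (b : C(X, ℂ)) x - qdiv (1 - κ) f s x * (a : C(X, ℂ)) x) =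
      qdiv κ q w x - (a : C(X, ℂ)) x
  linear_combination (qdiv κ q w x) * e - (a : C(X, ℂ)) x * (e1 + e2)

end Sheet

section Sheet

variable {X : Type*} [TopologicalSpace X] [CompactSpace X]

theorem not_unimodular_apply {A : Subalgebra ℂ C(X, ℂ)} {f q : A} (x : X) :
    ¬ Unimodular A f q ((f : C(X, ℂ)) x) ((q : C(X, ℂ)) x) := by
  rintro ⟨a, b, h⟩
  simpa using unimodular_apply h x

theorem exists_cutoffs (f q : C(X, ℂ)) {w₀ : ℂ} {r δ₀ : ℝ} (hδ₀p : 0 < δ₀)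
    (hne : ∀ x, ‖f x‖ < δ₀ → ‖q x - w₀‖ ≠ r) :
    ∃ ρ β : C(X, ℂ), (∀ x, ‖f x‖ ≤ δ₀ / 3 → ρ x = 1) ∧ (∀ x ∈ tsupport ρ, ‖f x‖ < δ₀) ∧
      (∀ x, ‖q x - w₀‖ < r → β x = ρ x) ∧
      (∀ x ∈ tsupport β, ‖q x - w₀‖ < r ∧ ‖f x‖ < δ₀) ∧
      (∀ x ∈ tsupport (ρ - β : C(X, ℂ)), r < ‖q x - w₀‖) ∧
      (∀ s ∈ ball (0 : ℂ) (δ₀ / 3), s ∉ f '' tsupport (1 - ρ : C(X, ℂ))) ∧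
      ∀ s ∈ ball (0 : ℂ) (δ₀ / 3), s ∉ f '' tsupport β →
        s ∉ f '' tsupport (1 - (ρ - β) : C(X, ℂ)) := by
  let ρ : C(X, ℂ) := ⟨fun x => ((max 0 (min 1 (2 - 3 / δ₀ * ‖f x‖)) : ℝ) : ℂ), by
    fun_prop⟩
  have hρ0 : ∀ x, 2 / 3 * δ₀ ≤ ‖f x‖ → ρ x = 0 := by
    intro x hx
    have : 2 - 3 / δ₀ * ‖f x‖ ≤ 0 := by
      rw [sub_nonpos, div_mul_eq_mul_div, le_div_iff₀ hδ₀p]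
      linarith
    simp only [ρ, ContinuousMap.coe_mk]
    rw [max_eq_left ((min_le_right _ _).trans this), Complex.ofReal_zero]
  have hρ1 : ∀ x, ‖f x‖ ≤ δ₀ / 3 → ρ x = 1 := by
    intro x hx
    have : 1 ≤ 2 - 3 / δ₀ * ‖f x‖ := by
      have : 3 / δ₀ * ‖f x‖ ≤ 1 := by
        rw [div_mul_eq_mul_div, div_le_one hδ₀p]
        linarith
      linarith
    simp only [ρ, ContinuousMap.coe_mk]
    rw [min_eq_left this, max_eq_right zero_le_one, Complex.ofReal_one]
  have hρs : ∀ x ∈ tsupport ρ, ‖f x‖ < δ₀ := by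
    have : tsupport ρ ⊆ {x | ‖f x‖ ≤ 2 / 3 * δ₀} := by
      refine closure_minimal (fun x hx => ?_) (isClosed_le (by fun_prop) continuous_const)
      by_contra! h
      exact hx (hρ0 x (not_le.1 h).le)
    intro x hx
    have := this hx
    exact lt_of_le_of_lt this (by linarith)
  classical
  let β : C(X, ℂ) := ⟨fun x => if ‖q x - w₀‖ < r then ρ x else 0, by
    rw [continuous_iff_continuousAt]
    intro x
    have hcq : Continuous fun x => ‖q x - w₀‖ := by fun_prop
    rcases lt_trichotomy ‖q x - w₀‖ r with h | h | h
    · refine ρ.continuous.continuousAt.congr ?_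
      filter_upwards [hcq.continuousAt.eventually_lt continuousAt_const h] with y hy
      rw [if_pos hy]
    · have hx : x ∉ tsupport ρ := fun hx => hne x (hρs x hx) h
      refine continuousAt_const (y := (0 : ℂ)) |>.congr ?_
      filter_upwards [notMem_tsupport_iff_eventuallyEq.mp hx] with y hy
      rw [hy]
      simp
    · refine continuousAt_const (y := (0 : ℂ)) |>.congr ?_
      filter_upwards [continuousAt_const.eventually_lt hcq.continuousAt h] with y hy
      rw [if_neg hy.not_gt]⟩
  have hβin : ∀ x, ‖q x - w₀‖ < r → β x = ρ x := fun x hx => if_pos hx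
  have hβout : ∀ x, ¬ ‖q x - w₀‖ < r → β x = 0 := fun x hx => if_neg hx
  have hβs : ∀ x ∈ tsupport β, ‖q x - w₀‖ < r ∧ ‖f x‖ < δ₀ := by
    intro x hx
    have h1 : tsupport β ⊆ {x | ‖q x - w₀‖ ≤ r} := by
      refine closure_minimal (fun x hx => ?_) (isClosed_le (by fun_prop) continuous_const)
      by_contra h
      exact hx (hβout x fun h' => h h'.le)
    have h2 : tsupport β ⊆ tsupport ρ := by
      refine closure_mono fun x hx h => hx ?_
      by_cases h' : ‖q x - w₀‖ < r
      · rw [hβin x h', h]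
      · exact hβout x h'
    have h3 := hρs x (h2 hx)
    exact ⟨lt_of_le_of_ne (h1 hx) (hne x h3), h3⟩
  have hκs : ∀ x ∈ tsupport (ρ - β : C(X, ℂ)), r < ‖q x - w₀‖ := by
    intro x hx
    have h1 : tsupport (ρ - β : C(X, ℂ)) ⊆ {x | r ≤ ‖q x - w₀‖} := by
      refine closure_minimal (fun x hx => ?_) (isClosed_le continuous_const (by fun_prop))
      by_contra h
      exact hx (by rw [ContinuousMap.sub_apply, hβin x (not_le.1 h), sub_self])
    have h2 : tsupport (ρ - β : C(X, ℂ)) ⊆ tsupport ρ := by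
      refine closure_mono fun x hx h => hx ?_
      rw [ContinuousMap.sub_apply]
      by_cases h' : ‖q x - w₀‖ < r
      · rw [hβin x h', sub_self]
      · rw [hβout x h', h, sub_zero]
    exact lt_of_le_of_ne (h1 hx) (hne x (hρs x (h2 hx))).symm
  have h1ρ : ∀ x ∈ tsupport (1 - ρ : C(X, ℂ)), δ₀ / 3 ≤ ‖f x‖ := by
    have : tsupport (1 - ρ : C(X, ℂ)) ⊆ {x | δ₀ / 3 ≤ ‖f x‖} := by
      refine closure_minimal (fun x hx => ?_) (isClosed_le continuous_const (by fun_prop))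
      by_contra h
      refine hx ?_
      rw [ContinuousMap.sub_apply, hρ1 x (not_le.1 h).le, ContinuousMap.one_apply, sub_self]
    exact fun x hx => this hx
  have hball : ∀ s ∈ ball (0 : ℂ) (δ₀ / 3), s ∉ f '' tsupport (1 - ρ : C(X, ℂ)) := by
    rintro s hs ⟨x, hx, rfl⟩
    rw [mem_ball, dist_zero_right] at hs
    exact (h1ρ x hx).not_gt hs
  have hballκ : ∀ s ∈ ball (0 : ℂ) (δ₀ / 3), s ∉ f '' tsupport β →
      s ∉ f '' tsupport (1 - (ρ - β) : C(X, ℂ)) := by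
    rintro s hs hsβ ⟨x, hx, rfl⟩
    have : tsupport (1 - (ρ - β) : C(X, ℂ)) ⊆ tsupport (1 - ρ : C(X, ℂ)) ∪ tsupport β := by
      rw [show (1 - (ρ - β) : C(X, ℂ)) = (1 - ρ) + β by ring]
      exact tsupport_add _ _
    rcases this hx with h | h
    · exact hball _ hs ⟨x, h, rfl⟩
    · exact hsβ ⟨x, h, rfl⟩
  exact ⟨ρ, β, hρ1, hρs, hβin, hβs, hκs, hball, hballκ⟩

/-- A separated part of the variety `f = 0` inside the disc `|q - w₀| < r` gives a cutoff `β`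
localizing there such that the transform `ν (β / (f - s))` of any annihilating functional `ν`
differs by a holomorphic function from a function counting the sheet. -/
theorem exists_sheet (A : Subalgebra ℂ C(X, ℂ)) [CompleteSpace A] (f q : A) {w₀ : ℂ} {r δ₁ : ℝ}
    (hr : 0 < r) (hδ₁ : 0 < δ₁) (hU : ∀ w ∈ sphere w₀ r, Unimodular A f q 0 w) :
    ∃ δ > 0, δ ≤ δ₁ ∧ ∃ β : C(X, ℂ),
      (∀ x ∈ tsupport β, ‖(q : C(X, ℂ)) x - w₀‖ < r ∧ ‖(f : C(X, ℂ)) x‖ < δ₁) ∧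
      (∀ x, ‖(f : C(X, ℂ)) x‖ < δ → ‖(q : C(X, ℂ)) x - w₀‖ < r → β x = 1) ∧
      ∀ ν : C(X, ℂ) →L[ℂ] ℂ, (∀ g ∈ A, ν g = 0) → ∃ Λ : ℂ → ℂ,
        DifferentiableOn ℂ Λ (ball 0 δ) ∧
        (∀ s ∈ ball (0 : ℂ) δ, s ∉ (f : C(X, ℂ)) '' tsupport β →
          (∀ w ∈ closedBall w₀ r, Unimodular A f q s w) → Λ s + ν (qdiv β f s) = 0) ∧
        ∀ s ∈ ball (0 : ℂ) δ, s ∉ (f : C(X, ℂ)) '' tsupport β → ∀ μ : C(X, ℂ) →L[ℂ] ℂ,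
          (∀ g, ν g = μ ((f - algebraMap ℂ _ s) * g)) →
          (∀ a ∈ A, ∀ b ∈ A, μ (a * b) = μ a * μ b) → μ 1 = 1 → ‖μ q - w₀‖ < r →
          Λ s + ν (qdiv β f s) = 1 := by
  obtain ⟨δ₂, hδ₂, hU₂⟩ : ∃ δ₂ > 0, ∀ s ∈ ball (0 : ℂ) δ₂, ∀ w ∈ sphere w₀ r,
      Unimodular A f q s w := by
    have h1 : ∀ᶠ s in 𝓝 (0 : ℂ), ∀ w ∈ sphere w₀ r, Unimodular A f q s w := by
      refine (isCompact_sphere w₀ r).eventually_forall_of_forall_eventually fun w hw => ?_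
      exact (isOpen_unimodular f q).mem_nhds (hU w hw)
    obtain ⟨δ₂, hδ₂, h2⟩ := Metric.eventually_nhds_iff_ball.1 h1
    exact ⟨δ₂, hδ₂, h2⟩
  set δ₀ := min δ₁ δ₂ with hδ₀
  have hδ₀p : 0 < δ₀ := lt_min hδ₁ hδ₂
  have hne : ∀ x, ‖(f : C(X, ℂ)) x‖ < δ₀ → ‖(q : C(X, ℂ)) x - w₀‖ ≠ r := by
    intro x hx hq
    refine not_unimodular_apply x (hU₂ _ ?_ _ ?_)
    · rw [mem_ball, dist_zero_right]
      exact hx.trans_le (min_le_right _ _)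
    · rw [mem_sphere, dist_eq_norm, hq]
  obtain ⟨ρ, β, hρ1, hρs, hβin, hβs, hκs, hball, hballκ⟩ :=
    exists_cutoffs (f : C(X, ℂ)) (q : C(X, ℂ)) hδ₀p hne
  have hsub : ∀ s ∈ ball (0 : ℂ) (δ₀ / 3), s ∈ ball (0 : ℂ) δ₂ := by
    intro s hs
    refine ball_subset_ball ?_ hs
    have := min_le_right δ₁ δ₂
    linarith
  have hwκ : ∀ w ∈ closedBall w₀ r, w ∉ (q : C(X, ℂ)) '' tsupport (ρ - β : C(X, ℂ)) := by
    rintro w hw ⟨x, hx, rfl⟩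
    rw [mem_closedBall, dist_eq_norm] at hw
    exact hw.not_gt (hκs x hx)
  have hwρ : ∀ w ∈ sphere w₀ r, w ∉ (q : C(X, ℂ)) '' tsupport ρ := by
    rintro w hw ⟨x, hx, rfl⟩
    rw [mem_sphere, dist_eq_norm] at hw
    exact hne x (hρs x hx) hw
  have hwβ : ∀ w ∈ sphere w₀ r, w ∉ (q : C(X, ℂ)) '' tsupport β := by
    rintro w hw ⟨x, hx, rfl⟩
    rw [mem_sphere, dist_eq_norm] at hw
    exact (hβs x hx).1.ne hw
  refine ⟨δ₀ / 3, by positivity, ?_, β, ?_, ?_, ?_⟩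
  · have := min_le_left δ₁ δ₂
    linarith
  · exact fun x hx => ⟨(hβs x hx).1, (hβs x hx).2.trans_le (min_le_left _ _)⟩
  · intro x hx hq
    rw [hβin x hq, hρ1 x hx.le]
  intro ν hν
  have hpi : (2 * Real.pi * Complex.I : ℂ) ≠ 0 := Complex.two_pi_I_ne_zero
  have hrel : ∀ s ∈ ball (0 : ℂ) (δ₀ / 3), s ∉ (f : C(X, ℂ)) '' tsupport β →
      (2 * Real.pi * Complex.I)⁻¹ * (∮ w in C(w₀, r), patchInt ν f q ρ (s, w)) +
        ν (qdiv β f s) =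
      (2 * Real.pi * Complex.I)⁻¹ * ∮ w in C(w₀, r), patchInt ν f q (ρ - β) (s, w) := by
    intro s hs hsβ
    have hγ : ∀ x ∈ tsupport (qdiv β f s), ‖(q : C(X, ℂ)) x - w₀‖ < r :=
      fun x hx => (hβs x (tsupport_qdiv_subset hsβ hx)).1
    have hγ' : ∀ w ∈ sphere w₀ r, w ∉ (q : C(X, ℂ)) '' tsupport (qdiv β f s) :=
      fun w hw hx => hwβ w hw (Set.image_mono (tsupport_qdiv_subset hsβ) hx)
    have e1 : (∮ w in C(w₀, r), patchInt ν f q (ρ - β) (s, w)) =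
        ∮ w in C(w₀, r), (patchInt ν f q ρ (s, w) - ν (qdiv (qdiv β f s) q w)) := by
      refine circleIntegral.integral_congr hr.le fun w hw => ?_
      obtain ⟨a, b, h⟩ := hU₂ s (hsub s hs) w hw
      rw [patchInt_eq hν (hwκ w (sphere_subset_closedBall hw)) (hballκ s hs hsβ) h,
        patchInt_eq hν (hwρ w hw) (hball s hs) h, ← map_sub,
        patchKernel_sub h (hwρ w hw) (hwβ w hw) (hwκ w (sphere_subset_closedBall hw))
          (hball s hs) hsβ (hballκ s hs hsβ)]
    have i1 : CircleIntegrable (fun w => patchInt ν f q ρ (s, w)) w₀ r := by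
      refine ContinuousOn.circleIntegrable hr.le fun w hw => ?_
      exact (ContinuousAt.comp (f := fun w => (s, w))
        (contDiffAt_patchInt hν (hwρ w hw) (hball s hs) (hU₂ s (hsub s hs) w hw)).continuousAt
        (by fun_prop)).continuousWithinAt
    have i2 : CircleIntegrable (fun w => ν (qdiv (qdiv β f s) q w)) w₀ r := by
      refine ContinuousOn.circleIntegrable hr.le fun w hw => ?_
      exact (ν.continuous.continuousAt.comp
        (contDiffAt_qdiv (hγ' w hw)).continuousAt).continuousWithinAt
    rw [e1, circleIntegral.integral_sub i1 i2, mul_sub,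
      ← ν.circleIntegral_comm (circleIntegrable_qdiv hr.le hγ'), circleIntegral_qdiv hr hγ,
      map_smul, smul_eq_mul]
    field_simp
    ring
  refine ⟨fun s => (2 * Real.pi * Complex.I)⁻¹ * ∮ w in C(w₀, r), patchInt ν f q ρ (s, w),
    ?_, ?_, ?_⟩
  · refine DifferentiableOn.const_mul ?_ _
    exact differentiableOn_circleIntegral hr.le isOpen_ball fun s hs w hw =>
      contDiffAt_patchInt hν (hwρ w hw) (hball s hs) (hU₂ s (hsub s hs) w hw)
  · intro s hs hsβ hUs
    have hd : ∀ w ∈ closedBall w₀ r,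
        DifferentiableAt ℂ (fun w => patchInt ν f q (ρ - β) (s, w)) w := by
      intro w hw
      have h1 := (contDiffAt_patchInt hν (hwκ w hw) (hballκ s hs hsβ)
        (hUs w hw)).differentiableAt one_ne_zero
      exact DifferentiableAt.comp (f := fun w => (s, w)) w h1 (by fun_prop)
    rw [hrel s hs hsβ]
    rw [Complex.circleIntegral_eq_zero_of_differentiable_on_off_countable hr.le
      Set.countable_empty (fun w hw => (hd w hw).continuousAt.continuousWithinAt)
      (fun w hw => hd w (ball_subset_closedBall hw.1)), mul_zero]
  · intro s hs hsβ μ hνμ hmul hμ1 hq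
    rw [hrel s hs hsβ]
    have hs0 : μ ((f : C(X, ℂ)) - algebraMap ℂ _ s) = 0 := by
      have := hνμ 1
      rw [mul_one, hν 1 A.one_mem] at this
      exact this.symm
    have hin : μ q ∈ ball w₀ r := by rwa [mem_ball, dist_eq_norm]
    have hd : ∀ w ∈ closedBall w₀ r, DifferentiableAt ℂ (fun w => μ (qdiv (ρ - β) q w)) w :=
      fun w hw => (μ.differentiableAt).comp w
        ((contDiffAt_qdiv (hwκ w hw)).differentiableAt one_ne_zero)
    have e1 : (∮ w in C(w₀, r), patchInt ν f q (ρ - β) (s, w)) =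
        ∮ w in C(w₀, r), (μ (qdiv (ρ - β) q w) - -(w - μ q)⁻¹) := by
      refine circleIntegral.integral_congr hr.le fun w hw => ?_
      obtain ⟨a, b, h⟩ := hU₂ s (hsub s hs) w hw
      have hwc := hwκ w (sphere_subset_closedBall hw)
      rw [patchInt_eq hν hwc (hballκ s hs hsβ) h, hνμ,
        patchKernel_mul h hwc (hballκ s hs hsβ), map_sub]
      have h2 := congrArg (fun g : A => μ (g : C(X, ℂ))) h
      have h3 : μ ((q : C(X, ℂ)) - algebraMap ℂ _ w) = μ q - w := by
        rw [map_sub, Algebra.algebraMap_eq_smul_one, map_smul, hμ1]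
        simp
      have h4 : μ ((a : C(X, ℂ)) * (q - algebraMap ℂ _ w) +
          (b : C(X, ℂ)) * (f - algebraMap ℂ _ s)) = 1 := by
        rw [← hμ1]
        exact h2
      rw [map_add, hmul _ a.2 _ (A.sub_mem q.2 (A.algebraMap_mem w)),
        hmul _ b.2 _ (A.sub_mem f.2 (A.algebraMap_mem s)), hs0, h3, mul_zero, add_zero] at h4
      have h5 : w - μ q ≠ 0 := by
        intro h6
        rw [show μ (q : C(X, ℂ)) - w = 0 by linear_combination -h6, mul_zero] at h4
        exact zero_ne_one h4
      have h6 : μ (a : C(X, ℂ)) = -(w - μ q)⁻¹ := by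
        field_simp
        linear_combination -h4
      rw [h6]
    have i1 : CircleIntegrable (fun w => μ (qdiv (ρ - β) q w)) w₀ r :=
      ContinuousOn.circleIntegrable hr.le fun w hw =>
        (hd w (sphere_subset_closedBall hw)).continuousAt.continuousWithinAt
    have i2 : CircleIntegrable (fun w => -(w - μ q)⁻¹) w₀ r := by
      refine ContinuousOn.circleIntegrable hr.le fun w hw => ?_
      have : w - μ q ≠ 0 := by
        intro h
        rw [← sub_eq_zero.1 h, mem_ball] at hin
        exact hin.ne (mem_sphere.1 hw)
      have h2 : ContinuousAt (fun w => -(w - μ q)⁻¹) w := by fun_prop (disch := assumption)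
      exact h2.continuousWithinAt
    rw [e1, circleIntegral.integral_sub i1 i2,
      Complex.circleIntegral_eq_zero_of_differentiable_on_off_countable hr.le
      Set.countable_empty (fun w hw => (hd w hw).continuousAt.continuousWithinAt)
      (fun w hw => hd w (ball_subset_closedBall hw.1))]
    have : (∮ w in C(w₀, r), -(w - μ q)⁻¹) = -(2 * Real.pi * Complex.I) := by
      rw [← circleIntegral.integral_sub_inv_of_mem_ball hin]
      simp [circleIntegral, intervalIntegral.integral_neg]
    rw [this]
    field_simp
    ring

end Sheet

theorem Submodule.exists_dual_ne_zero_of_notMem {E : Type*} [NormedAddCommGroup E]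
    [NormedSpace ℂ E] (S : Submodule ℂ E) (hS : IsClosed (S : Set E)) {x : E} (hx : x ∉ S) :
    ∃ ν : E →L[ℂ] ℂ, (∀ g ∈ S, ν g = 0) ∧ ν x ≠ 0 := by
  have : IsClosed (S : Set E) := hS
  have h : (S.mkQL x : E ⧸ S) ≠ 0 := by
    simpa [Submodule.Quotient.mk_eq_zero] using hx
  obtain ⟨f, hf⟩ := SeparatingDual.exists_ne_zero (R := ℂ) h
  refine ⟨f.comp S.mkQL, fun g hg => ?_, hf⟩
  have : S.mkQL g = 0 := by simpa [Submodule.Quotient.mk_eq_zero] using hg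
  rw [ContinuousLinearMap.comp_apply, this, map_zero]

section Char

variable {X : Type*} [TopologicalSpace X] [CompactSpace X] {A : Subalgebra ℂ C(X, ℂ)}

/-- A functional on `C(X)` whose restriction to `A` is a character. -/
def IsCharOn (A : Subalgebra ℂ C(X, ℂ)) (μ : C(X, ℂ) →L[ℂ] ℂ) : Prop :=
  (∀ a ∈ A, ∀ b ∈ A, μ (a * b) = μ a * μ b) ∧ μ 1 = 1

theorem IsCharOn.pow {μ : C(X, ℂ) →L[ℂ] ℂ} (hμ : IsCharOn A μ) {a : C(X, ℂ)} (ha : a ∈ A)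
    (n : ℕ) : μ (a ^ n) = μ a ^ n := by
  induction n with
  | zero => simp [hμ.2]
  | succ n ih => rw [pow_succ, hμ.1 _ (A.pow_mem ha n) _ ha, ih, pow_succ]

theorem norm_le_of_pow_le {C t R : ℝ} (hR : 0 ≤ R)
    (h : ∀ n : ℕ, t ^ n ≤ C * R ^ n) : t ≤ R := by
  by_contra! hlt
  rcases hR.eq_or_lt with rfl | hR
  · have := h 1
    simp only [pow_one, mul_zero] at this
    exact absurd this (not_le.2 hlt)
  have h1 : 1 < t / R := (one_lt_div hR).2 hlt
  obtain ⟨n, hn⟩ := pow_unbounded_of_one_lt C h1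
  have := h n
  rw [div_pow, lt_div_iff₀ (by positivity)] at hn
  linarith

theorem IsCharOn.norm_le {μ : C(X, ℂ) →L[ℂ] ℂ} (hμ : IsCharOn A μ) {a : C(X, ℂ)} (ha : a ∈ A) :
    ‖μ a‖ ≤ ‖a‖ := by
  refine norm_le_of_pow_le (C := ‖μ‖) (norm_nonneg _) fun n => ?_
  rw [← norm_pow, ← hμ.pow ha]
  have h1 : ‖a ^ n‖ ≤ ‖a‖ ^ n := by
    refine (ContinuousMap.norm_le _ (by positivity)).2 fun x => ?_
    rw [ContinuousMap.pow_apply, norm_pow]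
    exact pow_le_pow_left₀ (norm_nonneg _) (a.norm_coe_le_norm x) n
  exact (μ.le_opNorm _).trans (mul_le_mul_of_nonneg_left h1 (norm_nonneg _))

theorem exists_isCharOn [CompleteSpace A] {f q : A} {s w : ℂ} (h : ¬ Unimodular A f q s w) :
    ∃ μ : C(X, ℂ) →L[ℂ] ℂ, IsCharOn A μ ∧ μ f = s ∧ μ q = w := by
  let I : Ideal A := Ideal.span {q - algebraMap ℂ A w, f - algebraMap ℂ A s}
  have hI : I ≠ ⊤ := by
    intro h1
    rw [Ideal.eq_top_iff_one, Ideal.mem_span_pair] at h1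
    exact h h1
  have : Nontrivial A := by
    by_contra h1
    rw [not_nontrivial_iff_subsingleton] at h1
    exact h ⟨0, 0, Subsingleton.elim _ _⟩
  obtain ⟨M, hM, hIM⟩ := Ideal.exists_le_maximal I hI
  let m := M.toCharacterSpace
  have hm : ∀ a ∈ I, m a = 0 := fun a ha => M.toCharacterSpace_apply_eq_zero_of_mem (hIM ha)
  let L : (Subalgebra.toSubmodule A) →L[ℂ] ℂ :=
    WeakDual.CharacterSpace.toCLM m
  obtain ⟨μ, hμ, -⟩ := exists_extension_norm_eq (Subalgebra.toSubmodule A) L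
  have hμ' : ∀ a : A, μ a = m a := fun a => hμ a
  refine ⟨μ, ⟨fun a ha b hb => ?_, ?_⟩, ?_, ?_⟩
  · have := hμ' (⟨a, ha⟩ * ⟨b, hb⟩)
    rw [map_mul, ← hμ', ← hμ'] at this
    exact this
  · have := hμ' 1
    rw [map_one] at this
    exact this
  · have := hm _ (Ideal.subset_span (Set.mem_insert_of_mem _ rfl))
    rw [map_sub, sub_eq_zero, AlgHomClass.commutes] at this
    rw [hμ', this]; rfl
  · have := hm _ (Ideal.subset_span (Set.mem_insert _ _))
    rw [map_sub, sub_eq_zero, AlgHomClass.commutes] at this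
    rw [hμ', this]; rfl

/-- The essential set of a subalgebra: the common zeros of the ideal of `C(X)` it contains. -/
def essSet (A : Subalgebra ℂ C(X, ℂ)) : Set X :=
  {x | ∀ u : C(X, ℂ), (∀ v : C(X, ℂ), u * v ∈ A) → u x = 0}

theorem isClosed_essSet (A : Subalgebra ℂ C(X, ℂ)) : IsClosed (essSet A) := by
  have : essSet A = ⋂ u : C(X, ℂ), ⋂ _ : ∀ v : C(X, ℂ), u * v ∈ A, {x | u x = 0} := by
    ext x
    simp [essSet]
  rw [this]
  exact isClosed_iInter fun u => isClosed_iInter fun _ =>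
    isClosed_eq u.continuous continuous_const

theorem mem_of_eqOn_essSet [T2Space X] (hA : IsClosed (A : Set C(X, ℂ))) {g : C(X, ℂ)}
    (hg : ∀ x ∈ essSet A, g x = 0) : g ∈ A := by
  let J : Ideal C(X, ℂ) :=
    { carrier := {u | ∀ v : C(X, ℂ), u * v ∈ A}
      add_mem' := fun {a b} ha hb v => by
        rw [add_mul]
        exact A.add_mem (ha v) (hb v)
      zero_mem' := fun v => by
        rw [zero_mul]
        exact A.zero_mem
      smul_mem' := fun c u hu v => by
        rw [smul_eq_mul, mul_comm c u, mul_assoc]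
        exact hu _ }
  have hJ : IsClosed (J : Set C(X, ℂ)) := by
    have : (J : Set C(X, ℂ)) = ⋂ v : C(X, ℂ), (fun u => u * v) ⁻¹' A := by
      ext u
      simp [J]
    rw [this]
    exact isClosed_iInter fun v => hA.preimage (by fun_prop)
  have h1 : g ∈ ContinuousMap.idealOfSet ℂ (ContinuousMap.setOfIdeal J) := by
    rw [ContinuousMap.mem_idealOfSet]
    intro x hx
    refine hg x fun u hu => ?_
    exact ContinuousMap.notMem_setOfIdeal.1 hx hu
  rw [ContinuousMap.idealOfSet_ofIdeal_isClosed hJ] at h1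
  have := h1 1
  rwa [mul_one] at this

theorem notMem_essSet (hA : IsClosed (A : Set C(X, ℂ))) {x : X} {u : C(X, ℂ)} (hu : u x ≠ 0)
    (h : ∀ ν : C(X, ℂ) →L[ℂ] ℂ, (∀ g ∈ A, ν g = 0) → ∀ v, ν (u * v) = 0) : x ∉ essSet A := by
  intro hx
  refine hu (hx u fun v => ?_)
  by_contra hv
  obtain ⟨ν, hν, hne⟩ :=
    (Subalgebra.toSubmodule A).exists_dual_ne_zero_of_notMem (x := u * v) hA hv
  exact hne (h ν hν v)

end Char

section PolyAlg

variable {n : ℕ} (K : Set (Fin n → ℂ))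

/-- A coordinate function on a subset of `ℂⁿ`. -/
def coordFun (i : Fin n) : C(K, ℂ) := ⟨fun x => x.1 i, (continuous_apply i).comp continuous_subtype_val⟩

/-- Restriction of polynomials to a set. -/
def polyMap : MvPolynomial (Fin n) ℂ →ₐ[ℂ] C(K, ℂ) := MvPolynomial.aeval (coordFun K)

theorem polyMap_apply (p : MvPolynomial (Fin n) ℂ) (x : K) :
    polyMap K p x = MvPolynomial.eval x.1 p := by
  induction p using MvPolynomial.induction_on with
  | C a => simp [polyMap]
  | add p q hp hq => rw [map_add, map_add, ContinuousMap.add_apply, hp, hq]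
  | mul_X p i hp =>
    rw [map_mul, map_mul, ContinuousMap.mul_apply, hp]
    simp [polyMap, coordFun]

theorem polyMap_X (i : Fin n) : polyMap K (MvPolynomial.X i) = coordFun K i := by
  simp [polyMap]

variable [CompactSpace K]

/-- The uniform closure of the polynomials on a compact set. -/
def polyAlg : Subalgebra ℂ C(K, ℂ) := (polyMap K).range.topologicalClosure

theorem isClosed_polyAlg : IsClosed (polyAlg K : Set C(K, ℂ)) :=
  Subalgebra.isClosed_topologicalClosure _

instance : CompleteSpace (polyAlg K) := (isClosed_polyAlg K).completeSpace_coe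

variable {K}

theorem polyMap_mem (p : MvPolynomial (Fin n) ℂ) : polyMap K p ∈ polyAlg K :=
  Subalgebra.le_topologicalClosure _ ⟨p, rfl⟩

theorem coordFun_mem (i : Fin n) : coordFun K i ∈ polyAlg K := by
  rw [← polyMap_X]
  exact polyMap_mem _

theorem mem_polyAlg_iff {g : C(K, ℂ)} :
    g ∈ polyAlg K ↔ ∀ ε > 0, ∃ p, ‖g - polyMap K p‖ < ε := by
  rw [polyAlg, ← SetLike.mem_coe, Subalgebra.topologicalClosure_coe, Metric.mem_closure_iff]
  simp [dist_eq_norm]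

theorem norm_eval_le_of_mem_polyHull {y : Fin n → ℂ} (hy : y ∈ polyHull n K)
    (p : MvPolynomial (Fin n) ℂ) : ‖MvPolynomial.eval y p‖ ≤ ‖polyMap K p‖ := by
  refine (hy p).trans (Real.sSup_le ?_ (norm_nonneg _))
  rintro _ ⟨w, hw, rfl⟩
  have := (polyMap K p).norm_coe_le_norm ⟨w, hw⟩
  rwa [polyMap_apply] at this

theorem mem_polyHull_of_norm_eval_le {y : Fin n → ℂ}
    (h : ∀ p : MvPolynomial (Fin n) ℂ, ‖MvPolynomial.eval y p‖ ≤ ‖polyMap K p‖) :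
    y ∈ polyHull n K := by
  intro p
  have h0 : 0 ≤ sSup ((fun w => ‖MvPolynomial.eval w p‖) '' K) := by
    refine Real.sSup_nonneg ?_
    rintro _ ⟨w, -, rfl⟩
    exact norm_nonneg _
  refine (h p).trans ((ContinuousMap.norm_le _ h0).2 fun x => ?_)
  rw [polyMap_apply]
  refine le_csSup ⟨‖polyMap K p‖, ?_⟩ ⟨x.1, x.2, rfl⟩
  rintro _ ⟨w, hw, rfl⟩
  have := (polyMap K p).norm_coe_le_norm ⟨w, hw⟩
  rwa [polyMap_apply] at this

theorem subset_polyHull : K ⊆ polyHull n K := fun x hx =>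
  mem_polyHull_of_norm_eval_le fun p => by
    have := (polyMap K p).norm_coe_le_norm ⟨x, hx⟩
    rwa [polyMap_apply] at this

theorem isCharOn_polyAlg {μ : C(K, ℂ) →L[ℂ] ℂ}
    (h : ∀ p q, μ (polyMap K p * polyMap K q) = μ (polyMap K p) * μ (polyMap K q))
    (h1 : μ 1 = 1) : IsCharOn (polyAlg K) μ := by
  refine ⟨?_, h1⟩
  have hd : ∀ a ∈ polyAlg K, ∀ q, μ (a * polyMap K q) = μ a * μ (polyMap K q) := by
    intro a ha q
    have hc : IsClosed {a : C(K, ℂ) | μ (a * polyMap K q) = μ a * μ (polyMap K q)} :=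
      isClosed_eq (by fun_prop) (by fun_prop)
    have : closure ((polyMap K).range : Set C(K, ℂ)) ⊆ _ := closure_minimal
      (fun a ⟨p, hp⟩ => by subst hp; exact h p q) hc
    exact this ha
  intro a ha b hb
  have hc : IsClosed {b : C(K, ℂ) | μ (a * b) = μ a * μ b} :=
    isClosed_eq (by fun_prop) (by fun_prop)
  have : closure ((polyMap K).range : Set C(K, ℂ)) ⊆ _ := closure_minimal
    (fun b ⟨q, hq⟩ => by subst hq; exact hd a ha q) hc
  exact this hb

theorem exists_isCharOn_of_mem_polyHull {y : Fin n → ℂ} (hy : y ∈ polyHull n K) :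
    ∃ μ : C(K, ℂ) →L[ℂ] ℂ, IsCharOn (polyAlg K) μ ∧ ‖μ‖ ≤ 1 ∧
      ∀ p, μ (polyMap K p) = MvPolynomial.eval y p := by
  let S : Submodule ℂ C(K, ℂ) := LinearMap.range (polyMap K).toLinearMap
  have hS : ∀ g : S, ∃ p, polyMap K p = g := fun g => g.2
  choose c hc using hS
  have key : ∀ p q, polyMap K p = polyMap K q → MvPolynomial.eval y p = MvPolynomial.eval y q := by
    intro p q hpq
    have := norm_eval_le_of_mem_polyHull hy (p - q)
    rw [map_sub, map_sub, hpq, sub_self, norm_zero, norm_le_zero_iff, sub_eq_zero] at this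
    exact this
  let L₀ : S →ₗ[ℂ] ℂ :=
    { toFun := fun g => MvPolynomial.eval y (c g)
      map_add' := fun g g' => by
        rw [← map_add]
        refine key _ _ ?_
        rw [hc, map_add, hc, hc]
        rfl
      map_smul' := fun t g => by
        rw [RingHom.id_apply, smul_eq_mul, ← MvPolynomial.smul_eval]
        refine key _ _ ?_
        rw [hc, map_smul, hc]
        rfl }
  let L : S →L[ℂ] ℂ := L₀.mkContinuous 1 fun g => by
    rw [one_mul]
    refine (norm_eval_le_of_mem_polyHull hy _).trans ?_
    rw [hc]
    rfl
  have hL : ‖L‖ ≤ 1 := LinearMap.mkContinuous_norm_le _ zero_le_one _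
  obtain ⟨μ, hμ, hn⟩ := exists_extension_norm_eq S L
  have hval : ∀ p, μ (polyMap K p) = MvPolynomial.eval y p := by
    intro p
    have h1 := hμ ⟨polyMap K p, p, rfl⟩
    rw [h1]
    exact key _ _ (hc _)
  refine ⟨μ, isCharOn_polyAlg (fun p q => ?_) ?_, hn.trans_le hL, hval⟩
  · rw [← map_mul, hval, hval, hval, map_mul]
  · rw [← map_one (polyMap K), hval, map_one]

theorem IsCharOn.apply_polyMap {μ : C(K, ℂ) →L[ℂ] ℂ} (hμ : IsCharOn (polyAlg K) μ)
    (p : MvPolynomial (Fin n) ℂ) :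
    μ (polyMap K p) = MvPolynomial.eval (fun i => μ (coordFun K i)) p := by
  induction p using MvPolynomial.induction_on with
  | C a =>
    have : polyMap K (MvPolynomial.C a) = a • (1 : C(K, ℂ)) := by
      ext x
      simp [polyMap]
    rw [this, map_smul, hμ.2]
    simp
  | add p q hp hq => rw [map_add, map_add, map_add, hp, hq]
  | mul_X p i hp =>
    rw [map_mul (polyMap K), hμ.1 _ (polyMap_mem p) _ (polyMap_mem _), hp, polyMap_X,
      map_mul (MvPolynomial.eval _), MvPolynomial.eval_X]

theorem IsCharOn.mem_polyHull {μ : C(K, ℂ) →L[ℂ] ℂ} (hμ : IsCharOn (polyAlg K) μ) :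
    (fun i => μ (coordFun K i)) ∈ polyHull n K :=
  mem_polyHull_of_norm_eval_le fun p => by
    rw [← hμ.apply_polyMap]
    exact hμ.norm_le (polyMap_mem p)

theorem exists_sum_coordFun_sub_mul_eq_one {y : Fin n → ℂ} (hy : y ∉ K) :
    ∃ b : Fin n → C(K, ℂ), ∑ i, (coordFun K i - algebraMap ℂ _ (y i)) * b i = 1 := by
  have hne : ∀ x : K, ((∑ j, Complex.normSq (x.1 j - y j) : ℝ) : ℂ) ≠ 0 := by
    intro x h
    rw [Complex.ofReal_eq_zero, Finset.sum_eq_zero_iff_of_nonneg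
      (fun _ _ => Complex.normSq_nonneg _)] at h
    refine hy ?_
    have : x.1 = y := by
      funext j
      have := h j (Finset.mem_univ j)
      rwa [map_eq_zero, sub_eq_zero] at this
    exact this ▸ x.2
  have hc : ∀ i, Continuous fun x : K => x.1 i := fun i => (coordFun K i).continuous
  refine ⟨fun i => ⟨fun x => (starRingEnd ℂ) (x.1 i - y i) /
    ((∑ j, Complex.normSq (x.1 j - y j) : ℝ) : ℂ), ?_⟩, ?_⟩
  · refine Continuous.div (RCLike.continuous_conj.comp ((hc i).sub continuous_const)) ?_ hne
    refine Complex.continuous_ofReal.comp (continuous_finsetSum _ fun j _ => ?_)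
    exact Complex.continuous_normSq.comp ((hc j).sub continuous_const)
  · ext x
    rw [ContinuousMap.sum_apply]
    simp only [ContinuousMap.mul_apply, ContinuousMap.sub_apply, ContinuousMap.coe_mk,
      ContinuousMap.one_apply]
    have : ∀ i, (coordFun K i x - (algebraMap ℂ C(K, ℂ) (y i)) x) * ((starRingEnd ℂ) (x.1 i - y i) /
        ((∑ j, Complex.normSq (x.1 j - y j) : ℝ) : ℂ)) = (Complex.normSq (x.1 i - y i) : ℂ) /
        ((∑ j, Complex.normSq (x.1 j - y j) : ℝ) : ℂ) := by
      intro i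
      rw [← Complex.mul_conj, mul_div_assoc]
      rfl
    rw [Finset.sum_congr rfl fun i _ => this i, ← Finset.sum_div, ← Complex.ofReal_sum,
      div_self (hne x)]

/-- Points of the hull off the set are controlled by the essential set. -/
theorem norm_eval_le_of_essSet {y : Fin n → ℂ} (hy : y ∈ polyHull n K) (hyK : y ∉ K)
    {R : ℝ} (hR : 0 ≤ R) {p : MvPolynomial (Fin n) ℂ}
    (hp : ∀ x ∈ essSet (polyAlg K), ‖MvPolynomial.eval x.1 p‖ ≤ R) :
    ‖MvPolynomial.eval y p‖ ≤ R := by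
  obtain ⟨μ, hμ, hμn, hval⟩ := exists_isCharOn_of_mem_polyHull hy
  obtain ⟨b, hb⟩ := exists_sum_coordFun_sub_mul_eq_one hyK
  have hvan : ∀ g : C(K, ℂ), (∀ x ∈ essSet (polyAlg K), g x = 0) → μ g = 0 := by
    intro g hg
    have e : g = ∑ i, (coordFun K i - algebraMap ℂ _ (y i)) * (g * b i) := by
      calc g = g * ∑ i, (coordFun K i - algebraMap ℂ _ (y i)) * b i := by rw [hb, mul_one]
        _ = _ := by rw [Finset.mul_sum]; exact Finset.sum_congr rfl fun i _ => by ring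
    rw [e, map_sum]
    refine Finset.sum_eq_zero fun i _ => ?_
    have h1 : g * b i ∈ polyAlg K := mem_of_eqOn_essSet (isClosed_polyAlg K) fun x hx => by
      rw [ContinuousMap.mul_apply, hg x hx, zero_mul]
    rw [hμ.1 _ ((polyAlg K).sub_mem (coordFun_mem i) ((polyAlg K).algebraMap_mem _)) _ h1,
      map_sub, Algebra.algebraMap_eq_smul_one, map_smul, hμ.2, ← polyMap_X, hval]
    simp
  let T : ℂ → ℂ := fun z => ((R / max R ‖z‖ : ℝ) : ℂ) * z
  rcases hR.eq_or_lt with rfl | hR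
  · rw [← hval, hvan _ fun x hx => by
      rw [polyMap_apply]; exact norm_le_zero_iff.1 (hp x hx), norm_zero]
  have hT : Continuous T := by
    refine Continuous.mul (Complex.continuous_ofReal.comp ?_) continuous_id
    refine continuous_const.div (continuous_const.max continuous_norm) fun z => ?_
    exact (lt_max_of_lt_left hR).ne'
  have hTn : ∀ z, ‖T z‖ ≤ R := by
    intro z
    have hpos : 0 < max R ‖z‖ := lt_max_of_lt_left hR
    rw [norm_mul, Complex.norm_real, Real.norm_of_nonneg (by positivity), div_mul_eq_mul_div,
      div_le_iff₀ hpos]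
    exact mul_le_mul_of_nonneg_left (le_max_right _ _) hR.le
  have hTe : ∀ z, ‖z‖ ≤ R → T z = z := by
    intro z hz
    simp only [T, max_eq_left hz, div_self hR.ne', Complex.ofReal_one, one_mul]
  let g : C(K, ℂ) := ⟨fun x => T (polyMap K p x), by fun_prop⟩
  have h1 : μ (polyMap K p) = μ g := by
    rw [← sub_eq_zero, ← map_sub]
    refine hvan _ fun x hx => ?_
    rw [ContinuousMap.sub_apply, sub_eq_zero]
    refine (hTe _ ?_).symm
    rw [polyMap_apply]
    exact hp x hx
  rw [← hval, h1]
  refine (μ.le_opNorm _).trans ?_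
  have h2 : ‖g‖ ≤ R := (ContinuousMap.norm_le _ hR.le).2 fun x => hTn _
  nlinarith [norm_nonneg g, norm_nonneg μ]

theorem polyHull_eq_of_essSet_eq_empty (h : essSet (polyAlg K) = ∅) : polyHull n K = K := by
  refine Set.Subset.antisymm (fun y hy => ?_) subset_polyHull
  by_contra hyK
  have := norm_eval_le_of_essSet hy hyK le_rfl (p := 1) (by simp [h])
  norm_num at this

theorem polyAlg_eq_top_iff : polyAlg K = ⊤ ↔ essSet (polyAlg K) = ∅ := by
  constructor
  · intro h
    rw [Set.eq_empty_iff_forall_notMem]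
    intro x hx
    have := hx 1 fun v => by rw [h]; trivial
    norm_num at this
  · intro h
    rw [eq_top_iff]
    rintro g -
    exact mem_of_eqOn_essSet (isClosed_polyAlg K) (by simp [h])

theorem sum_norm_sq_le_of_essSet {y : Fin n → ℂ} (hy : y ∈ polyHull n K) (hyK : y ∉ K)
    {R : ℝ} (hR : 0 ≤ R) (hE : ∀ x ∈ essSet (polyAlg K), ∑ i, ‖x.1 i‖ ^ 2 ≤ R) :
    ∑ i, ‖y i‖ ^ 2 ≤ R := by
  let p : MvPolynomial (Fin n) ℂ :=
    ∑ i, MvPolynomial.C ((starRingEnd ℂ) (y i)) * MvPolynomial.X i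
  have hpe : ∀ x : Fin n → ℂ, MvPolynomial.eval x p = ∑ i, (starRingEnd ℂ) (y i) * x i := by
    intro x
    simp [p]
  have h1 := norm_eval_le_of_essSet hy hyK (R := √(∑ i, ‖y i‖ ^ 2) * √R) (by positivity) (p := p)
    fun x hx => by
      rw [hpe]
      refine (norm_sum_le _ _).trans ?_
      simp only [norm_mul, RCLike.norm_conj]
      refine (Real.sum_mul_le_sqrt_mul_sqrt _ _ _).trans ?_
      exact mul_le_mul_of_nonneg_left (Real.sqrt_le_sqrt (hE x hx)) (Real.sqrt_nonneg _)
  have h2 : MvPolynomial.eval y p = ((∑ i, ‖y i‖ ^ 2 : ℝ) : ℂ) := by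
    rw [hpe, Complex.ofReal_sum]
    refine Finset.sum_congr rfl fun i _ => ?_
    rw [mul_comm, Complex.mul_conj, Complex.normSq_eq_norm_sq]
  have hS : 0 ≤ ∑ i, ‖y i‖ ^ 2 := by positivity
  rw [h2, Complex.norm_real, Real.norm_of_nonneg hS] at h1
  by_contra! hlt
  have h3 := Real.sq_sqrt hS
  have h4 := Real.sqrt_lt_sqrt hR hlt
  nlinarith [Real.sqrt_nonneg R]

end PolyAlg

section GraphKernel

open MeasureTheory Filter

/-- The kernel `ε² / ((γ x - γ t)² + ε²)` attached to the graph `γ t = t + i ψ t`. -/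
def graphPt (ψ : ℝ → ℝ) (t : ℝ) : ℂ := (t : ℂ) + Complex.I * (ψ t : ℂ)

variable {ψ : ℝ → ℝ} {κ : ℝ}

theorem continuous_graphPt (hψ : Continuous ψ) : Continuous (graphPt ψ) := by
  unfold graphPt
  fun_prop

theorem half_le_norm_graph_sq (hκ : κ ≤ 1 / 2) (hψ : ∀ x y, |ψ x - ψ y| ≤ κ * |x - y|)
    (ε x t : ℝ) :
    ((x - t) ^ 2 + ε ^ 2) / 2 ≤ ‖(graphPt ψ x - graphPt ψ t) ^ 2 + (ε : ℂ) ^ 2‖ := by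
  refine le_trans ?_ (Complex.re_le_norm _)
  have h1 : ((graphPt ψ x - graphPt ψ t) ^ 2 + (ε : ℂ) ^ 2).re
      = (x - t) ^ 2 - (ψ x - ψ t) ^ 2 + ε ^ 2 := by
    simp [graphPt, pow_two]
  rw [h1]
  have h2 := hψ x t
  have h3 : |ψ x - ψ t| ≤ 1 / 2 * |x - t| := h2.trans (by gcongr)
  have h4 : (ψ x - ψ t) ^ 2 ≤ (1 / 2 * |x - t|) ^ 2 := by
    rw [← sq_abs (ψ x - ψ t)]
    gcongr
  rw [mul_pow, sq_abs] at h4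
  nlinarith [sq_nonneg ε, sq_nonneg (x - t)]

theorem norm_graph_sq_sub_le (hκ : κ ≤ 1 / 2) (hψ : ∀ x y, |ψ x - ψ y| ≤ κ * |x - y|) (x t : ℝ) :
    ‖(graphPt ψ x - graphPt ψ t) ^ 2 - ((x - t : ℝ) : ℂ) ^ 2‖ ≤ 3 * κ * (x - t) ^ 2 := by
  have e : (graphPt ψ x - graphPt ψ t) ^ 2 - ((x - t : ℝ) : ℂ) ^ 2 =
      (((ψ x - ψ t : ℝ) : ℂ)) * (2 * Complex.I * ((x - t : ℝ) : ℂ) - ((ψ x - ψ t : ℝ) : ℂ)) := by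
    simp only [graphPt]
    push_cast
    linear_combination ((ψ x : ℂ) - ψ t) ^ 2 * Complex.I_sq
  rw [e, norm_mul, Complex.norm_real, Real.norm_eq_abs]
  have h2 := hψ x t
  have h0 : 0 ≤ κ * |x - t| := (abs_nonneg _).trans h2
  have h3 : ‖2 * Complex.I * ((x - t : ℝ) : ℂ) - ((ψ x - ψ t : ℝ) : ℂ)‖ ≤ 3 * |x - t| := by
    refine (norm_sub_le _ _).trans ?_
    rw [norm_mul, norm_mul, Complex.norm_real, Complex.norm_real, Complex.norm_I,
      Real.norm_eq_abs, Real.norm_eq_abs]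
    have : κ * |x - t| ≤ 1 / 2 * |x - t| := by gcongr
    have h5 := abs_nonneg (x - t)
    norm_num
    linarith
  calc _ ≤ κ * |x - t| * (3 * |x - t|) := by gcongr
    _ = 3 * κ * (|x - t| ^ 2) := by ring
    _ = _ := by rw [sq_abs]

/-- The regularisation of `g` along the graph of `ψ`. -/
def graphConv (ψ : ℝ → ℝ) (ε : ℝ) (g : ℝ → ℂ) (x : ℝ) : ℂ :=
  ((ε / Real.pi : ℝ) : ℂ) * ∫ t, g t * ((graphPt ψ x - graphPt ψ t) ^ 2 + (ε : ℂ) ^ 2)⁻¹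

theorem graph_sq_ne_zero (hκ : κ ≤ 1 / 2) (hψ : ∀ x y, |ψ x - ψ y| ≤ κ * |x - y|)
    {ε : ℝ} (hε : 0 < ε) (x t : ℝ) : (graphPt ψ x - graphPt ψ t) ^ 2 + (ε : ℂ) ^ 2 ≠ 0 := by
  have := half_le_norm_graph_sq hκ hψ ε x t
  rw [← norm_pos_iff]
  refine lt_of_lt_of_le ?_ this
  positivity

theorem continuous_graphConv (hψc : Continuous ψ) (hκ : κ ≤ 1 / 2)
    (hψ : ∀ x y, |ψ x - ψ y| ≤ κ * |x - y|) {ε : ℝ} (hε : 0 < ε) {g : ℝ → ℂ} (hg : Continuous g)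
    {b : ℝ} (hb : ∀ t, b ≤ |t| → g t = 0) : Continuous (graphConv ψ ε g) := by
  have hγ := continuous_graphPt hψc
  refine continuous_const.mul ?_
  have h1 : ∀ x, ∫ t, g t * ((graphPt ψ x - graphPt ψ t) ^ 2 + (ε : ℂ) ^ 2)⁻¹ =
      ∫ t in Set.Icc (-b) b, g t * ((graphPt ψ x - graphPt ψ t) ^ 2 + (ε : ℂ) ^ 2)⁻¹ := by
    intro x
    refine (setIntegral_eq_integral_of_forall_compl_eq_zero fun t ht => ?_).symm
    rw [hb t, zero_mul]
    by_contra! h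
    exact ht ⟨(abs_lt.1 h).1.le, (abs_lt.1 h).2.le⟩
  simp_rw [h1]
  refine continuous_parametric_integral_of_continuous ?_ isCompact_Icc
  refine (hg.comp continuous_snd).mul (Continuous.inv₀ ?_ fun z => graph_sq_ne_zero hκ hψ hε z.1 z.2)
  fun_prop

theorem norm_graphConv_le (hκ : κ ≤ 1 / 2)
    (hψ : ∀ x y, |ψ x - ψ y| ≤ κ * |x - y|) {ε : ℝ} (hε : 0 < ε) {g : ℝ → ℂ}
    {b c M : ℝ} (hc : 0 < c) (hM : ∀ t, ‖g t‖ ≤ M) (hb : ∀ t, b ≤ |t| → g t = 0) {x : ℝ}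
    (hx : b + c ≤ |x|) :
    ‖graphConv ψ ε g x‖ ≤ ε * (2 * M / c ^ 2 * (volume (Set.Icc (-b) b)).toReal) := by
  have hM0 : 0 ≤ M := (norm_nonneg _).trans (hM 0)
  rw [graphConv, norm_mul, Complex.norm_real, Real.norm_of_nonneg (by positivity),
    ← setIntegral_eq_integral_of_forall_compl_eq_zero (s := Set.Icc (-b) b)]
  · have h1 : ‖∫ t in Set.Icc (-b) b, g t * ((graphPt ψ x - graphPt ψ t) ^ 2 + (ε : ℂ) ^ 2)⁻¹‖
        ≤ 2 * M / c ^ 2 * (volume (Set.Icc (-b) b)).toReal := by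
      refine norm_setIntegral_le_of_norm_le_const measure_Icc_lt_top fun t ht => ?_
      have h2 := half_le_norm_graph_sq hκ hψ ε x t
      have h3 : c ≤ |x - t| := by
        have := abs_sub_abs_le_abs_sub x t
        have : |t| ≤ b := abs_le.2 ht
        linarith
      have h4 : c ^ 2 / 2 ≤ ‖(graphPt ψ x - graphPt ψ t) ^ 2 + (ε : ℂ) ^ 2‖ := by
        refine le_trans ?_ h2
        have : c ^ 2 ≤ (x - t) ^ 2 := by
          rw [← sq_abs (x - t)]
          gcongr
        nlinarith [sq_nonneg ε]
      rw [norm_mul, norm_inv]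
      calc _ ≤ M * (c ^ 2 / 2)⁻¹ := by
            gcongr
            exact hM t
        _ = _ := by
            field_simp
    have h5 : ε / Real.pi ≤ ε := div_le_self hε.le (by linarith [Real.pi_gt_three])
    gcongr
  · intro t ht
    rw [hb t, zero_mul]
    by_contra! h
    exact ht ⟨(abs_lt.1 h).1.le, (abs_lt.1 h).2.le⟩

theorem graphConv_eq {ε : ℝ} (hε : 0 < ε) (g : ℝ → ℂ) (x : ℝ) :
    graphConv ψ ε g x = ((1 / Real.pi : ℝ) : ℂ) * ∫ u : ℝ, g (x + ε * u) * ((ε : ℂ) ^ 2 *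
      ((graphPt ψ x - graphPt ψ (x + ε * u)) ^ 2 + (ε : ℂ) ^ 2)⁻¹) := by
  have h1 := Measure.integral_comp_mul_left (fun t => g (x + t) *
    ((graphPt ψ x - graphPt ψ (x + t)) ^ 2 + (ε : ℂ) ^ 2)⁻¹) ε
  have h2 := integral_add_left_eq_self (μ := (volume : Measure ℝ))
    (fun t => g t * ((graphPt ψ x - graphPt ψ t) ^ 2 + (ε : ℂ) ^ 2)⁻¹) x
  rw [h2] at h1
  have h3 : ∀ u : ℝ, g (x + ε * u) * ((ε : ℂ) ^ 2 *
      ((graphPt ψ x - graphPt ψ (x + ε * u)) ^ 2 + (ε : ℂ) ^ 2)⁻¹) = (ε : ℂ) ^ 2 *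
      (g (x + ε * u) * ((graphPt ψ x - graphPt ψ (x + ε * u)) ^ 2 + (ε : ℂ) ^ 2)⁻¹) :=
    fun u => by ring
  simp_rw [h3]
  rw [integral_const_mul, h1, abs_of_pos (inv_pos.2 hε), graphConv, Complex.real_smul]
  have : (ε : ℂ) ≠ 0 := by exact_mod_cast hε.ne'
  push_cast
  field_simp

theorem tendsto_integral_tail :
    Tendsto (fun R : ℝ => ∫ u : ℝ, Set.indicator {u | R ≤ |u|} (fun u => (1 + u ^ 2)⁻¹) u) atTop
      (𝓝 0) := by
  rw [← integral_zero ℝ ℝ (μ := volume)]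
  refine tendsto_integral_filter_of_dominated_convergence (fun u => (1 + u ^ 2)⁻¹) ?_ ?_
    integrable_inv_one_add_sq ?_
  · refine Eventually.of_forall fun R => (Measurable.indicator ?_ ?_).aestronglyMeasurable
    · fun_prop
    · exact (isClosed_le continuous_const continuous_abs).measurableSet
  · refine Eventually.of_forall fun R => Eventually.of_forall fun u => ?_
    have h0 : 0 ≤ (1 + u ^ 2)⁻¹ := by positivity
    by_cases h : R ≤ |u|
    · rw [Set.indicator_of_mem (by exact h), Real.norm_of_nonneg h0]
    · rw [Set.indicator_of_notMem (by exact h), norm_zero]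
      exact h0
  · refine Eventually.of_forall fun u => tendsto_const_nhds.congr' ?_
    filter_upwards [eventually_gt_atTop |u|] with R hR
    rw [Set.indicator_of_notMem]
    exact not_le.2 hR

theorem norm_kernel_sub_le (hκ : κ ≤ 1 / 2) (hψ : ∀ x y, |ψ x - ψ y| ≤ κ * |x - y|) (hκ0 : 0 ≤ κ)
    {ε : ℝ} (hε : 0 < ε) (x u : ℝ) :
    ‖(((1 + u ^ 2)⁻¹ : ℝ) : ℂ) - (ε : ℂ) ^ 2 *
      ((graphPt ψ x - graphPt ψ (x + ε * u)) ^ 2 + (ε : ℂ) ^ 2)⁻¹‖ ≤ 6 * κ * (1 + u ^ 2)⁻¹ := by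
  have h1 := half_le_norm_graph_sq hκ hψ ε x (x + ε * u)
  have h2 := norm_graph_sq_sub_le hκ hψ x (x + ε * u)
  have h3 := graph_sq_ne_zero hκ hψ hε x (x + ε * u)
  set D := (graphPt ψ x - graphPt ψ (x + ε * u)) ^ 2
  have hu : ((1 : ℂ) + (u : ℂ) ^ 2) ≠ 0 := by
    have : (0 : ℝ) < 1 + u ^ 2 := by positivity
    exact_mod_cast this.ne'
  have e : (((1 + u ^ 2)⁻¹ : ℝ) : ℂ) - (ε : ℂ) ^ 2 * (D + (ε : ℂ) ^ 2)⁻¹ =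
      (D - ((x - (x + ε * u) : ℝ) : ℂ) ^ 2) * (((1 + u ^ 2)⁻¹ : ℝ) : ℂ) * (D + (ε : ℂ) ^ 2)⁻¹ := by
    push_cast
    field_simp
    ring
  rw [e, norm_mul, norm_mul, norm_inv, Complex.norm_real, Real.norm_of_nonneg (by positivity)]
  have h4 : x - (x + ε * u) = -(ε * u) := by ring
  rw [h4] at h1 h2 ⊢
  calc _ ≤ 3 * κ * (-(ε * u)) ^ 2 * (1 + u ^ 2)⁻¹ * (((-(ε * u)) ^ 2 + ε ^ 2) / 2)⁻¹ := by
        gcongr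
    _ = 6 * κ * (1 + u ^ 2)⁻¹ * (u ^ 2 / (1 + u ^ 2)) := by
        have : (0 : ℝ) < 1 + u ^ 2 := by positivity
        field_simp
        ring
    _ ≤ 6 * κ * (1 + u ^ 2)⁻¹ * 1 := by
        gcongr
        rw [div_le_one (by positivity)]
        linarith
    _ = _ := mul_one _

theorem eventually_norm_sub_graphConv_le (hψc : Continuous ψ) (hκ : κ ≤ 1 / 24) (hκ0 : 0 ≤ κ)
    (hψ : ∀ x y, |ψ x - ψ y| ≤ κ * |x - y|) {g : ℝ → ℂ} (hg : UniformContinuous g)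
    {M ρ : ℝ} (hM : ∀ t, ‖g t‖ ≤ M) (hρ : 0 < ρ) :
    ∀ᶠ ε in 𝓝[>] (0 : ℝ), ∀ x, ‖g x - graphConv ψ ε g x‖ ≤ M / 4 + ρ := by
  have hκ' : κ ≤ 1 / 2 := by linarith
  have hM0 : 0 ≤ M := (norm_nonneg _).trans (hM 0)
  obtain ⟨d, hd, hgd⟩ := Metric.uniformContinuous_iff.1 hg (ρ / 2) (by positivity)
  have hlim := (tendsto_integral_tail.const_mul (2 * M))
  rw [mul_zero] at hlim
  obtain ⟨R, hR, hR1⟩ := ((hlim.eventually (gt_mem_nhds (half_pos hρ))).and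
    (eventually_ge_atTop 1)).exists
  have hRp : 0 < R := by linarith
  filter_upwards [Ioo_mem_nhdsGT (show (0 : ℝ) < d / R by positivity)] with ε hε x
  have hε0 : 0 < ε := hε.1
  have hεR : ε * R < d := (lt_div_iff₀ hRp).1 hε.2
  rw [graphConv_eq hε0]
  have hπ := Real.pi_pos
  have hgx : g x = ((1 / Real.pi : ℝ) : ℂ) * ∫ u : ℝ, g x * (((1 + u ^ 2)⁻¹ : ℝ) : ℂ) := by
    rw [integral_const_mul, integral_complex_ofReal, integral_univ_inv_one_add_sq]
    have : (Real.pi : ℂ) ≠ 0 := by exact_mod_cast hπ.ne'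
    push_cast
    field_simp
  have hi1 : Integrable fun u : ℝ => g x * (((1 + u ^ 2)⁻¹ : ℝ) : ℂ) :=
    (integrable_inv_one_add_sq.ofReal).const_mul _
  have hpt : ∀ u : ℝ, ‖g x * (((1 + u ^ 2)⁻¹ : ℝ) : ℂ) - g (x + ε * u) * ((ε : ℂ) ^ 2 *
      ((graphPt ψ x - graphPt ψ (x + ε * u)) ^ 2 + (ε : ℂ) ^ 2)⁻¹)‖ ≤
      (6 * κ * M + ρ / 2) * (1 + u ^ 2)⁻¹ +
        2 * M * Set.indicator {u | R ≤ |u|} (fun u => (1 + u ^ 2)⁻¹) u := by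
    intro u
    have hk := norm_kernel_sub_le hκ' hψ hκ0 hε0 x u
    have hp : 0 ≤ (1 + u ^ 2)⁻¹ := by positivity
    have e : g x * (((1 + u ^ 2)⁻¹ : ℝ) : ℂ) - g (x + ε * u) * ((ε : ℂ) ^ 2 *
      ((graphPt ψ x - graphPt ψ (x + ε * u)) ^ 2 + (ε : ℂ) ^ 2)⁻¹) =
      (g x - g (x + ε * u)) * (((1 + u ^ 2)⁻¹ : ℝ) : ℂ) + g (x + ε * u) *
      ((((1 + u ^ 2)⁻¹ : ℝ) : ℂ) - (ε : ℂ) ^ 2 *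
      ((graphPt ψ x - graphPt ψ (x + ε * u)) ^ 2 + (ε : ℂ) ^ 2)⁻¹) := by ring
    rw [e]
    refine (norm_add_le _ _).trans ?_
    rw [norm_mul, norm_mul, Complex.norm_real, Real.norm_of_nonneg hp]
    have h1 : ‖g (x + ε * u)‖ * ‖(((1 + u ^ 2)⁻¹ : ℝ) : ℂ) - (ε : ℂ) ^ 2 *
      ((graphPt ψ x - graphPt ψ (x + ε * u)) ^ 2 + (ε : ℂ) ^ 2)⁻¹‖ ≤
      M * (6 * κ * (1 + u ^ 2)⁻¹) := by
      gcongr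
      exact hM _
    have h2 : ‖g x - g (x + ε * u)‖ * (1 + u ^ 2)⁻¹ ≤ ρ / 2 * (1 + u ^ 2)⁻¹ +
        2 * M * Set.indicator {u | R ≤ |u|} (fun u => (1 + u ^ 2)⁻¹) u := by
      by_cases h : R ≤ |u|
      · rw [Set.indicator_of_mem (by exact h)]
        have : ‖g x - g (x + ε * u)‖ ≤ 2 * M := by
          refine (norm_sub_le _ _).trans ?_
          linarith [hM x, hM (x + ε * u)]
        nlinarith
      · rw [Set.indicator_of_notMem (by exact h), mul_zero, add_zero]
        gcongr
        rw [← dist_eq_norm]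
        refine (hgd ?_).le
        rw [Real.dist_eq, sub_add_cancel_left, abs_neg, abs_mul, abs_of_pos hε0]
        push Not at h
        refine lt_of_le_of_lt ?_ hεR
        gcongr
    linarith
  have hind : Integrable (Set.indicator {u : ℝ | R ≤ |u|} (fun u => (1 + u ^ 2)⁻¹)) :=
    integrable_inv_one_add_sq.indicator (isClosed_le continuous_const continuous_abs).measurableSet
  have hbi : Integrable fun u : ℝ => (6 * κ * M + ρ / 2) * (1 + u ^ 2)⁻¹ +
        2 * M * Set.indicator {u | R ≤ |u|} (fun u => (1 + u ^ 2)⁻¹) u :=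
    (integrable_inv_one_add_sq.const_mul _).add (hind.const_mul _)
  have hmeas : AEStronglyMeasurable (fun u : ℝ => g (x + ε * u) * ((ε : ℂ) ^ 2 *
      ((graphPt ψ x - graphPt ψ (x + ε * u)) ^ 2 + (ε : ℂ) ^ 2)⁻¹)) := by
    have hγ := continuous_graphPt hψc
    have hgc := hg.continuous
    refine Continuous.aestronglyMeasurable ?_
    refine (hgc.comp (by fun_prop)).mul (continuous_const.mul (Continuous.inv₀ (by fun_prop) ?_))
    exact fun u => graph_sq_ne_zero hκ' hψ hε0 x _
  have hi2 : Integrable (fun u : ℝ => g (x + ε * u) * ((ε : ℂ) ^ 2 *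
      ((graphPt ψ x - graphPt ψ (x + ε * u)) ^ 2 + (ε : ℂ) ^ 2)⁻¹)) := by
    have h3 : Integrable fun u : ℝ => g x * (((1 + u ^ 2)⁻¹ : ℝ) : ℂ) - g (x + ε * u) *
      ((ε : ℂ) ^ 2 * ((graphPt ψ x - graphPt ψ (x + ε * u)) ^ 2 + (ε : ℂ) ^ 2)⁻¹) :=
      hbi.mono' (hi1.aestronglyMeasurable.sub hmeas) (Eventually.of_forall hpt)
    have := hi1.sub h3
    refine this.congr (Eventually.of_forall fun u => ?_)
    simp
  have hb : ‖∫ u : ℝ, (g x * (((1 + u ^ 2)⁻¹ : ℝ) : ℂ) - g (x + ε * u) *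
      ((ε : ℂ) ^ 2 * ((graphPt ψ x - graphPt ψ (x + ε * u)) ^ 2 + (ε : ℂ) ^ 2)⁻¹))‖ ≤
      (6 * κ * M + ρ / 2) * Real.pi + ρ / 2 := by
    refine (norm_integral_le_of_norm_le hbi (Eventually.of_forall hpt)).trans ?_
    rw [integral_add (integrable_inv_one_add_sq.const_mul _) (hind.const_mul _),
      integral_const_mul, integral_const_mul, integral_univ_inv_one_add_sq]
    linarith
  rw [integral_sub hi1 hi2] at hb
  nth_rewrite 1 [hgx]
  rw [← mul_sub, norm_mul, Complex.norm_real, Real.norm_of_nonneg (by positivity), one_div,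
    inv_mul_le_iff₀ hπ]
  refine hb.trans ?_
  have : 6 * κ * M ≤ M / 4 := by nlinarith
  have := Real.pi_gt_three
  nlinarith

end GraphKernel

section GraphKill

open MeasureTheory Filter

variable {X : Type*} [TopologicalSpace X] [CompactSpace X]

/-- The real part of a continuous function. -/
def reMap (f : C(X, ℂ)) : C(X, ℝ) := ⟨fun x => (f x).re, Complex.continuous_re.comp f.continuous⟩

variable {ψ : ℝ → ℝ} {κ : ℝ} {f β : C(X, ℂ)} {τ : C(X, ℂ) →L[ℂ] ℂ} {Λ : ℂ → ℂ} {δ : ℝ}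

theorem notMem_image_of_im_ne (hβ : ∀ x ∈ tsupport β, (f x).im = ψ (f x).re) {s : ℂ}
    (hs : s.im ≠ ψ s.re) : s ∉ f '' tsupport β := by
  rintro ⟨x, hx, rfl⟩
  exact hs (hβ x hx)

theorem im_graphPt_add (t ε : ℝ) : (graphPt ψ t + ε * Complex.I).im = ψ t + ε := by
  simp [graphPt]

theorem re_graphPt_add (t ε : ℝ) : (graphPt ψ t + ε * Complex.I).re = t := by
  simp [graphPt]

theorem graphPt_add_off (t : ℝ) {ε : ℝ} (hε : ε ≠ 0) :
    (graphPt ψ t + ε * Complex.I).im ≠ ψ (graphPt ψ t + ε * Complex.I).re := by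
  rw [im_graphPt_add, re_graphPt_add]
  simpa using hε

theorem continuous_qdiv_graph (hψc : Continuous ψ)
    (hβ : ∀ x ∈ tsupport β, (f x).im = ψ (f x).re) {ε : ℝ} (hε : ε ≠ 0) :
    Continuous fun t : ℝ => qdiv β f (graphPt ψ t + ε * Complex.I) := by
  have hγ := continuous_graphPt hψc
  rw [continuous_iff_continuousAt]
  intro t
  have h1 := (contDiffAt_qdiv (notMem_image_of_im_ne hβ (graphPt_add_off t hε))).continuousAt
  exact ContinuousAt.comp (g := qdiv β f) (f := fun t : ℝ => graphPt ψ t + ε * Complex.I) h1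
    (by fun_prop)

theorem integrable_qdiv_graph (hψc : Continuous ψ)
    (hβ : ∀ x ∈ tsupport β, (f x).im = ψ (f x).re) {ε : ℝ} (hε : ε ≠ 0) {g : ℝ → ℂ}
    (hg : Continuous g) {b : ℝ} (hb : ∀ t, b ≤ |t| → g t = 0) :
    Integrable fun t : ℝ => g t • qdiv β f (graphPt ψ t + ε * Complex.I) := by
  refine (hg.smul (continuous_qdiv_graph hψc hβ hε)).integrable_of_hasCompactSupport ?_
  refine HasCompactSupport.smul_right ?_
  refine HasCompactSupport.intro (isCompact_Icc (a := -b) (b := b)) fun t ht => hb t ?_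
  by_contra! h
  exact ht ⟨(abs_lt.1 h).1.le, (abs_lt.1 h).2.le⟩

theorem graphConv_mul_eq (hψc : Continuous ψ)
    (hβ : ∀ x ∈ tsupport β, (f x).im = ψ (f x).re) {ε : ℝ} (hε : 0 < ε) {g : ℝ → ℂ}
    (hg : Continuous g) {b : ℝ} (hb : ∀ t, b ≤ |t| → g t = 0) (hκ : κ ≤ 1 / 2)
    (hψ : ∀ x y, |ψ x - ψ y| ≤ κ * |x - y|) (x : X) :
    ((2 * Real.pi * Complex.I : ℂ)⁻¹ • ((∫ t : ℝ, g t • qdiv β f (graphPt ψ t + ε * Complex.I)) -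
      ∫ t : ℝ, g t • qdiv β f (graphPt ψ t + (-ε : ℝ) * Complex.I))) x =
    β x * graphConv ψ ε g (f x).re := by
  have hi1 := integrable_qdiv_graph hψc hβ hε.ne' hg hb
  have hi2 := integrable_qdiv_graph hψc hβ (neg_ne_zero.2 hε.ne') hg hb
  rw [← integral_sub hi1 hi2]
  have hev := ((ContinuousMap.evalCLM ℂ x : C(X, ℂ) →L[ℂ] ℂ)).integral_comp_comm (hi1.sub hi2)
  simp only [ContinuousMap.evalCLM_apply] at hev
  rw [ContinuousMap.smul_apply]
  simp only [Pi.sub_apply] at hev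
  rw [← hev, graphConv, smul_eq_mul, ← integral_const_mul, ← integral_const_mul,
    ← integral_const_mul]
  refine integral_congr_ae (Eventually.of_forall fun t => ?_)
  have h1 := notMem_image_of_im_ne hβ (graphPt_add_off t hε.ne')
  have h2 := notMem_image_of_im_ne hβ (graphPt_add_off t (neg_ne_zero.2 hε.ne'))
  simp only [ContinuousMap.sub_apply, ContinuousMap.smul_apply, qdiv_apply h1, qdiv_apply h2]
  by_cases hx : β x = 0
  · simp [hx]
  have hfx : f x = graphPt ψ (f x).re := by
    have := hβ x (subset_tsupport _ hx)
    apply Complex.ext <;> simp [graphPt, this]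
  have h3 := qdiv_sub_ne h1 hx
  have h4 := qdiv_sub_ne h2 hx
  have h5 := graph_sq_ne_zero hκ hψ hε (f x).re t
  rw [← hfx] at h5 ⊢
  have hπ : (Real.pi : ℂ) ≠ 0 := by exact_mod_cast Real.pi_pos.ne'
  have hI := Complex.I_ne_zero
  have e : (f x - graphPt ψ t) ^ 2 + (ε : ℂ) ^ 2 =
      (f x - (graphPt ψ t + ε * Complex.I)) * (f x - (graphPt ψ t + (-ε : ℝ) * Complex.I)) := by
    push_cast
    linear_combination (ε : ℂ) ^ 2 * Complex.I_sq
  have e2 : (f x - (graphPt ψ t + (-ε : ℝ) * Complex.I)) - (f x - (graphPt ψ t + ε * Complex.I)) =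
      2 * Complex.I * ε := by
    push_cast
    ring
  rw [e]
  generalize f x - (graphPt ψ t + ε * Complex.I) = P at h3 e2 ⊢
  generalize f x - (graphPt ψ t + (-ε : ℝ) * Complex.I) = Q at h4 e2 ⊢
  simp only [smul_eq_mul]
  push_cast
  field_simp
  linear_combination g t * e2

theorem eventually_norm_graphConv_le (hψc : Continuous ψ)
    (hβ : ∀ x ∈ tsupport β, (f x).im = ψ (f x).re) (hκ : κ ≤ 1 / 2)
    (hψ : ∀ x y, |ψ x - ψ y| ≤ κ * |x - y|) (hΛc : ContinuousOn Λ (ball 0 δ))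
    (hΛ : ∀ s ∈ ball (0 : ℂ) δ, s.im ≠ ψ s.re → τ (qdiv β f s) = Λ s)
    {g : ℝ → ℂ}
    (hg : Continuous g) {b M : ℝ} (hγb : ∀ t, |t| ≤ b → graphPt ψ t ∈ ball (0 : ℂ) δ)
    (hb : ∀ t, b ≤ |t| → g t = 0) (hM : ∀ t, ‖g t‖ ≤ M)
    {ρ : ℝ} (hρ : 0 < ρ) :
    ∀ᶠ ε in 𝓝[>] (0 : ℝ), ∀ v : C(X, ℂ), (∀ x, v x = β x * graphConv ψ ε g (f x).re) →
      ‖τ v‖ ≤ ρ := by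
  have hM0 : 0 ≤ M := (norm_nonneg _).trans (hM 0)
  have hγ := continuous_graphPt hψc
  set C : ℝ := M * (volume (Set.Icc (-b) b)).toReal + 1 with hC
  have hCp : 0 < C := by positivity
  have hunif : ∀ᶠ ε : ℝ in 𝓝 0, ∀ t ∈ Set.Icc (-b) b,
      graphPt ψ t + ε * Complex.I ∈ ball (0 : ℂ) δ ∧
      graphPt ψ t + (-ε : ℝ) * Complex.I ∈ ball (0 : ℂ) δ ∧
      ‖Λ (graphPt ψ t + ε * Complex.I) - Λ (graphPt ψ t + (-ε : ℝ) * Complex.I)‖ < ρ / C := by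
    refine isCompact_Icc.eventually_forall_of_forall_eventually fun t ht => ?_
    have hin := hγb t (abs_le.2 ht)
    have hc1 : ContinuousAt (fun z : ℝ × ℝ => graphPt ψ z.2 + z.1 * Complex.I) (0, t) := by
      fun_prop
    have hc2 : ContinuousAt (fun z : ℝ × ℝ => graphPt ψ z.2 + (-z.1 : ℝ) * Complex.I) (0, t) := by
      fun_prop
    have hΛt : ContinuousAt Λ (graphPt ψ t) := hΛc.continuousAt (isOpen_ball.mem_nhds hin)
    have v1 : (fun z : ℝ × ℝ => graphPt ψ z.2 + z.1 * Complex.I) (0, t) = graphPt ψ t := by simp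
    have v2 : (fun z : ℝ × ℝ => graphPt ψ z.2 + (-z.1 : ℝ) * Complex.I) (0, t) = graphPt ψ t := by
      simp
    have hc3 := (ContinuousAt.comp (g := Λ) (by simpa using hΛt) hc1).sub
      (ContinuousAt.comp (g := Λ) (by simpa using hΛt) hc2)
    have hn := hc3.norm
    refine Eventually.and (hc1 (by rw [v1]; exact isOpen_ball.mem_nhds hin))
      (Eventually.and (hc2 (by rw [v2]; exact isOpen_ball.mem_nhds hin)) ?_)
    refine hn.eventually (gt_mem_nhds ?_)
    simp only [Pi.sub_apply, Function.comp]
    simpa using div_pos hρ hCp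
  filter_upwards [hunif.filter_mono nhdsWithin_le_nhds, self_mem_nhdsWithin] with ε hεu hε v hv
  have hε0 : 0 < ε := hε
  have hi1 := integrable_qdiv_graph hψc hβ hε0.ne' hg hb
  have hi2 := integrable_qdiv_graph hψc hβ (neg_ne_zero.2 hε0.ne') hg hb
  have hve : v = ((2 * Real.pi * Complex.I : ℂ)⁻¹ •
      ((∫ t : ℝ, g t • qdiv β f (graphPt ψ t + ε * Complex.I)) -
      ∫ t : ℝ, g t • qdiv β f (graphPt ψ t + (-ε : ℝ) * Complex.I))) := by
    ext x
    rw [hv x, graphConv_mul_eq hψc hβ hε0 hg hb hκ hψ x]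
  rw [hve, map_smul, map_sub, ← τ.integral_comp_comm hi1, ← τ.integral_comp_comm hi2,
    ← integral_sub (τ.integrable_comp hi1) (τ.integrable_comp hi2), norm_smul,
    ← setIntegral_eq_integral_of_forall_compl_eq_zero (s := Set.Icc (-b) b)]
  · have h1 : ‖∫ t in Set.Icc (-b) b, (τ (g t • qdiv β f (graphPt ψ t + ε * Complex.I)) -
        τ (g t • qdiv β f (graphPt ψ t + (-ε : ℝ) * Complex.I)))‖ ≤
        M * (ρ / C) * (volume (Set.Icc (-b) b)).toReal := by
      refine norm_setIntegral_le_of_norm_le_const measure_Icc_lt_top fun t ht => ?_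
      obtain ⟨m1, m2, hlt⟩ := hεu t ht
      rw [map_smul, map_smul, hΛ _ m1 (graphPt_add_off t hε0.ne'),
        hΛ _ m2 (graphPt_add_off t (neg_ne_zero.2 hε0.ne')), ← smul_sub, norm_smul]
      exact mul_le_mul (hM t) hlt.le (norm_nonneg _) hM0
    have h2 : ‖(2 * Real.pi * Complex.I : ℂ)⁻¹‖ ≤ 1 := by
      rw [norm_inv]
      refine inv_le_one_of_one_le₀ ?_
      simp only [norm_mul, Complex.norm_I, Complex.norm_real, Real.norm_of_nonneg Real.pi_pos.le]
      norm_num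
      linarith [Real.pi_gt_three]
    have h3 : M * (ρ / C) * (volume (Set.Icc (-b) b)).toReal ≤ ρ := by
      have : M * (volume (Set.Icc (-b) b)).toReal ≤ C := by linarith
      calc _ = ρ * (M * (volume (Set.Icc (-b) b)).toReal / C) := by ring
        _ ≤ ρ * 1 := by
            gcongr
            exact (div_le_one hCp).2 this
        _ = ρ := mul_one _
    calc _ ≤ 1 * ρ := mul_le_mul h2 (h1.trans h3) (norm_nonneg _) zero_le_one
      _ = ρ := one_mul _
  · intro t ht
    rw [hb t]
    · simp
    · by_contra! h
      exact ht ⟨(abs_lt.1 h).1.le, (abs_lt.1 h).2.le⟩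

theorem graph_kill_of_bound_le (hψc : Continuous ψ)
    (hβ : ∀ x ∈ tsupport β, (f x).im = ψ (f x).re) (hκ : κ ≤ 1 / 24) (hκ0 : 0 ≤ κ)
    (hψ : ∀ x y, |ψ x - ψ y| ≤ κ * |x - y|) (hΛc : ContinuousOn Λ (ball 0 δ))
    (hΛ : ∀ s ∈ ball (0 : ℂ) δ, s.im ≠ ψ s.re → τ (qdiv β f s) = Λ s) {a N : ℝ} (hN : 0 ≤ N)
    (hγa : ∀ t, |t| ≤ a → graphPt ψ t ∈ ball (0 : ℂ) δ)
    (ih : ∀ (g : C(ℝ, ℂ)) (b M : ℝ), b < a → (∀ t, b ≤ |t| → g t = 0) → (∀ t, ‖g t‖ ≤ M) →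
      ‖τ (β * g.comp (reMap f))‖ ≤ N * M)
    (g : C(ℝ, ℂ)) (b M : ℝ) (hba : b < a) (hb : ∀ t, b ≤ |t| → g t = 0) (hM : ∀ t, ‖g t‖ ≤ M) :
    ‖τ (β * g.comp (reMap f))‖ ≤ N / 4 * M := by
  have hM0 : 0 ≤ M := (norm_nonneg _).trans (hM 0)
  have hκ' : κ ≤ 1 / 2 := by linarith
  set d := (a - b) / 3 with hd
  have hdp : 0 < d := by
    rw [hd]
    linarith
  let η : C(ℝ, ℝ) := ⟨fun t => max 0 (min 1 ((b + 2 * d - |t|) / d)), by fun_prop⟩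
  have hη0 : ∀ t, 0 ≤ η t := fun t => le_max_left _ _
  have hη1 : ∀ t, η t ≤ 1 := fun t => max_le zero_le_one (min_le_left _ _)
  have hηone : ∀ t, |t| ≤ b + d → η t = 1 := by
    intro t ht
    have : 1 ≤ (b + 2 * d - |t|) / d := (one_le_div hdp).2 (by linarith)
    simp [η, min_eq_left this]
  have hηzero : ∀ t, b + 2 * d ≤ |t| → η t = 0 := by
    intro t ht
    have : (b + 2 * d - |t|) / d ≤ 0 := div_nonpos_of_nonpos_of_nonneg (by linarith) hdp.le
    exact max_eq_left ((min_le_right _ _).trans this)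
  have hgu : UniformContinuous g := by
    refine HasCompactSupport.uniformContinuous_of_continuous ?_ g.continuous
    refine HasCompactSupport.intro (isCompact_Icc (a := -b) (b := b)) fun t ht => hb t ?_
    by_contra! h
    exact ht ⟨(abs_lt.1 h).1.le, (abs_lt.1 h).2.le⟩
  refine le_of_forall_pos_le_add fun ρ hρ => ?_
  set P := N + ‖τ‖ * ‖β‖ + 1 with hP
  have hPp : 0 < P := by positivity
  set ρ' := ρ / P with hρ'
  have hρ'p : 0 < ρ' := div_pos hρ hPp
  have hlin : Tendsto (fun ε : ℝ => ε * (2 * M / d ^ 2 * (volume (Set.Icc (-b) b)).toReal))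
      (𝓝[>] 0) (𝓝 0) := by
    have : Tendsto (fun ε : ℝ => ε * (2 * M / d ^ 2 * (volume (Set.Icc (-b) b)).toReal))
      (𝓝 0) (𝓝 (0 * (2 * M / d ^ 2 * (volume (Set.Icc (-b) b)).toReal))) :=
      tendsto_id.mul_const _
    rw [zero_mul] at this
    exact this.mono_left nhdsWithin_le_nhds
  obtain ⟨ε, ⟨⟨h1, h2⟩, h3⟩, hε⟩ := (((eventually_norm_sub_graphConv_le hψc hκ hκ0 hψ hgu hM hρ'p).and
    (eventually_norm_graphConv_le (τ := τ) hψc hβ hκ' hψ hΛc hΛ g.continuous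
      (fun t ht => hγa t (ht.trans hba.le)) hb hM hρ'p)).and
    (hlin.eventually (gt_mem_nhds hρ'p))).and self_mem_nhdsWithin |>.exists
  have hε0 : 0 < ε := hε
  let v : C(ℝ, ℂ) := ⟨graphConv ψ ε g, continuous_graphConv hψc hκ' hψ hε0 g.continuous hb⟩
  let ηc : C(ℝ, ℂ) := ⟨fun t => (η t : ℂ), by fun_prop⟩
  have hηn : ∀ t, ‖ηc t‖ ≤ 1 := by
    intro t
    simp only [ηc, ContinuousMap.coe_mk, Complex.norm_real, Real.norm_of_nonneg (hη0 t)]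
    exact hη1 t
  have hdec : g = ηc * (g - v) - (1 - ηc) * v + v := by
    ext t
    simp only [ContinuousMap.add_apply, ContinuousMap.sub_apply, ContinuousMap.mul_apply,
      ContinuousMap.one_apply]
    have : (1 - ηc t) * g t = 0 := by
      by_cases h : b ≤ |t|
      · rw [hb t h, mul_zero]
      · have : ηc t = 1 := by
          simp only [ηc, ContinuousMap.coe_mk]
          rw [hηone t (by linarith)]
          norm_num
        rw [this, sub_self, zero_mul]
    linear_combination this
  have t1 : ‖τ (β * (ηc * (g - v)).comp (reMap f))‖ ≤ N * (M / 4 + ρ') := by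
    refine ih _ (b + 2 * d) _ ?_ ?_ ?_
    · rw [hd]
      linarith
    · intro t ht
      simp [ηc, hηzero t ht]
    · intro t
      rw [ContinuousMap.mul_apply, norm_mul]
      calc _ ≤ 1 * (M / 4 + ρ') := mul_le_mul (hηn t) (h1 t) (norm_nonneg _) zero_le_one
        _ = _ := one_mul _
  have t2 : ‖τ (β * ((1 - ηc) * v).comp (reMap f))‖ ≤ ‖τ‖ * ‖β‖ * ρ' := by
    refine (τ.le_opNorm _).trans ?_
    rw [mul_assoc]
    gcongr
    refine (norm_mul_le _ _).trans ?_
    gcongr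
    refine (ContinuousMap.norm_le _ hρ'p.le).2 fun x => ?_
    simp only [ContinuousMap.comp_apply, ContinuousMap.mul_apply, ContinuousMap.sub_apply,
      ContinuousMap.one_apply]
    set t := reMap f x
    by_cases h : |t| ≤ b + d
    · have : ηc t = 1 := by
        simp only [ηc, ContinuousMap.coe_mk]
        rw [hηone t h]
        norm_num
      rw [this, sub_self, zero_mul, norm_zero]
      exact hρ'p.le
    · push Not at h
      have hv1 : ‖v t‖ ≤ ρ' :=
        (norm_graphConv_le hκ' hψ hε0 hdp hM hb h.le).trans h3.le
      have h4 : ‖1 - ηc t‖ ≤ 1 := by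
        have : (1 : ℂ) - ηc t = ((1 - η t : ℝ) : ℂ) := by
          simp [ηc]
        rw [this, Complex.norm_real, Real.norm_of_nonneg (by linarith [hη1 t])]
        linarith [hη0 t]
      rw [norm_mul]
      calc _ ≤ 1 * ρ' := mul_le_mul h4 hv1 (norm_nonneg _) zero_le_one
        _ = _ := one_mul _
  have t3 : ‖τ (β * v.comp (reMap f))‖ ≤ ρ' := h2 _ fun x => rfl
  have hsum : τ (β * g.comp (reMap f)) = τ (β * (ηc * (g - v)).comp (reMap f)) -
      τ (β * ((1 - ηc) * v).comp (reMap f)) + τ (β * v.comp (reMap f)) := by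
    rw [← map_sub, ← map_add]
    congr 1
    conv_lhs => rw [hdec]
    ext x
    simp
    ring
  rw [hsum]
  have hfin : P * ρ' = ρ := by
    rw [hρ']
    field_simp
  calc _ ≤ N * (M / 4 + ρ') + ‖τ‖ * ‖β‖ * ρ' + ρ' :=
        (norm_add_le _ _).trans (add_le_add ((norm_sub_le _ _).trans (add_le_add t1 t2)) t3)
    _ = N / 4 * M + P * ρ' := by
        rw [hP]
        ring
    _ = _ := by rw [hfin]

/-- A functional whose Cauchy transform extends continuously across a Lipschitz graph with small
constant vanishes on the functions carried by the graph. -/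
theorem graph_kill (hψc : Continuous ψ)
    (hβ : ∀ x ∈ tsupport β, (f x).im = ψ (f x).re) (hκ : κ ≤ 1 / 24) (hκ0 : 0 ≤ κ)
    (hψ : ∀ x y, |ψ x - ψ y| ≤ κ * |x - y|) (hΛc : ContinuousOn Λ (ball 0 δ))
    (hΛ : ∀ s ∈ ball (0 : ℂ) δ, s.im ≠ ψ s.re → τ (qdiv β f s) = Λ s) {a : ℝ}
    (hγa : ∀ t, |t| ≤ a → graphPt ψ t ∈ ball (0 : ℂ) δ)
    (g : C(ℝ, ℂ)) (b : ℝ) (hba : b < a) (hb : ∀ t, b ≤ |t| → g t = 0) :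
    τ (β * g.comp (reMap f)) = 0 := by
  have main : ∀ n : ℕ, ∀ (g : C(ℝ, ℂ)) (b M : ℝ), b < a → (∀ t, b ≤ |t| → g t = 0) →
      (∀ t, ‖g t‖ ≤ M) → ‖τ (β * g.comp (reMap f))‖ ≤ ‖τ‖ * ‖β‖ * (1 / 4) ^ n * M := by
    intro n
    induction n with
    | zero =>
      intro g b M _ _ hM
      have hM0 : 0 ≤ M := (norm_nonneg _).trans (hM 0)
      rw [pow_zero, mul_one, mul_assoc]
      refine (τ.le_opNorm _).trans ?_
      gcongr
      refine (norm_mul_le _ _).trans ?_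
      gcongr
      exact (ContinuousMap.norm_le _ hM0).2 fun x => hM _
    | succ n ih =>
      intro g b M h1 h2 h3
      have := graph_kill_of_bound_le hψc hβ hκ hκ0 hψ hΛc hΛ (by positivity) hγa ih g b M h1 h2 h3
      refine this.trans (le_of_eq ?_)
      ring
  have hsupp : HasCompactSupport g :=
    HasCompactSupport.intro (isCompact_Icc (a := -b) (b := b)) fun t ht => hb t (by
      by_contra! h
      exact ht ⟨(abs_lt.1 h).1.le, (abs_lt.1 h).2.le⟩)
  obtain ⟨M, hM⟩ := hsupp.exists_bound_of_continuous g.continuous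
  have hlim : Tendsto (fun n : ℕ => ‖τ‖ * ‖β‖ * (1 / 4) ^ n * M) atTop (𝓝 0) := by
    have := ((tendsto_pow_atTop_nhds_zero_of_lt_one (r := (1 / 4 : ℝ)) (by norm_num)
      (by norm_num)).const_mul (‖τ‖ * ‖β‖)).mul_const M
    simpa using this
  exact norm_le_zero_iff.1 (ge_of_tendsto' hlim fun n => main n g b M hba hb hM)

end GraphKill

section LocalKill

open MeasureTheory Filter

variable {X : Type*} [TopologicalSpace X] [CompactSpace X]

theorem vanish_of_fibre {A : Set C(X, ℂ)} {f β : C(X, ℂ)} {ν : C(X, ℂ) →L[ℂ] ℂ} {a b : ℝ}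
    (h : ∀ p ∈ A, ∀ g : C(ℝ, ℂ), ∀ b < a, (∀ t, b ≤ |t| → g t = 0) →
      ν (p * (β * g.comp (reMap f))) = 0)
    (hfib : ∀ t, |t| < a → ∀ u : C(X, ℂ), ∀ ε > 0, ∃ p ∈ A, ∀ x ∈ tsupport β, (f x).re = t →
      ‖u x - p x‖ < ε)
    (g : C(ℝ, ℂ)) (hba : b < a) (hb : ∀ t, b ≤ |t| → g t = 0) (u : C(X, ℂ)) :
    ν (u * (β * g.comp (reMap f))) = 0 := by
  have key : ∀ ε > 0, ‖ν (u * (β * g.comp (reMap f)))‖ ≤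
      ‖ν‖ * (ε * (‖β‖ * ‖g.comp (reMap f)‖)) := by
    intro ε hε
    have hch : ∀ t : ℝ, ∃ p : C(X, ℂ), |t| < a → p ∈ A ∧ ∀ x ∈ tsupport β, (f x).re = t →
        ‖u x - p x‖ < ε := by
      intro t
      by_cases ht : |t| < a
      · obtain ⟨p, hp, hp'⟩ := hfib t ht u ε hε
        exact ⟨p, fun _ => ⟨hp, hp'⟩⟩
      · exact ⟨0, fun h => absurd h ht⟩
    choose p hp using hch
    let J : ℝ → Set ℝ := fun t => (reMap f '' (tsupport β ∩ {x | ε ≤ ‖u x - p t x‖}))ᶜ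
    have hJo : ∀ t, IsOpen (J t) := by
      intro t
      have : IsClosed (tsupport β ∩ {x | ε ≤ ‖u x - p t x‖}) :=
        (isClosed_tsupport _).inter (isClosed_le continuous_const (by fun_prop))
      exact (this.isCompact.image (reMap f).continuous).isClosed.isOpen_compl
    have hJm : ∀ t, |t| < a → t ∈ J t := by
      rintro t ht ⟨x, ⟨hx, hx'⟩, rfl⟩
      exact absurd ((hp _ ht).2 x hx rfl) (not_lt.2 hx')
    have hJu : ∀ t, ∀ x ∈ tsupport β, (f x).re ∈ J t → ‖u x - p t x‖ < ε := by
      intro t x hx hxJ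
      by_contra! hle
      exact hxJ ⟨x, ⟨hx, hle⟩, rfl⟩
    have hba' : ∀ t ∈ Set.Icc (-b) b, |t| < a := fun t ht => (abs_le.2 ht).trans_lt hba
    obtain ⟨T, hT, hcov⟩ := (isCompact_Icc (a := -b) (b := b)).elim_nhds_subcover J
      fun t ht => (hJo t).mem_nhds (hJm t (hba' t ht))
    let e := T.equivFin.symm
    obtain ⟨ρ, hρs, hρ1, hρ01, -⟩ := exists_continuous_sum_one_of_isOpen_isCompact
      (s := fun i => J (e i)) (t := Set.Icc (-b) b) (fun i => hJo _) isCompact_Icc (by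
        intro t ht
        obtain ⟨t', ht', hm⟩ := Set.mem_iUnion₂.1 (hcov ht)
        refine Set.mem_iUnion.2 ⟨T.equivFin ⟨t', ht'⟩, ?_⟩
        simpa [e] using hm)
    let ρc : Fin T.card → C(ℝ, ℂ) := fun i => ⟨fun t => (ρ i t : ℂ), by fun_prop⟩
    have hsum : ∀ t, (∑ i, (ρ i t : ℂ)) * g t = g t := by
      intro t
      by_cases ht : b ≤ |t|
      · rw [hb t ht, mul_zero]
      · have : (∑ i, ⇑(ρ i)) t = 1 := hρ1 (abs_le.1 (not_le.1 ht).le)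
        rw [Finset.sum_apply] at this
        rw [← Complex.ofReal_sum, this, Complex.ofReal_one, one_mul]
    have hzero : ν (∑ i, p (e i) * (β * (ρc i * g).comp (reMap f))) = 0 := by
      rw [map_sum]
      refine Finset.sum_eq_zero fun i _ => ?_
      refine h _ (hp _ (hba' _ (hT _ (e i).2))).1 _ b hba fun t ht => ?_
      rw [ContinuousMap.mul_apply, hb t ht, mul_zero]
    have hdec : u * (β * g.comp (reMap f)) =
        ∑ i, p (e i) * (β * (ρc i * g).comp (reMap f)) +
        ∑ i, (u - p (e i)) * (β * (ρc i * g).comp (reMap f)) := by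
      rw [← Finset.sum_add_distrib]
      ext x
      rw [ContinuousMap.sum_apply]
      simp only [ContinuousMap.add_apply, ContinuousMap.mul_apply, ContinuousMap.sub_apply,
        ContinuousMap.comp_apply, ρc, ContinuousMap.coe_mk]
      conv_lhs => rw [← hsum]
      rw [Finset.sum_mul, Finset.mul_sum, Finset.mul_sum]
      refine Finset.sum_congr rfl fun i _ => ?_
      ring
    rw [hdec, map_add, hzero, zero_add]
    refine (ν.le_opNorm _).trans ?_
    gcongr
    refine (ContinuousMap.norm_le _ (by positivity)).2 fun x => ?_
    rw [ContinuousMap.sum_apply]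
    have hterm : ∀ i, ‖((u - p (e i)) * (β * (ρc i * g).comp (reMap f))) x‖ ≤
        ε * (‖β x‖ * ‖g (reMap f x)‖) * ρ i (reMap f x) := by
      intro i
      have h0 := (hρ01 i (reMap f x)).1
      simp only [ContinuousMap.mul_apply, ContinuousMap.sub_apply,
        ContinuousMap.comp_apply, ρc, ContinuousMap.coe_mk, norm_mul, Complex.norm_real,
        Real.norm_of_nonneg h0]
      by_cases hβx : β x = 0
      · simp [hβx]
      by_cases hρx : ρ i (reMap f x) = 0
      · simp [hρx]
      · have := hJu _ x (subset_tsupport _ hβx) (hρs i (subset_tsupport _ hρx))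
        calc _ ≤ ε * (‖β x‖ * (ρ i (reMap f x) * ‖g (reMap f x)‖)) := by gcongr
          _ = _ := by ring
    refine (norm_sum_le _ _).trans ((Finset.sum_le_sum fun i _ => hterm i).trans ?_)
    rw [← Finset.mul_sum]
    have hs2 := congrArg norm (hsum (reMap f x))
    rw [← Complex.ofReal_sum, norm_mul, Complex.norm_real,
      Real.norm_of_nonneg (Finset.sum_nonneg fun i _ => (hρ01 i _).1)] at hs2
    calc _ = ε * (‖β x‖ * ((∑ i, ρ i (reMap f x)) * ‖g (reMap f x)‖)) := by ring
      _ = ε * (‖β x‖ * ‖g (reMap f x)‖) := by rw [hs2]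
      _ ≤ _ := by
        gcongr
        · exact β.norm_coe_le_norm x
        · exact (g.comp (reMap f)).norm_coe_le_norm x
  have hlim : Tendsto (fun ε : ℝ => ‖ν‖ * (ε * (‖β‖ * ‖g.comp (reMap f)‖))) (𝓝[>] 0) (𝓝 0) := by
    have : Tendsto (fun ε : ℝ => ‖ν‖ * (ε * (‖β‖ * ‖g.comp (reMap f)‖))) (𝓝 0)
        (𝓝 (‖ν‖ * (0 * (‖β‖ * ‖g.comp (reMap f)‖)))) :=
      (tendsto_id.mul_const _).const_mul _
    rw [zero_mul, mul_zero] at this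
    exact this.mono_left nhdsWithin_le_nhds
  refine norm_le_zero_iff.1 (ge_of_tendsto hlim ?_)
  filter_upwards [self_mem_nhdsWithin] with ε hε using key ε hε

/-- A sheet over a Lipschitz graph avoids the essential set, when the annihilating functionals are
killed off the graph and the algebra is dense on the fibres. -/
theorem notMem_essSet_of_sheet (A : Subalgebra ℂ C(X, ℂ)) [CompleteSpace A]
    (hA : IsClosed (A : Set C(X, ℂ))) (f q : A) {w₀ : ℂ} {r δ₁ κ : ℝ} {ψ : ℝ → ℝ}
    (hr : 0 < r) (hδ₁ : 0 < δ₁) (hU : ∀ w ∈ sphere w₀ r, Unimodular A f q 0 w)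
    (hψc : Continuous ψ) (hκ : κ ≤ 1 / 24) (hκ0 : 0 ≤ κ)
    (hψ : ∀ x y, |ψ x - ψ y| ≤ κ * |x - y|) (hψ0 : ψ 0 = 0)
    (hgraph : ∀ x, ‖(q : C(X, ℂ)) x - w₀‖ < r → ‖(f : C(X, ℂ)) x‖ < δ₁ →
      ((f : C(X, ℂ)) x).im = ψ ((f : C(X, ℂ)) x).re)
    (hfib : ∀ t, |t| < δ₁ → ∀ u : C(X, ℂ), ∀ ε > 0, ∃ p ∈ A, ∀ x,
      ‖(q : C(X, ℂ)) x - w₀‖ < r → ‖(f : C(X, ℂ)) x‖ < δ₁ → ((f : C(X, ℂ)) x).re = t →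
      ‖u x - p x‖ < ε)
    (hkill : ∀ δ > 0, δ ≤ δ₁ → ∀ β : C(X, ℂ),
      (∀ x ∈ tsupport β, ‖(q : C(X, ℂ)) x - w₀‖ < r ∧ ‖(f : C(X, ℂ)) x‖ < δ₁) →
      (∀ x, ‖(f : C(X, ℂ)) x‖ < δ → ‖(q : C(X, ℂ)) x - w₀‖ < r → β x = 1) →
      ∃ δ' > 0, δ' ≤ δ ∧ ∀ ν : C(X, ℂ) →L[ℂ] ℂ, (∀ g ∈ A, ν g = 0) → ∀ Λ : ℂ → ℂ,
        DifferentiableOn ℂ Λ (ball 0 δ) →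
        (∀ s ∈ ball (0 : ℂ) δ, s ∉ (f : C(X, ℂ)) '' tsupport β →
          (∀ w ∈ closedBall w₀ r, Unimodular A f q s w) → Λ s + ν (qdiv β f s) = 0) →
        ∀ s ∈ ball (0 : ℂ) δ', s.im ≠ ψ s.re → Λ s + ν (qdiv β f s) = 0)
    {x : X} (hx : (f : C(X, ℂ)) x = 0) (hxq : ‖(q : C(X, ℂ)) x - w₀‖ < r) : x ∉ essSet A := by
  obtain ⟨δ, hδ, hδle, β, hβs, hβ1, hβν⟩ := exists_sheet A f q hr hδ₁ hU
  obtain ⟨δ', hδ', hδ'le, hk⟩ := hkill δ hδ hδle β hβs hβ1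
  have hβg : ∀ y ∈ tsupport β, ((f : C(X, ℂ)) y).im = ψ ((f : C(X, ℂ)) y).re :=
    fun y hy => hgraph y (hβs y hy).1 (hβs y hy).2
  have hγ : ∀ t, |t| ≤ δ' / 3 → graphPt ψ t ∈ ball (0 : ℂ) δ' := by
    intro t ht
    have h1 := hψ t 0
    rw [hψ0, sub_zero, sub_zero] at h1
    have h2 : κ * |t| ≤ 1 * |t| := by
      gcongr
      linarith
    rw [mem_ball, dist_zero_right, graphPt]
    refine (norm_add_le _ _).trans_lt ?_
    rw [norm_mul, Complex.norm_I, Complex.norm_real, Complex.norm_real, Real.norm_eq_abs,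
      Real.norm_eq_abs]
    linarith
  have hvan : ∀ ν : C(X, ℂ) →L[ℂ] ℂ, (∀ g ∈ A, ν g = 0) → ∀ p ∈ (A : Set C(X, ℂ)),
      ∀ g : C(ℝ, ℂ), ∀ b < δ' / 3, (∀ t, b ≤ |t| → g t = 0) →
      ν (p * (β * g.comp (reMap f))) = 0 := by
    intro ν hν p hp g b hb hg
    let τ : C(X, ℂ) →L[ℂ] ℂ := ν.comp (ContinuousLinearMap.mul ℂ C(X, ℂ) p)
    have hτ : ∀ g ∈ A, τ g = 0 := fun g hg => hν _ (A.mul_mem hp hg)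
    obtain ⟨Λ, hΛ, hΛb, -⟩ := hβν τ hτ
    have h0 := hk τ hτ Λ hΛ hΛb
    have := graph_kill (f := (f : C(X, ℂ))) (β := β) (τ := τ) (Λ := fun s => - Λ s) (δ := δ')
      hψc hβg hκ hκ0 hψ ((hΛ.continuousOn.mono (ball_subset_ball hδ'le)).neg)
      (fun s hs hsi => by linear_combination h0 s hs hsi) hγ g b hb hg
    exact this
  have ha : δ' / 3 < δ₁ := by linarith
  let G : C(ℝ, ℂ) := ⟨fun t => ((max 0 (δ' / 6 - |t|) : ℝ) : ℂ), by fun_prop⟩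
  have hG : ∀ t, δ' / 6 ≤ |t| → G t = 0 := by
    intro t ht
    simp [G, ht]
  refine notMem_essSet hA (u := β * G.comp (reMap f)) ?_ fun ν hν v => ?_
  · have : β x = 1 := hβ1 x (by rw [hx, norm_zero]; exact hδ) hxq
    have h2 : reMap (f : C(X, ℂ)) x = 0 := by simp [reMap, hx]
    rw [ContinuousMap.mul_apply, ContinuousMap.comp_apply, this, h2, one_mul]
    have : (0 : ℝ) < δ' / 6 := by positivity
    simp only [G, ContinuousMap.coe_mk, abs_zero, sub_zero, max_eq_right this.le]
    exact_mod_cast this.ne'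
  · rw [mul_comm]
    exact vanish_of_fibre (hvan ν hν) (fun t ht u ε hε => by
      obtain ⟨p, hp, hp'⟩ := hfib t (ht.trans ha) u ε hε
      exact ⟨p, hp, fun y hy => hp' y (hβs y hy).1 (hβs y hy).2⟩) G (by linarith) hG v

end LocalKill

section HolomorphicC1

open Filter

variable {E : Type*} [NormedAddCommGroup E] [NormedSpace ℂ E]

theorem continuousOn_fderiv_apply {h : E → ℂ} {Ω : Set E} (hΩ : IsOpen Ω)
    (hh : DifferentiableOn ℂ h Ω) (e : E) : ContinuousOn (fun z => fderiv ℂ h z e) Ω := by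
  intro z hz
  refine ContinuousAt.continuousWithinAt ?_
  have hc : Continuous fun y : E × ℂ => y.1 + y.2 • e := by fun_prop
  have hev : ∀ᶠ y : E × ℂ in 𝓝 z ×ˢ 𝓝 0, y.1 + y.2 • e ∈ Ω := by
    rw [← nhds_prod_eq]
    exact hc.continuousAt.eventually (hΩ.mem_nhds (by simpa using hz))
  obtain ⟨V, hV, W, hW, hVW⟩ := Filter.mem_prod_iff.1 hev
  obtain ⟨r, hr, hrW⟩ := Metric.mem_nhds_iff.1 hW
  have hVW' : ∀ y ∈ V, ∀ t ∈ ball (0 : ℂ) r, y + t • e ∈ Ω := fun y hy t ht =>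
    hVW (Set.mk_mem_prod hy (hrW ht))
  have hderiv : ∀ y ∈ V, ∀ t ∈ ball (0 : ℂ) r,
      HasDerivAt (fun t : ℂ => h (y + t • e)) (fderiv ℂ h (y + t • e) e) t := by
    intro y hy t ht
    have h1 := (hh.differentiableAt (hΩ.mem_nhds (hVW' y hy t ht))).hasFDerivAt
    have h2 : HasDerivAt (fun t : ℂ => y + t • e) e t := by
      simpa using ((hasDerivAt_id t).smul_const e).const_add y
    exact h1.comp_hasDerivAt t h2
  have hlim : TendstoLocallyUniformlyOn (fun y t => h (y + t • e)) (fun t => h (z + t • e)) (𝓝 z)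
      (ball (0 : ℂ) r) := by
    rw [tendstoLocallyUniformlyOn_iff_forall_tendsto]
    intro t ht
    have hcz : ContinuousAt h (z + t • e) :=
      (hh.differentiableAt (hΩ.mem_nhds (hVW' z (mem_of_mem_nhds hV) t ht))).continuousAt
    have a1 : Tendsto (fun y : E × ℂ => h (z + y.2 • e)) (𝓝 (z, t)) (𝓝 (h (z + t • e))) := by
      have : ContinuousAt (fun y : E × ℂ => z + y.2 • e) (z, t) := by fun_prop
      exact Tendsto.comp hcz this
    have a2 : Tendsto (fun y : E × ℂ => h (y.1 + y.2 • e)) (𝓝 (z, t)) (𝓝 (h (z + t • e))) :=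
      Tendsto.comp hcz hc.continuousAt
    have a3 := (a1.prodMk_nhds a2).mono_right (nhds_le_uniformity _)
    refine a3.mono_left ?_
    rw [nhds_prod_eq]
    exact Filter.prod_mono le_rfl nhdsWithin_le_nhds
  have hd := hlim.deriv (by
    filter_upwards [hV] with y hy t ht
    exact (hderiv y hy t ht).differentiableAt.differentiableWithinAt) isOpen_ball
  have h0 := hd.tendsto_at (mem_ball_self hr)
  have hz0 : deriv (fun t : ℂ => h (z + t • e)) 0 = fderiv ℂ h z e := by
    simpa using (hderiv z (mem_of_mem_nhds hV) 0 (mem_ball_self hr)).deriv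
  rw [hz0] at h0
  refine h0.congr' ?_
  filter_upwards [hV] with y hy
  simpa using (hderiv y hy 0 (mem_ball_self hr)).deriv

theorem contDiffOn_one_of_differentiableOn [FiniteDimensional ℂ E] {h : E → ℂ} {Ω : Set E}
    (hΩ : IsOpen Ω) (hh : DifferentiableOn ℂ h Ω) : ContDiffOn ℂ 1 h Ω := by
  rw [← zero_add (1 : WithTop ℕ∞), contDiffOn_succ_iff_fderiv_of_isOpen hΩ]
  exact ⟨hh, by simp, contDiffOn_zero.2
    (continuousOn_clm_apply.2 fun e => continuousOn_fderiv_apply hΩ hh e)⟩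

end HolomorphicC1

section LevelCharts

open Filter

theorem exists_apply_single_ne {l : (Fin 2 → ℂ) →L[ℂ] ℂ} (hl : l ≠ 0) :
    ∃ i j : Fin 2, i ≠ j ∧ l (Pi.single j 1) ≠ 0 := by
  by_contra! hc
  apply hl
  have h0 := hc 1 0 (by decide)
  have h1 := hc 0 1 (by decide)
  ext v
  have : v = v 0 • Pi.single 0 1 + v 1 • Pi.single 1 1 := by
    ext k; fin_cases k <;> simp
  rw [this, map_add, map_smul, map_smul, h0, h1]
  simp

/-- The level set of a holomorphic function of two variables near a noncritical point is the
graph of a holomorphic function. -/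
theorem exists_level_chart {Ω : Set (Fin 2 → ℂ)} (hΩ : IsOpen Ω) {h : (Fin 2 → ℂ) → ℂ}
    (hh : DifferentiableOn ℂ h Ω) {x₀ : Fin 2 → ℂ} (hx₀ : x₀ ∈ Ω) {i j : Fin 2} (hij : i ≠ j)
    (hj : fderiv ℂ h x₀ (Pi.single j 1) ≠ 0) {ε : ℝ} (hε : 0 < ε) :
    ∃ r > 0, r ≤ ε ∧ ∃ δ > 0, δ ≤ ε ∧ ∃ σ : ℂ → (Fin 2 → ℂ),
      DifferentiableOn ℂ σ (ball 0 δ) ∧ σ 0 = x₀ ∧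
      (∀ s ∈ ball (0 : ℂ) δ, σ s i - x₀ i = s ∧ ‖σ s j - x₀ j‖ < r ∧ σ s ∈ Ω ∧ h (σ s) = h x₀) ∧
      ∀ z, ‖z i - x₀ i‖ < δ → ‖z j - x₀ j‖ ≤ r → z ∈ Ω ∧ (h z = h x₀ → z = σ (z i - x₀ i)) := by
  have hC : ContDiffAt ℂ 1 h x₀ :=
    (contDiffOn_one_of_differentiableOn hΩ hh).contDiffAt (hΩ.mem_nhds hx₀)
  have hall : ∀ k, k = i ∨ k = j := by clear hj; revert i j; decide
  set Φ : (Fin 2 → ℂ) → (Fin 2 → ℂ) := fun z => z + (h z - z j) • Pi.single j (1 : ℂ) with hΦ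
  have Φi : ∀ z, Φ z i = z i := fun z => by simp [hΦ, hij]
  have Φj : ∀ z, Φ z j = h z := fun z => by simp [hΦ]
  have hΦC : ContDiffAt ℂ 1 Φ x₀ := by
    have : ContDiffAt ℂ 1 (fun z : Fin 2 → ℂ => z j) x₀ := by fun_prop
    exact contDiffAt_id.add ((hC.sub this).smul contDiffAt_const)
  set l := fderiv ℂ h x₀ with hl
  let D : (Fin 2 → ℂ) →L[ℂ] (Fin 2 → ℂ) := ContinuousLinearMap.id ℂ _ +
    (l - ContinuousLinearMap.proj j).smulRight (Pi.single j (1 : ℂ))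
  have hD : HasFDerivAt Φ D x₀ := by
    have h1 := (hC.differentiableAt one_ne_zero).hasFDerivAt
    have h2 : HasFDerivAt (fun z : Fin 2 → ℂ => z j) (ContinuousLinearMap.proj j : _ →L[ℂ] ℂ) x₀ :=
      (ContinuousLinearMap.proj (R := ℂ) (φ := fun _ : Fin 2 => ℂ) j).hasFDerivAt
    exact (hasFDerivAt_id x₀).add ((h1.sub h2).smul_const _)
  have hinj : Function.Injective D := by
    rw [injective_iff_map_eq_zero]
    intro v hv
    have hvi : v i = 0 := by simpa [D, hij] using congrFun hv i
    have hvj : l v = 0 := by simpa [D] using congrFun hv j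
    have hv' : v = v j • Pi.single j 1 := by
      ext k
      rcases hall k with rfl | rfl
      · simp [hvi, hij]
      · simp
    rw [hv', map_smul, smul_eq_zero, or_iff_left hj] at hvj
    rw [hv', hvj, zero_smul]
  let D' : (Fin 2 → ℂ) ≃L[ℂ] (Fin 2 → ℂ) :=
    (LinearEquiv.ofInjectiveEndo (D : (Fin 2 → ℂ) →ₗ[ℂ] _) hinj).toContinuousLinearEquiv
  have hD' : HasFDerivAt Φ (D' : (Fin 2 → ℂ) →L[ℂ] (Fin 2 → ℂ)) x₀ := by
    convert hD using 1
    ext v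
    rfl
  let e := hΦC.toOpenPartialHomeomorph Φ hD' one_ne_zero
  have he : ∀ z, e z = Φ z := fun z => rfl
  have hx₀e : x₀ ∈ e.source := hΦC.mem_toOpenPartialHomeomorph_source hD' one_ne_zero
  have hinvC : ContDiffAt ℂ 1 e.symm (Φ x₀) := hΦC.to_localInverse hD' one_ne_zero
  -- the polydisc
  have hnb : e.source ∩ Ω ∈ 𝓝 x₀ := inter_mem (e.open_source.mem_nhds hx₀e) (hΩ.mem_nhds hx₀)
  obtain ⟨ρ, hρ, hρs⟩ := Metric.nhds_basis_closedBall.mem_iff.1 hnb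
  set r := min ρ ε with hr
  have hr0 : 0 < r := lt_min hρ hε
  set c : ℂ → (Fin 2 → ℂ) := fun s => Φ x₀ + s • Pi.single i (1 : ℂ) with hc
  have hc0 : c 0 = Φ x₀ := by simp [hc]
  have hcd : Differentiable ℂ c := by fun_prop
  have hcc : Tendsto c (𝓝 0) (𝓝 (Φ x₀)) := by
    rw [← hc0]; exact hcd.continuous.continuousAt
  have hev1 : ∀ᶠ s in 𝓝 (0 : ℂ), c s ∈ e.target :=
    hcc.eventually (e.open_target.mem_nhds (e.map_source hx₀e))
  have hev2 : ∀ᶠ s in 𝓝 (0 : ℂ), DifferentiableAt ℂ e.symm (c s) := by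
    have := hinvC.eventually (by simp)
    exact (hcc.eventually this).mono fun s hs => hs.differentiableAt one_ne_zero
  have hev3 : ∀ᶠ s in 𝓝 (0 : ℂ), e.symm (c s) ∈ ball x₀ r := by
    have h1 : e.symm (Φ x₀) = x₀ := e.left_inv hx₀e
    have h2 : Tendsto e.symm (𝓝 (Φ x₀)) (𝓝 x₀) := by
      have := hinvC.continuousAt.tendsto
      rwa [h1] at this
    exact (h2.comp hcc).eventually (ball_mem_nhds x₀ hr0)
  obtain ⟨δ', hδ', hδs⟩ := Metric.eventually_nhds_iff_ball.1 (hev1.and (hev2.and hev3))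
  set δ := min δ' r with hδ
  have hδ0 : 0 < δ := lt_min hδ' hr0
  have hsub : ball (0 : ℂ) δ ⊆ ball 0 δ' := ball_subset_ball (min_le_left _ _)
  have hcj : ∀ s, c s j = h x₀ := fun s => by simp [hc, hij.symm, Φj]
  have hci : ∀ s, c s i = x₀ i + s := fun s => by simp [hc, Φi]
  refine ⟨r, hr0, min_le_right _ _, δ, hδ0, (min_le_right _ _).trans (min_le_right _ _),
    fun s => e.symm (c s), ?_, ?_, ?_, ?_⟩
  · intro s hs
    exact ((hδs s (hsub hs)).2.1.comp s hcd.differentiableAt).differentiableWithinAt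
  · simp only [hc0]
    exact e.left_inv hx₀e
  · intro s hs
    obtain ⟨h1, -, h3⟩ := hδs s (hsub hs)
    have h4 : Φ (e.symm (c s)) = c s := e.right_inv h1
    have h6 : ‖e.symm (c s) - x₀‖ < r := by rwa [mem_ball, dist_eq_norm] at h3
    refine ⟨?_, ?_, ?_, ?_⟩
    · beta_reduce
      rw [← Φi (e.symm (c s)), h4, hci, add_sub_cancel_left]
    · exact (norm_le_pi_norm (e.symm (c s) - x₀) j).trans_lt h6
    · refine (hρs ?_).2
      rw [mem_closedBall, dist_eq_norm]
      exact h6.le.trans (min_le_left _ _)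
    · beta_reduce
      rw [← Φj (e.symm (c s)), h4, hcj]
  · intro z hzi hzj
    have hz : z ∈ closedBall x₀ ρ := by
      rw [mem_closedBall, dist_eq_norm, pi_norm_le_iff_of_nonneg hρ.le]
      intro k
      rcases hall k with rfl | rfl
      · exact (hzi.le.trans (min_le_right _ _)).trans (min_le_left _ _)
      · exact hzj.trans (min_le_left _ _)
    refine ⟨(hρs hz).2, fun hhz => ?_⟩
    have h1 : Φ z = c (z i - x₀ i) := by
      ext k
      rcases hall k with rfl | rfl
      · rw [Φi, hci]; ring
      · rw [Φj, hcj, hhz]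
    show z = e.symm (c (z i - x₀ i))
    rw [← h1]
    exact (e.left_inv (hρs hz).1).symm

/-- The zero set of `v` near `p₀`, seen through `F`, is a Lipschitz graph. -/
theorem exists_graph_chart {F : ℝ × ℝ → ℂ} {v : ℝ × ℝ → ℝ} {p₀ V : ℝ × ℝ}
    (hF : ContDiffAt ℝ 1 F p₀) (hv : ContDiffAt ℝ 1 v p₀) (hF0 : F p₀ = 0) (hv0 : v p₀ = 0)
    (hFV : fderiv ℝ F p₀ V = 1) (hvV : fderiv ℝ v p₀ V = 0) (hdv : fderiv ℝ v p₀ ≠ 0) {κ : ℝ}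
    (hκ : 0 < κ) :
    ∃ N ∈ 𝓝 p₀, ∃ η > 0, ∃ (g : ℝ → ℝ × ℝ) (ψ : ℝ → ℝ), ψ 0 = 0 ∧
      (∀ x y, |ψ x - ψ y| ≤ κ * |x - y|) ∧ g 0 = p₀ ∧ ContinuousOn g (Set.Ioo (-η) η) ∧
      (∀ t ∈ Set.Ioo (-η) η, v (g t) = 0 ∧ F (g t) = graphPt ψ t) ∧
      ∀ p ∈ N, v p = 0 → (F p).re ∈ Set.Ioo (-η) η ∧ g (F p).re = p ∧
        (F p).im = ψ (F p).re := by
  set Φ : ℝ × ℝ → ℝ × ℝ := fun p => ((F p).re, v p) with hΦ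
  have hre : ContDiffAt ℝ 1 (fun p => (F p).re) p₀ := Complex.reCLM.contDiff.contDiffAt.comp p₀ hF
  have hΦC : ContDiffAt ℝ 1 Φ p₀ := hre.prodMk hv
  have hdF := (hF.differentiableAt one_ne_zero).hasFDerivAt
  have hdv' := (hv.differentiableAt one_ne_zero).hasFDerivAt
  let D : ℝ × ℝ →L[ℝ] ℝ × ℝ := (Complex.reCLM.comp (fderiv ℝ F p₀)).prod (fderiv ℝ v p₀)
  have hD : HasFDerivAt Φ D p₀ := (Complex.reCLM.hasFDerivAt.comp p₀ hdF).prodMk hdv'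
  obtain ⟨W, hW⟩ : ∃ W, fderiv ℝ v p₀ W ≠ 0 := by
    by_contra! hc
    exact hdv (ContinuousLinearMap.ext hc)
  have hsurj : Function.Surjective D := by
    rintro ⟨a, b⟩
    refine ⟨(a - (b / fderiv ℝ v p₀ W) * (fderiv ℝ F p₀ W).re) • V + (b / fderiv ℝ v p₀ W) • W, ?_⟩
    simp only [D, ContinuousLinearMap.prod_apply, ContinuousLinearMap.comp_apply, map_add, map_smul,
      hFV, hvV, Complex.reCLM_apply]
    ext
    · simp
    · simp [hW]
  have hinj : Function.Injective D :=
    (LinearMap.injective_iff_surjective (f := (D : ℝ × ℝ →ₗ[ℝ] ℝ × ℝ))).2 hsurj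
  let D' : (ℝ × ℝ) ≃L[ℝ] (ℝ × ℝ) :=
    (LinearEquiv.ofInjectiveEndo (D : (ℝ × ℝ) →ₗ[ℝ] _) hinj).toContinuousLinearEquiv
  have hDD : (D' : ℝ × ℝ →L[ℝ] ℝ × ℝ) = D := by ext <;> rfl
  have hD' : HasFDerivAt Φ (D' : (ℝ × ℝ) →L[ℝ] (ℝ × ℝ)) p₀ := by rwa [hDD]
  let e := hΦC.toOpenPartialHomeomorph Φ hD' one_ne_zero
  have hpe : p₀ ∈ e.source := hΦC.mem_toOpenPartialHomeomorph_source hD' one_ne_zero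
  have hinvC : ContDiffAt ℝ 1 e.symm (Φ p₀) := hΦC.to_localInverse hD' one_ne_zero
  have hΦ0 : Φ p₀ = ((0 : ℝ), (0 : ℝ)) := by simp [hΦ, hF0, hv0]
  have hs0 : e.symm (0, 0) = p₀ := by rw [← hΦ0]; exact e.left_inv hpe
  rw [hΦ0] at hinvC
  set g : ℝ → ℝ × ℝ := fun t => e.symm (t, 0) with hg
  have hιC : ContDiffAt ℝ 1 (fun t : ℝ => (t, (0 : ℝ))) 0 := by fun_prop
  have hgC : ContDiffAt ℝ 1 g 0 := ContDiffAt.comp (f := fun t : ℝ => (t, (0 : ℝ))) 0 hinvC hιC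
  have hg0 : g 0 = p₀ := hs0
  have hFg : ContDiffAt ℝ 1 (fun t => F (g t)) 0 := ContDiffAt.comp 0 (by rwa [hg0]) hgC
  have hψC : ContDiffAt ℝ 1 (fun t => (F (g t)).im) 0 :=
    Complex.imCLM.contDiff.contDiffAt.comp 0 hFg
  have hιt : ∀ᶠ t in 𝓝 (0 : ℝ), (t, (0 : ℝ)) ∈ e.target := by
    have h1 : e.target ∈ 𝓝 ((0 : ℝ), (0 : ℝ)) := by
      rw [← hΦ0]; exact e.open_target.mem_nhds (e.map_source hpe)
    exact hιC.continuousAt.eventually h1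
  have hΦg : ∀ t, (t, (0 : ℝ)) ∈ e.target → Φ (g t) = (t, 0) := fun t ht => e.right_inv ht
  -- the derivative of the graph function vanishes at `0`
  have hgV : HasDerivAt g V 0 := by
    have h1 : HasFDerivAt g (fderiv ℝ g 0) 0 := (hgC.differentiableAt one_ne_zero).hasFDerivAt
    have h2 : HasDerivAt g (fderiv ℝ g 0 1) 0 := h1.hasDerivAt
    have h3 : HasDerivAt (fun t => Φ (g t)) (D (fderiv ℝ g 0 1)) 0 := by
      rw [← hg0] at hD
      exact hD.comp_hasDerivAt (0 : ℝ) h2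
    have h4 : HasDerivAt (fun t : ℝ => (t, (0 : ℝ))) ((1 : ℝ), (0 : ℝ)) 0 :=
      (hasDerivAt_id 0).prodMk (hasDerivAt_const 0 0)
    have h5 := h3.unique (h4.congr_of_eventuallyEq (hιt.mono fun t ht => hΦg t ht))
    have h6 : D V = ((1 : ℝ), (0 : ℝ)) := by
      simp [D, hFV, hvV]
    have h7 := hinj (h5.trans h6.symm)
    rwa [h7] at h2
  have hψ' : HasStrictDerivAt (fun t => (F (g t)).im) 0 0 := by
    have h1 : HasDerivAt (fun t => F (g t)) (fderiv ℝ F p₀ V) 0 := by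
      have h0 : HasFDerivAt F (fderiv ℝ F p₀) (g 0) := by rwa [hg0]
      exact h0.comp_hasDerivAt (0 : ℝ) hgV
    have h2 : HasDerivAt (fun t => (F (g t)).im) 0 0 := by
      have := Complex.imCLM.hasFDerivAt.comp_hasDerivAt (0 : ℝ) h1
      rw [hFV, Complex.imCLM_apply, Complex.one_im] at this
      exact this
    have h3 := hψC.hasStrictDerivAt one_ne_zero
    rwa [h2.deriv] at h3
  obtain ⟨T, hT, hTL⟩ : ∃ T ∈ 𝓝 (0 : ℝ), LipschitzOnWith κ.toNNReal (fun t => (F (g t)).im) T := by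
    refine HasStrictFDerivAt.exists_lipschitzOnWith_of_nnnorm_lt hψ' κ.toNNReal ?_
    simpa using hκ
  have hgc : ∀ᶠ t in 𝓝 (0 : ℝ), ContinuousAt g t :=
    (hgC.eventually (by simp)).mono fun t ht => ht.continuousAt
  obtain ⟨η, hη, hηT⟩ := Metric.eventually_nhds_iff_ball.1 (hιt.and (hgc.and hT))
  rw [Real.ball_eq_Ioo, zero_sub, zero_add] at hηT
  obtain ⟨ψ, hψL, hψe⟩ := (hTL.mono fun t (ht : t ∈ Set.Ioo (-η) η) => (hηT t ht).2.2).extend_real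
  have h0η : (0 : ℝ) ∈ Set.Ioo (-η) η := ⟨by linarith, hη⟩
  refine ⟨e.source ∩ {p | (F p).re ∈ Set.Ioo (-η) η}, ?_, η, hη, g, ψ, ?_, ?_, hg0, ?_, ?_, ?_⟩
  · refine inter_mem (e.open_source.mem_nhds hpe) (hre.continuousAt.preimage_mem_nhds ?_)
    exact isOpen_Ioo.mem_nhds (by rw [hF0]; exact h0η)
  · rw [← hψe h0η]
    simp [hg0, hF0]
  · intro x y
    have := hψL.dist_le_mul x y
    rwa [Real.dist_eq, Real.dist_eq, Real.coe_toNNReal _ hκ.le] at this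
  · exact fun t ht => (hηT t ht).2.1.continuousWithinAt
  · intro t ht
    have h1 := hΦg t (hηT t ht).1
    have h2 : (F (g t)).re = t := congrArg Prod.fst h1
    have h3 : (F (g t)).im = ψ t := hψe ht
    refine ⟨congrArg Prod.snd h1, ?_⟩
    apply Complex.ext
    · simp [graphPt, h2]
    · simp [graphPt, h3]
  · rintro p ⟨hp, hpη⟩ hvp
    have h1 : g (F p).re = p := by
      have : Φ p = ((F p).re, 0) := by simp [hΦ, hvp]
      show e.symm ((F p).re, 0) = p
      rw [← this]
      exact e.left_inv hp
    refine ⟨hpη, h1, ?_⟩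
    rw [← hψe hpη]
    simp only [h1]

end LevelCharts

section LevelSides

open Filter

/-- A holomorphic parametrization `σ` of a piece of a complex curve `V` containing the polynomial
hull of `X`, in which `X` lies over a Lipschitz graph. -/
structure LevelChart (X V : Set (Fin 2 → ℂ)) (x₀ : Fin 2 → ℂ) where
  /-- index of the coordinate used as parameter -/
  i : Fin 2
  /-- index of the coordinate separating the sheets -/
  j : Fin 2
  /-- scaling of the parameter -/
  ω : ℂ
  /-- radius in the separating coordinate -/
  r : ℝ
  /-- radius in the parameter -/
  δ : ℝ
  /-- the parametrization -/
  σ : ℂ → (Fin 2 → ℂ)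
  /-- the function whose graph carries `X` -/
  ψ : ℝ → ℝ
  r_pos : 0 < r
  δ_pos : 0 < δ
  σ_diff : DifferentiableOn ℂ σ (ball 0 δ)
  σ_zero : σ 0 = x₀
  σ_param : ∀ s ∈ ball (0 : ℂ) δ, ω * (σ s i - x₀ i) = s
  σ_near : ∀ s ∈ ball (0 : ℂ) δ, ‖σ s j - x₀ j‖ < r
  σ_mem : ∀ s ∈ ball (0 : ℂ) δ, σ s ∈ V
  σ_unique : ∀ z ∈ V, ‖ω * (z i - x₀ i)‖ < δ → ‖z j - x₀ j‖ ≤ r → z = σ (ω * (z i - x₀ i))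
  hull_sub : ∀ z ∈ polyHull 2 X, ‖ω * (z i - x₀ i)‖ < δ → ‖z j - x₀ j‖ ≤ r → z ∈ V
  ψ_zero : ψ 0 = 0
  ψ_lip : ∀ x y, |ψ x - ψ y| ≤ 1 / 24 * |x - y|
  graph : ∀ z ∈ X, ‖ω * (z i - x₀ i)‖ < δ → ‖z j - x₀ j‖ < r →
    (ω * (z i - x₀ i)).im = ψ (ω * (z i - x₀ i)).re

namespace LevelChart

variable {X V : Set (Fin 2 → ℂ)} [CompactSpace X] {x₀ : Fin 2 → ℂ} (c : LevelChart X V x₀)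

/-- The parameter as a function on `X`. -/
def f : polyAlg X :=
  ⟨c.ω • (coordFun X c.i - algebraMap ℂ _ (x₀ c.i)),
    Subalgebra.smul_mem _ (sub_mem (coordFun_mem _) (Subalgebra.algebraMap_mem _ _)) _⟩

/-- The separating coordinate as a function on `X`. -/
def q : polyAlg X := ⟨coordFun X c.j, coordFun_mem _⟩

theorem f_apply (x : X) : (c.f : C(X, ℂ)) x = c.ω * (x.1 c.i - x₀ c.i) := rfl

theorem q_apply (x : X) : (c.q : C(X, ℂ)) x = x.1 c.j := rfl

theorem char_f {μ : C(X, ℂ) →L[ℂ] ℂ} (hμ : IsCharOn (polyAlg X) μ) :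
    μ c.f = c.ω * (μ (coordFun X c.i) - x₀ c.i) := by
  have h : μ (algebraMap ℂ C(X, ℂ) (x₀ c.i)) = x₀ c.i := by
    rw [Algebra.algebraMap_eq_smul_one, map_smul, hμ.2, smul_eq_mul, mul_one]
  show μ (c.ω • (coordFun X c.i - algebraMap ℂ _ (x₀ c.i))) = _
  rw [map_smul, map_sub, h, smul_eq_mul]

theorem unimodular {s : ℂ} (hs : s ∈ ball (0 : ℂ) c.δ) {w : ℂ} (hw : w ∈ closedBall (x₀ c.j) c.r)
    (h : c.σ s ∈ polyHull 2 X → c.σ s c.j ≠ w) : Unimodular (polyAlg X) c.f c.q s w := by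
  by_contra hc
  obtain ⟨μ, hμ, h1, h2⟩ := exists_isCharOn hc
  have hm := hμ.mem_polyHull
  set y : Fin 2 → ℂ := fun k => μ (coordFun X k) with hy
  have h3 : c.ω * (y c.i - x₀ c.i) = s := by rw [← h1, c.char_f hμ]
  have h4 : y c.j = w := h2
  have h5 : ‖c.ω * (y c.i - x₀ c.i)‖ < c.δ := by rw [h3]; simpa using hs
  have h6 : ‖y c.j - x₀ c.j‖ ≤ c.r := by rw [h4]; simpa [dist_eq_norm] using hw
  have h7 := c.σ_unique y (c.hull_sub y hm h5 h6) h5 h6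
  rw [h3] at h7
  rw [h7] at hm h4
  exact h hm h4

theorem unimodular_sphere {w : ℂ} (hw : w ∈ sphere (x₀ c.j) c.r) :
    Unimodular (polyAlg X) c.f c.q 0 w := by
  refine c.unimodular (mem_ball_self c.δ_pos) (sphere_subset_closedBall hw) fun _ h => ?_
  rw [c.σ_zero] at h
  rw [mem_sphere, ← h, dist_self] at hw
  exact c.r_pos.ne hw

theorem exists_char {s : ℂ} (hs : s ∈ ball (0 : ℂ) c.δ) (h : c.σ s ∈ polyHull 2 X) :
    ∃ μ : C(X, ℂ) →L[ℂ] ℂ, IsCharOn (polyAlg X) μ ∧ μ c.f = s ∧ μ c.q = c.σ s c.j := by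
  obtain ⟨μ, hμ, -, hv⟩ := exists_isCharOn_of_mem_polyHull h
  have hk : ∀ k, μ (coordFun X k) = c.σ s k := by
    intro k
    rw [← polyMap_X, hv, MvPolynomial.eval_X]
  refine ⟨μ, hμ, ?_, hk _⟩
  rw [c.char_f hμ, hk, c.σ_param s hs]

theorem isClosed_polyHull {n : ℕ} (K : Set (Fin n → ℂ)) : IsClosed (polyHull n K) := by
  have : polyHull n K = ⋂ p : MvPolynomial (Fin n) ℂ,
      {z | ‖MvPolynomial.eval z p‖ ≤ sSup ((fun w => ‖MvPolynomial.eval w p‖) '' K)} := by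
    ext z
    simp [polyHull]
  rw [this]
  exact isClosed_iInter fun p => isClosed_le (MvPolynomial.continuous_eval p).norm continuous_const

/-- Away from the image of `X`, membership of `σ s` in the hull is locally constant. -/
theorem exists_clopen : ∃ ε > 0, ε ≤ c.δ ∧ ∃ T : Set ℂ, IsCompact T ∧
    (∀ s ∈ T, ∃ x ∈ X, ‖c.ω * (x c.i - x₀ c.i)‖ < c.δ ∧ ‖x c.j - x₀ c.j‖ < c.r ∧
      c.ω * (x c.i - x₀ c.i) = s) ∧
    ∀ B ⊆ ball (0 : ℂ) ε, Disjoint B T → IsPreconnected B →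
      (∀ s ∈ B, c.σ s ∈ polyHull 2 X) ∨ (∀ s ∈ B, c.σ s ∉ polyHull 2 X) := by
  obtain ⟨ε, hε, hεδ, β, hβ, -, hν⟩ := exists_sheet (polyAlg X) c.f c.q c.r_pos c.δ_pos
    fun w hw => c.unimodular_sphere hw
  refine ⟨ε, hε, hεδ, (c.f : C(X, ℂ)) '' tsupport β,
    (isClosed_tsupport β).isCompact.image (ContinuousMap.continuous _), ?_, ?_⟩
  · rintro _ ⟨x, hx, rfl⟩
    exact ⟨x.1, x.2, (hβ x hx).2, (hβ x hx).1, rfl⟩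
  intro B hB hBT hBc
  have hsub : B ⊆ ball (0 : ℂ) c.δ := hB.trans (ball_subset_ball hεδ)
  have hclosed : ∀ s ∈ B, c.σ s ∉ polyHull 2 X → ∀ᶠ t in 𝓝[B] s, c.σ t ∉ polyHull 2 X := by
    intro s hs h
    have h1 : ContinuousAt c.σ s :=
      (c.σ_diff.differentiableAt (isOpen_ball.mem_nhds (hsub hs))).continuousAt
    exact (h1.eventually ((isClosed_polyHull X).isOpen_compl.mem_nhds h)).filter_mono
      nhdsWithin_le_nhds
  have hopen : ∀ s ∈ B, c.σ s ∈ polyHull 2 X → ∀ᶠ t in 𝓝[B] s, c.σ t ∈ polyHull 2 X := by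
    intro s hs h
    obtain ⟨μ, hμ, hμf, hμq⟩ := c.exists_char (hsub hs) h
    let ν : C(X, ℂ) →L[ℂ] ℂ := μ.comp
      (ContinuousLinearMap.mul ℂ C(X, ℂ) ((c.f : C(X, ℂ)) - algebraMap ℂ _ s))
    have hνe : ∀ g, ν g = μ (((c.f : C(X, ℂ)) - algebraMap ℂ _ s) * g) := fun g => rfl
    have hfs : (c.f : C(X, ℂ)) - algebraMap ℂ _ s ∈ polyAlg X :=
      sub_mem c.f.2 (Subalgebra.algebraMap_mem _ _)
    have hνA : ∀ g ∈ polyAlg X, ν g = 0 := by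
      intro g hg
      rw [hνe, hμ.1 _ hfs _ hg, map_sub, hμf, Algebra.algebraMap_eq_smul_one, map_smul, hμ.2]
      simp
    obtain ⟨Λ, hΛ, hb, hd⟩ := hν ν hνA
    have hsT := Set.disjoint_left.1 hBT hs
    have h1 := hd s (hB hs) hsT μ hνe hμ.1 hμ.2 (by rw [hμq]; exact c.σ_near s (hsub hs))
    have hcont : ContinuousAt (fun t => Λ t + ν (qdiv β c.f t)) s := by
      refine ContinuousAt.add (hΛ.differentiableAt (isOpen_ball.mem_nhds (hB hs))).continuousAt ?_
      exact ν.continuous.continuousAt.comp (contDiffAt_qdiv hsT).continuousAt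
    have h2 : ∀ᶠ t in 𝓝[B] s, Λ t + ν (qdiv β c.f t) ≠ 0 :=
      (hcont.eventually_ne (by rw [h1]; exact one_ne_zero)).filter_mono nhdsWithin_le_nhds
    filter_upwards [h2, self_mem_nhdsWithin] with t ht htB
    by_contra hc
    exact ht (hb t (hB htB) (Set.disjoint_left.1 hBT htB) fun w hw =>
      c.unimodular (hsub htB) hw fun h => absurd h hc)
  classical
  have hloc : ContinuousOn (fun s => decide (c.σ s ∈ polyHull 2 X)) B := by
    intro s hs
    refine tendsto_const_nhds.congr' ?_
    by_cases h : c.σ s ∈ polyHull 2 X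
    · filter_upwards [hopen s hs h] with t ht
      simp [h, ht]
    · filter_upwards [hclosed s hs h] with t ht
      simp [h, ht]
  rcases B.eq_empty_or_nonempty with rfl | ⟨s₀, hs₀⟩
  · simp
  have hall : ∀ s ∈ B, (c.σ s ∈ polyHull 2 X ↔ c.σ s₀ ∈ polyHull 2 X) := by
    intro s hs
    exact decide_eq_decide.1 (hBc.constant hloc hs hs₀)
  by_cases h : c.σ s₀ ∈ polyHull 2 X
  · exact Or.inl fun s hs => (hall s hs).2 h
  · exact Or.inr fun s hs h' => h ((hall s hs).1 h')

end LevelChart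

end LevelSides

section LevelTrichotomy

open Filter

/-- The part of a square lying on one side of a graph. -/
def graphSide (ψ : ℝ → ℝ) (a e : ℝ) : Set ℂ :=
  {s | |s.re| < a ∧ |s.im| < a ∧ 0 < e * (s.im - ψ s.re)}

variable {ψ : ℝ → ℝ} {a : ℝ}

theorem abs_graph_le (hψ0 : ψ 0 = 0) (hψ : ∀ x y, |ψ x - ψ y| ≤ 1 / 24 * |x - y|) (x : ℝ) :
    |ψ x| ≤ 1 / 24 * |x| := by
  simpa [hψ0] using hψ x 0

theorem continuous_of_abs_sub_le (hψ : ∀ x y, |ψ x - ψ y| ≤ 1 / 24 * |x - y|) : Continuous ψ := by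
  have : LipschitzWith (1 / 24) ψ := LipschitzWith.of_dist_le_mul fun x y => by
    simpa [Real.dist_eq] using hψ x y
  exact this.continuous

theorem isPreconnected_graphSide (hψ0 : ψ 0 = 0)
    (hψ : ∀ x y, |ψ x - ψ y| ≤ 1 / 24 * |x - y|) {e : ℝ} (he : e = 1 ∨ e = -1) :
    IsPreconnected (graphSide ψ a e) := by
  have hψc := continuous_of_abs_sub_le hψ
  set G : ℝ × ℝ → ℂ := fun p =>
    (p.1 : ℂ) + Complex.I * ((ψ p.1 + e * (p.2 * (a - e * ψ p.1)) : ℝ) : ℂ) with hG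
  have hGc : Continuous G := by fun_prop
  have hre : ∀ p, (G p).re = p.1 := fun p => by simp [hG]
  have him : ∀ p, (G p).im = ψ p.1 + e * (p.2 * (a - e * ψ p.1)) := fun p => by
    simp [hG, -Complex.ofReal_add, -Complex.ofReal_mul]
  have hpre : IsPreconnected (Set.Ioo (-a) a ×ˢ Set.Ioo (0 : ℝ) 1) :=
    ((convex_Ioo _ _).prod (convex_Ioo _ _)).isPreconnected
  have himg : graphSide ψ a e = G '' (Set.Ioo (-a) a ×ˢ Set.Ioo (0 : ℝ) 1) := by
    ext s
    constructor
    · rintro ⟨h1, h2, h3⟩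
      have h4 := abs_graph_le hψ0 hψ s.re
      rw [abs_lt] at h1 h2
      have h5 : |ψ s.re| < a := by
        have := abs_lt.2 h1
        have h0 := abs_nonneg s.re
        linarith
      rw [abs_lt] at h5
      have h6 : 0 < a - e * ψ s.re := by
        rcases he with rfl | rfl <;> linarith
      refine ⟨(s.re, e * (s.im - ψ s.re) / (a - e * ψ s.re)), ⟨h1, div_pos h3 h6, ?_⟩, ?_⟩
      · rw [div_lt_one h6]
        rcases he with rfl | rfl <;> linarith
      · apply Complex.ext
        · rw [hre]
        · rw [him]
          simp only
          rw [div_mul_cancel₀ _ h6.ne']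
          rcases he with rfl | rfl <;> ring
    · rintro ⟨⟨x, t⟩, ⟨hx, ht⟩, rfl⟩
      have h4 := abs_graph_le hψ0 hψ x
      have h1 := abs_lt.2 hx
      have h5 : |ψ x| < a := by
        have h0 := abs_nonneg x
        simp only at h1
        linarith
      rw [abs_lt] at h5
      simp only [Set.mem_Ioo] at ht hx
      refine ⟨by rw [hre]; exact h1, ?_, ?_⟩
      · rw [him, abs_lt]
        rcases he with rfl | rfl <;> constructor <;> nlinarith
      · rw [him, hre]
        have h6 : 0 < a - e * ψ x := by
          rcases he with rfl | rfl <;> linarith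
        have h7 : e * e = 1 := by rcases he with rfl | rfl <;> norm_num
        have : e * (ψ x + e * (t * (a - e * ψ x)) - ψ x) = (e * e) * (t * (a - e * ψ x)) := by ring
        simp only
        rw [this, h7, one_mul]
        exact mul_pos ht.1 h6
  rw [himg]
  exact hpre.image _ hGc.continuousOn

theorem abs_im_graphPt_lt (hψ0 : ψ 0 = 0) (hψ : ∀ x y, |ψ x - ψ y| ≤ 1 / 24 * |x - y|) {t : ℝ}
    (ht : |t| < a) : |ψ t| < a := by
  have := abs_graph_le hψ0 hψ t
  have h0 := abs_nonneg t
  linarith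

theorem tendsto_graphPt_add (t e : ℝ) :
    Tendsto (fun η : ℝ => graphPt ψ t + (e * η : ℝ) * Complex.I) (𝓝[>] 0) (𝓝 (graphPt ψ t)) := by
  have h : Continuous (fun η : ℝ => graphPt ψ t + (e * η : ℝ) * Complex.I) := by fun_prop
  have h0 := h.tendsto 0
  simp only [mul_zero, Complex.ofReal_zero, zero_mul, add_zero] at h0
  exact h0.mono_left nhdsWithin_le_nhds

theorem eventually_mem_graphSide (hψ0 : ψ 0 = 0) (hψ : ∀ x y, |ψ x - ψ y| ≤ 1 / 24 * |x - y|)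
    {t e : ℝ} (ht : |t| < a) (he : e = 1 ∨ e = -1) :
    ∀ᶠ η : ℝ in 𝓝[>] 0, graphPt ψ t + (e * η : ℝ) * Complex.I ∈ graphSide ψ a e := by
  have h1 := abs_im_graphPt_lt hψ0 hψ ht
  have h2 : ∀ᶠ z in 𝓝 (graphPt ψ t), |z.im| < a := by
    have hc : Continuous fun z : ℂ => |z.im| := by fun_prop
    exact hc.continuousAt.eventually (gt_mem_nhds (by simpa [graphPt] using h1))
  filter_upwards [(tendsto_graphPt_add t e).eventually h2, self_mem_nhdsWithin] with η hη hη0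
  refine ⟨by simpa [graphPt] using ht, hη, ?_⟩
  have h3 : e * e = 1 := by rcases he with rfl | rfl <;> norm_num
  have h4 : (graphPt ψ t + (e * η : ℝ) * Complex.I).re = t := by simp [graphPt]
  have h5 : (graphPt ψ t + (e * η : ℝ) * Complex.I).im = ψ t + e * η := by
    simp [graphPt, -Complex.ofReal_mul]
  rw [h4, h5, add_sub_cancel_left, ← mul_assoc, h3, one_mul]
  exact hη0

theorem mem_graphSide_or {s : ℂ} (h1 : |s.re| < a) (h2 : |s.im| < a) :
    s ∈ graphSide ψ a 1 ∨ s ∈ graphSide ψ a (-1) ∨ s = graphPt ψ s.re := by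
  rcases lt_trichotomy (s.im) (ψ s.re) with h | h | h
  · exact Or.inr (Or.inl ⟨h1, h2, by linarith⟩)
  · refine Or.inr (Or.inr ?_)
    apply Complex.ext <;> simp [graphPt, h]
  · exact Or.inl ⟨h1, h2, by linarith⟩

namespace LevelChart

variable {X V : Set (Fin 2 → ℂ)} [CompactSpace X] {x₀ : Fin 2 → ℂ} (c : LevelChart X V x₀)

theorem mem_of_mem {x : Fin 2 → ℂ} (hx : x ∈ X) (h1 : ‖c.ω * (x c.i - x₀ c.i)‖ < c.δ)
    (h2 : ‖x c.j - x₀ c.j‖ ≤ c.r) : c.σ (c.ω * (x c.i - x₀ c.i)) = x :=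
  (c.σ_unique x (c.hull_sub x (subset_polyHull hx) h1 h2) h1 h2).symm

theorem im_eq_of_mem {s : ℂ} (hs : s ∈ ball (0 : ℂ) c.δ) (h : c.σ s ∈ X) : s.im = c.ψ s.re := by
  have h1 := c.graph _ h
  rw [c.σ_param s hs] at h1
  exact h1 (by simpa using hs) (c.σ_near s hs)

theorem continuousAt_σ {s : ℂ} (hs : s ∈ ball (0 : ℂ) c.δ) : ContinuousAt c.σ s :=
  (c.σ_diff.differentiableAt (isOpen_ball.mem_nhds hs)).continuousAt

/-- Near a point of `X`, either a full neighbourhood in the curve lies in the hull, or the hull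
coincides with `X`, or `X` is locally a graph and the hull is exactly one side of it. -/
theorem trichotomy : ∃ a > 0, (∀ s : ℂ, |s.re| < a → |s.im| < a → s ∈ ball (0 : ℂ) c.δ) ∧
    ((∀ s : ℂ, |s.re| < a → |s.im| < a → c.σ s ∈ polyHull 2 X) ∨
      (∀ s : ℂ, |s.re| < a → |s.im| < a → c.σ s ∈ polyHull 2 X → c.σ s ∈ X) ∨
      ((∀ t : ℝ, |t| < a → c.σ (graphPt c.ψ t) ∈ X) ∧ ∃ e : ℝ, (e = 1 ∨ e = -1) ∧
        (∀ s ∈ graphSide c.ψ a e, c.σ s ∈ polyHull 2 X) ∧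
        ∀ s ∈ graphSide c.ψ a (-e), c.σ s ∉ polyHull 2 X)) := by
  obtain ⟨ε, hε, hεδ, T, hTc, hT, hcl⟩ := c.exists_clopen
  have hTX : ∀ s ∈ T, c.σ s ∈ X ∧ s = graphPt c.ψ s.re := by
    intro s hs
    obtain ⟨x, hx, h1, h2, h3⟩ := hT s hs
    have h4 := c.mem_of_mem hx h1 h2.le
    rw [h3] at h4 h1
    refine ⟨h4 ▸ hx, ?_⟩
    have h5 := c.im_eq_of_mem (s := s) (by simpa using h1) (h4 ▸ hx)
    apply Complex.ext <;> simp [graphPt, h5]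
  set a := ε / 2 with ha
  have ha0 : 0 < a := by positivity
  have hbox : ∀ s : ℂ, |s.re| < a → |s.im| < a → s ∈ ball (0 : ℂ) ε := by
    intro s h1 h2
    rw [mem_ball, dist_zero_right]
    refine (Complex.norm_le_abs_re_add_abs_im s).trans_lt ?_
    linarith
  have hside : ∀ e : ℝ, (e = 1 ∨ e = -1) → (∀ s ∈ graphSide c.ψ a e, c.σ s ∈ polyHull 2 X) ∨
      (∀ s ∈ graphSide c.ψ a e, c.σ s ∉ polyHull 2 X) := by
    intro e he
    refine hcl _ (fun s hs => hbox s hs.1 hs.2.1) ?_ (isPreconnected_graphSide c.ψ_zero c.ψ_lip he)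
    rw [Set.disjoint_left]
    intro s hs hsT
    have h1 := congrArg Complex.im (hTX s hsT).2
    have h2 := hs.2.2
    have h3 : s.im = c.ψ s.re := by simpa [graphPt] using h1
    rw [h3] at h2
    simp at h2
  have hgb : ∀ t, |t| < a → graphPt c.ψ t ∈ ball (0 : ℂ) ε := by
    intro t ht
    refine hbox _ (by simpa [graphPt] using ht) ?_
    simpa [graphPt] using abs_im_graphPt_lt c.ψ_zero c.ψ_lip ht
  have hlink : ∀ t, |t| < a → graphPt c.ψ t ∉ T →
      ((∀ᶠ η : ℝ in 𝓝[>] 0, ∀ e ∈ ({1, -1} : Set ℝ),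
        c.σ (graphPt c.ψ t + (e * η : ℝ) * Complex.I) ∈ polyHull 2 X) ∧
          c.σ (graphPt c.ψ t) ∈ polyHull 2 X) ∨
      ((∀ᶠ η : ℝ in 𝓝[>] 0, ∀ e ∈ ({1, -1} : Set ℝ),
        c.σ (graphPt c.ψ t + (e * η : ℝ) * Complex.I) ∉ polyHull 2 X) ∧
          c.σ (graphPt c.ψ t) ∉ polyHull 2 X) := by
    intro t ht htT
    obtain ⟨ρ, hρ, hρs⟩ := Metric.isOpen_iff.1 (isOpen_ball.inter hTc.isClosed.isOpen_compl)
      (graphPt c.ψ t) (⟨hgb t ht, htT⟩ : graphPt c.ψ t ∈ ball (0 : ℂ) ε ∩ Tᶜ)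
    have hnear : ∀ᶠ η : ℝ in 𝓝[>] 0, ∀ e ∈ ({1, -1} : Set ℝ),
        graphPt c.ψ t + (e * η : ℝ) * Complex.I ∈ ball (graphPt c.ψ t) ρ := by
      simp only [Set.mem_insert_iff, Set.mem_singleton_iff, forall_eq_or_imp, forall_eq]
      exact ((tendsto_graphPt_add t 1).eventually (ball_mem_nhds _ hρ)).and
        ((tendsto_graphPt_add t (-1)).eventually (ball_mem_nhds _ hρ))
    refine (hcl (ball (graphPt c.ψ t) ρ) (fun s hs => (hρs hs).1)
      (Set.disjoint_left.2 fun s hs => (hρs hs).2) (convex_ball _ _).isPreconnected).imp ?_ ?_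
    · exact fun h => ⟨hnear.mono fun η hη e he => h _ (hη e he), h _ (mem_ball_self hρ)⟩
    · exact fun h => ⟨hnear.mono fun η hη e he => h _ (hη e he), h _ (mem_ball_self hρ)⟩
  have hsub : ball (0 : ℂ) ε ⊆ ball 0 c.δ := ball_subset_ball hεδ
  have hmixed : ∀ e : ℝ, (e = 1 ∨ e = -1) → (∀ s ∈ graphSide c.ψ a e, c.σ s ∈ polyHull 2 X) →
      (∀ s ∈ graphSide c.ψ a (-e), c.σ s ∉ polyHull 2 X) →
      ∀ t : ℝ, |t| < a → c.σ (graphPt c.ψ t) ∈ X := by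
    intro e he hin hout t ht
    by_contra hX
    have htT : graphPt c.ψ t ∉ T := fun h => hX (hTX _ h).1
    have he' : -e = 1 ∨ -e = -1 := by rcases he with rfl | rfl <;> simp
    have m1 := eventually_mem_graphSide c.ψ_zero c.ψ_lip ht he
    have m2 := eventually_mem_graphSide c.ψ_zero c.ψ_lip ht he'
    rcases hlink t ht htT with ⟨h, -⟩ | ⟨h, -⟩
    · obtain ⟨η, h1, h2⟩ := (h.and m2).exists
      exact hout _ h2 (h1 _ (by simpa using he'))
    · obtain ⟨η, h1, h2⟩ := (h.and m1).exists
      exact h1 _ (by simpa using he) (hin _ h2)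
  refine ⟨a, ha0, fun s h1 h2 => hsub (hbox s h1 h2), ?_⟩
  rcases hside 1 (Or.inl rfl) with hp | hp <;> rcases hside (-1) (Or.inr rfl) with hm | hm
  · refine Or.inl fun s h1 h2 => ?_
    rcases mem_graphSide_or (ψ := c.ψ) h1 h2 with h | h | h
    · exact hp s h
    · exact hm s h
    · have m1 := eventually_mem_graphSide c.ψ_zero c.ψ_lip h1 (Or.inl rfl)
      have hc := (c.continuousAt_σ (hsub (hgb _ h1))).tendsto.comp (tendsto_graphPt_add s.re 1)
      rw [h]
      exact (isClosed_polyHull X).mem_of_tendsto hc (m1.mono fun η hη => hp _ hη)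
  · exact Or.inr (Or.inr ⟨hmixed 1 (Or.inl rfl) hp hm, 1, Or.inl rfl, hp, hm⟩)
  · refine Or.inr (Or.inr ⟨hmixed (-1) (Or.inr rfl) hm (by simpa using hp), -1, Or.inr rfl, hm, ?_⟩)
    simpa using hp
  · refine Or.inr (Or.inl fun s h1 h2 hs => ?_)
    rcases mem_graphSide_or (ψ := c.ψ) h1 h2 with h | h | h
    · exact absurd hs (hp s h)
    · exact absurd hs (hm s h)
    · by_contra hX
      rw [h] at hs hX
      have htT : graphPt c.ψ s.re ∉ T := fun h => hX (hTX _ h).1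
      have m1 := eventually_mem_graphSide c.ψ_zero c.ψ_lip h1 (Or.inl rfl)
      rcases hlink _ h1 htT with ⟨h', -⟩ | ⟨-, h'⟩
      · obtain ⟨η, h3, h4⟩ := (h'.and m1).exists
        exact hp _ h4 (h3 1 (by simp))
      · exact h' hs

end LevelChart

end LevelTrichotomy

section LevelConsequences

open Filter

namespace LevelChart

variable {X V : Set (Fin 2 → ℂ)} [CompactSpace X] {x₀ : Fin 2 → ℂ}

theorem tendsto_σ (c : LevelChart X V x₀) : Tendsto c.σ (𝓝 0) (𝓝 x₀) := by
  have := (c.continuousAt_σ (mem_ball_self c.δ_pos)).tendsto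
  rwa [c.σ_zero] at this

theorem eventually_param (c : LevelChart X V x₀) {a : ℝ} (ha : 0 < a) : ∀ᶠ z in 𝓝 x₀, ‖c.ω * (z c.i - x₀ c.i)‖ < c.δ ∧
    ‖z c.j - x₀ c.j‖ ≤ c.r ∧ |(c.ω * (z c.i - x₀ c.i)).re| < a ∧
    |(c.ω * (z c.i - x₀ c.i)).im| < a := by
  have h1 : Continuous fun z : Fin 2 → ℂ => c.ω * (z c.i - x₀ c.i) := by fun_prop
  have h2 : Continuous fun z : Fin 2 → ℂ => z c.j - x₀ c.j := by fun_prop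
  have h3 := h1.tendsto x₀
  have h4 := h2.tendsto x₀
  simp only [sub_self, mul_zero] at h3 h4
  refine (h3.norm.eventually (gt_mem_nhds (by simpa using c.δ_pos))).and
    (((h4.norm.eventually (gt_mem_nhds (by simpa using c.r_pos))).mono fun _ h => h.le).and
    (((Complex.continuous_re.abs.continuousAt.tendsto.comp h3).eventually
      (gt_mem_nhds (by simpa using ha))).and
    ((Complex.continuous_im.abs.continuousAt.tendsto.comp h3).eventually
      (gt_mem_nhds (by simpa using ha)))))

/-- Near a point of `X`, either the hull fills the curve, or it coincides with `X`, or `X` is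
locally a graph along which neither happens. -/
theorem full_or_empty_or_half (c : LevelChart X V x₀) :
    (∀ᶠ z in 𝓝 x₀, z ∈ V → z ∈ polyHull 2 X) ∨ (∀ᶠ z in 𝓝 x₀, z ∈ polyHull 2 X → z ∈ X) ∨
    ∃ a > 0, a ≤ c.δ ∧ ∀ t : ℝ, |t| < a → c.σ (graphPt c.ψ t) ∈ X ∧
      (¬ ∀ᶠ z in 𝓝 (c.σ (graphPt c.ψ t)), z ∈ V → z ∈ polyHull 2 X) ∧
      ¬ ∀ᶠ z in 𝓝 (c.σ (graphPt c.ψ t)), z ∈ polyHull 2 X → z ∈ X := by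
  obtain ⟨a, ha, hbox, h⟩ := c.trichotomy
  rcases h with h | h | ⟨h, e, he, hin, hout⟩
  · left
    filter_upwards [c.eventually_param ha] with z hz hzV
    rw [c.σ_unique z hzV hz.1 hz.2.1]
    exact h _ hz.2.2.1 hz.2.2.2
  · right; left
    filter_upwards [c.eventually_param ha] with z hz hzL
    have h1 := c.σ_unique z (c.hull_sub z hzL hz.1 hz.2.1) hz.1 hz.2.1
    have h2 := h _ hz.2.2.1 hz.2.2.2
    rw [← h1] at h2
    exact h2 hzL
  · right; right
    have hb : ∀ t : ℝ, |t| < a → graphPt c.ψ t ∈ ball (0 : ℂ) c.δ := by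
      intro t ht
      refine hbox _ (by simpa [graphPt] using ht) ?_
      simpa [graphPt] using abs_im_graphPt_lt c.ψ_zero c.ψ_lip ht
    have he' : -e = 1 ∨ -e = -1 := by rcases he with rfl | rfl <;> simp
    refine ⟨min a c.δ, lt_min ha c.δ_pos, min_le_right _ _, fun t ht => ?_⟩
    have hta := ht.trans_le (min_le_left _ _)
    have hlim : ∀ e' : ℝ, Tendsto (fun η : ℝ => c.σ (graphPt c.ψ t + (e' * η : ℝ) * Complex.I))
        (𝓝[>] 0) (𝓝 (c.σ (graphPt c.ψ t))) := fun e' =>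
      (c.continuousAt_σ (hb t hta)).tendsto.comp (tendsto_graphPt_add t e')
    refine ⟨h t hta, fun hF => ?_, fun hE => ?_⟩
    · have m := eventually_mem_graphSide c.ψ_zero c.ψ_lip hta he'
      obtain ⟨η, h1, h2⟩ := (((hlim (-e)).eventually hF).and m).exists
      exact hout _ h2 (h1 (c.σ_mem _ (hbox _ h2.1 h2.2.1)))
    · have m := eventually_mem_graphSide c.ψ_zero c.ψ_lip hta he
      obtain ⟨η, h1, h2⟩ := (((hlim e).eventually hE).and m).exists
      have h3 := c.im_eq_of_mem (hbox _ h2.1 h2.2.1) (h1 (hin _ h2))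
      have h4 := h2.2.2
      rw [h3] at h4
      simp at h4

theorem notMem_essSet (c : LevelChart X V x₀) (h : ∀ᶠ z in 𝓝 x₀, z ∈ polyHull 2 X → z ∈ X) (hx : x₀ ∈ X) :
    (⟨x₀, hx⟩ : X) ∉ essSet (polyAlg X) := by
  obtain ⟨ρ, hρ, hρs⟩ := Metric.eventually_nhds_iff_ball.1 (c.tendsto_σ.eventually h)
  refine notMem_essSet_of_sheet (polyAlg X) (isClosed_polyAlg X) c.f c.q c.r_pos c.δ_pos
    (fun w hw => c.unimodular_sphere hw) (continuous_of_abs_sub_le c.ψ_lip)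
    (le_refl (1 / 24 : ℝ)) (by norm_num) c.ψ_lip c.ψ_zero (fun x h1 h2 => c.graph _ x.2 h2 h1)
    ?_ ?_ ?_ ?_
  · intro t ht u ε hε
    by_cases hc : ∃ x : X, ‖(c.q : C(X, ℂ)) x - x₀ c.j‖ < c.r ∧ ‖(c.f : C(X, ℂ)) x‖ < c.δ ∧
        ((c.f : C(X, ℂ)) x).re = t
    · obtain ⟨x, h1, h2, h3⟩ := hc
      refine ⟨algebraMap ℂ _ (u x), Subalgebra.algebraMap_mem _ _, fun y g1 g2 g3 => ?_⟩
      have hxy : x = y := by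
        apply Subtype.ext
        rw [← c.mem_of_mem x.2 h2 h1.le, ← c.mem_of_mem y.2 g2 g1.le]
        congr 1
        have hx := c.graph _ x.2 h2 h1
        have hy := c.graph _ y.2 g2 g1
        rw [f_apply] at h3 g3
        apply Complex.ext
        · rw [h3, g3]
        · rw [hx, hy, h3, g3]
      subst hxy
      simpa using hε
    · push Not at hc
      exact ⟨0, zero_mem _, fun x h1 h2 h3 => absurd h3 (hc x h1 h2)⟩
  · intro δ hδ hδle β hβ _
    refine ⟨min δ ρ, lt_min hδ hρ, min_le_left _ _, fun ν _ Λ _ hb s hs hsψ => ?_⟩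
    have hsδ := ball_subset_ball (min_le_left _ _) hs
    have hsc := ball_subset_ball hδle hsδ
    refine hb s hsδ ?_ fun w hw => c.unimodular hsc hw fun hL => ?_
    · exact notMem_image_of_im_ne
        (fun x hx => c.graph _ x.2 (hβ x hx).2 (hβ x hx).1) hsψ
    · exact absurd (c.im_eq_of_mem hsc (hρs s (ball_subset_ball (min_le_right _ _) hs) hL)) hsψ
  · rw [f_apply]
    simp
  · rw [q_apply]
    simpa using c.r_pos

theorem not_full (c : LevelChart X V x₀) (h : ∀ᶠ z in 𝓝 x₀, z ∈ V → z ∈ polyHull 2 X)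
    (hE : ∀ x ∈ essSet (polyAlg X), ∑ i, ‖x.1 i‖ ^ 2 ≤ ∑ i, ‖x₀ i‖ ^ 2) : False := by
  set R := ∑ i, ‖x₀ i‖ ^ 2 with hR
  have hR0 : 0 ≤ R := by positivity
  obtain ⟨ρ', hρ', hρs'⟩ := Metric.eventually_nhds_iff_ball.1 (c.tendsto_σ.eventually h)
  set ρ := min ρ' c.δ with hρ
  have hρ0 : 0 < ρ := lt_min hρ' c.δ_pos
  have hsub : ball (0 : ℂ) ρ ⊆ ball 0 c.δ := ball_subset_ball (min_le_right _ _)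
  have hL : ∀ s ∈ ball (0 : ℂ) ρ, c.σ s ∈ polyHull 2 X := fun s hs =>
    hρs' s (ball_subset_ball (min_le_left _ _) hs) (c.σ_mem s (hsub hs))
  have hoff : ∀ s ∈ ball (0 : ℂ) ρ, s.im ≠ c.ψ s.re → ∑ i, ‖c.σ s i‖ ^ 2 ≤ R := fun s hs hne =>
    sum_norm_sq_le_of_essSet (hL s hs) (fun hX => hne (c.im_eq_of_mem (hsub hs) hX)) hR0 hE
  have hall : ∀ s ∈ ball (0 : ℂ) ρ, ∑ i, ‖c.σ s i‖ ^ 2 ≤ R := by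
    intro s hs
    by_cases hne : s.im = c.ψ s.re
    · have hsg : s = graphPt c.ψ s.re := by
        apply Complex.ext <;> simp [graphPt, hne]
      have hlim := tendsto_graphPt_add (ψ := c.ψ) s.re 1
      rw [← hsg] at hlim
      have hcont : ContinuousAt (fun s => ∑ i, ‖c.σ s i‖ ^ 2) s := by
        have h1 : Continuous fun z : Fin 2 → ℂ => ∑ i, ‖z i‖ ^ 2 := by
          simp only [Fin.sum_univ_two]
          fun_prop
        exact h1.continuousAt.comp (c.continuousAt_σ (hsub hs))
      refine le_of_tendsto (hcont.tendsto.comp hlim) ?_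
      filter_upwards [hlim.eventually (isOpen_ball.mem_nhds hs), self_mem_nhdsWithin] with η h1 h2
      refine hoff _ h1 ?_
      have h3 : (0 : ℝ) < η := h2
      simp [hne, h3.ne']
    · exact hoff s hs hne
  set g : ℂ → ℂ := fun s => ∑ i, (starRingEnd ℂ) (x₀ i) * c.σ s i with hg
  have hg0 : g 0 = (R : ℂ) := by
    simp only [hg, c.σ_zero, hR]
    rw [Complex.ofReal_sum]
    refine Finset.sum_congr rfl fun i _ => ?_
    rw [mul_comm, Complex.mul_conj, Complex.normSq_eq_norm_sq]
  have hgle : ∀ s ∈ ball (0 : ℂ) ρ, ‖g s‖ ≤ R := by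
    intro s hs
    refine (norm_sum_le _ _).trans ?_
    simp only [norm_mul, RCLike.norm_conj]
    refine (Real.sum_mul_le_sqrt_mul_sqrt _ _ _).trans ?_
    rw [← hR]
    calc √R * √(∑ i, ‖c.σ s i‖ ^ 2) ≤ √R * √R :=
          mul_le_mul_of_nonneg_left (Real.sqrt_le_sqrt (hall s hs)) (Real.sqrt_nonneg _)
      _ = R := Real.mul_self_sqrt hR0
  have hgd : ∀ᶠ s in 𝓝 (0 : ℂ), DifferentiableAt ℂ g s := by
    filter_upwards [isOpen_ball.mem_nhds (mem_ball_self c.δ_pos)] with s hs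
    have h1 := c.σ_diff.differentiableAt (isOpen_ball.mem_nhds hs)
    have h2 := differentiableAt_pi.1 h1
    exact DifferentiableAt.fun_sum fun i _ => (h2 i).const_mul _
  have hmax : IsLocalMax (norm ∘ g) 0 := by
    filter_upwards [ball_mem_nhds (0 : ℂ) hρ0] with s hs
    simp only [Function.comp_apply, hg0]
    rw [Complex.norm_real, Real.norm_of_nonneg hR0]
    exact hgle s hs
  have hconst := Complex.eventually_eq_of_isLocalMax_norm hgd hmax
  have hfin : ∀ᶠ s in 𝓝 (0 : ℂ), s = 0 := by
    filter_upwards [hconst, ball_mem_nhds (0 : ℂ) hρ0] with s hs hsρ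
    have h1 : ∑ i, ‖c.σ s i - x₀ i‖ ^ 2 =
        ∑ i, ‖c.σ s i‖ ^ 2 - 2 * (g s).re + ∑ i, ‖x₀ i‖ ^ 2 := by
      simp only [hg, Complex.re_sum, Finset.mul_sum]
      rw [← Finset.sum_sub_distrib, ← Finset.sum_add_distrib]
      refine Finset.sum_congr rfl fun i _ => ?_
      simp only [← Complex.normSq_eq_norm_sq, Complex.normSq_apply, Complex.sub_re, Complex.sub_im,
        Complex.mul_re, Complex.conj_re, Complex.conj_im]
      ring
    have h2 := hall s hsρ
    rw [hs, hg0, Complex.ofReal_re, ← hR] at h1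
    have h3 : ∑ i, ‖c.σ s i - x₀ i‖ ^ 2 ≤ 0 := by rw [h1]; linarith
    have h4 : ‖c.σ s c.i - x₀ c.i‖ ^ 2 ≤ ∑ i, ‖c.σ s i - x₀ i‖ ^ 2 :=
      Finset.single_le_sum (f := fun i => ‖c.σ s i - x₀ i‖ ^ 2) (fun i _ => by positivity)
        (Finset.mem_univ c.i)
    have h5 : ‖c.σ s c.i - x₀ c.i‖ = 0 := by
      have := norm_nonneg (c.σ s c.i - x₀ c.i)
      nlinarith
    have h6 := c.σ_param s (hsub hsρ)
    rw [norm_eq_zero.1 h5, mul_zero] at h6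
    exact h6.symm
  obtain ⟨t, ht, hts⟩ := Metric.eventually_nhds_iff_ball.1 hfin
  have := hts ((t / 2 : ℝ) : ℂ) (by
    rw [mem_ball, dist_zero_right, Complex.norm_real, Real.norm_of_nonneg (by positivity)]
    linarith)
  rw [Complex.ofReal_eq_zero] at this
  linarith

end LevelChart

end LevelConsequences

section DiscLevels

open Filter

/-- A totally real disc, parametrized by `φ`, inside the set `‖h‖ = 1` of a Runge domain. -/
structure DiscSetup (Ω : Set (Fin 2 → ℂ)) (h : (Fin 2 → ℂ) → ℂ) (U : Set (ℝ × ℝ))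
    (φ : ℝ × ℝ → (Fin 2 → ℂ)) : Prop where
  runge : RungeDomain 2 Ω
  hol : DifferentiableOn ℂ h Ω
  noncrit : ∀ z ∈ Ω, ‖h z‖ = 1 → fderiv ℂ h z ≠ 0
  isOpen_U : IsOpen U
  disc_sub : closedBall (0 : ℝ × ℝ) 1 ⊆ U
  smooth : ContDiffOn ℝ 2 φ U
  inj : Set.InjOn φ U
  imm : ∀ x ∈ U, Function.Injective (fderiv ℝ φ x)
  real : ∀ x ∈ U, ∀ v w : ℝ × ℝ,
    fderiv ℝ φ x v = Complex.I • fderiv ℝ φ x w → fderiv ℝ φ x v = 0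
  maps : ∀ p ∈ closedBall (0 : ℝ × ℝ) 1, φ p ∈ Ω
  norm_eq : ∀ p ∈ closedBall (0 : ℝ × ℝ) 1, ‖h (φ p)‖ = 1

/-- The part of the disc on which `h` equals `l`. -/
def discLevel (h : (Fin 2 → ℂ) → ℂ) (φ : ℝ × ℝ → (Fin 2 → ℂ)) (l : ℂ) : Set (Fin 2 → ℂ) :=
  φ '' {p ∈ closedBall (0 : ℝ × ℝ) 1 | h (φ p) = l}

namespace DiscSetup

variable {Ω : Set (Fin 2 → ℂ)} {h : (Fin 2 → ℂ) → ℂ} {U : Set (ℝ × ℝ)}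
  {φ : ℝ × ℝ → (Fin 2 → ℂ)}

theorem contDiffAt_φ (S : DiscSetup Ω h U φ) {p : ℝ × ℝ} (hp : p ∈ U) : ContDiffAt ℝ 1 φ p :=
  (S.smooth.contDiffAt (S.isOpen_U.mem_nhds hp)).of_le (by norm_num)

theorem continuousOn_φ (S : DiscSetup Ω h U φ) : ContinuousOn φ U := S.smooth.continuousOn

theorem contDiffAt_h (S : DiscSetup Ω h U φ) {z : Fin 2 → ℂ} (hz : z ∈ Ω) : ContDiffAt ℂ 1 h z :=
  (contDiffOn_one_of_differentiableOn S.runge.1 S.hol).contDiffAt (S.runge.1.mem_nhds hz)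

theorem contDiffAt_comp (S : DiscSetup Ω h U φ) {p : ℝ × ℝ} (hp : p ∈ closedBall (0 : ℝ × ℝ) 1) :
    ContDiffAt ℝ 1 (fun p => h (φ p)) p :=
  ((S.contDiffAt_h (S.maps p hp)).restrict_scalars ℝ).comp p (S.contDiffAt_φ (S.disc_sub hp))

theorem hasFDerivAt_comp (S : DiscSetup Ω h U φ) {p : ℝ × ℝ} (hp : p ∈ closedBall (0 : ℝ × ℝ) 1) :
    HasFDerivAt (fun p => h (φ p))
      (((fderiv ℂ h (φ p)).restrictScalars ℝ).comp (fderiv ℝ φ p)) p :=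
  (((S.contDiffAt_h (S.maps p hp)).differentiableAt one_ne_zero).hasFDerivAt.restrictScalars
    ℝ).comp p ((S.contDiffAt_φ (S.disc_sub hp)).differentiableAt one_ne_zero).hasFDerivAt

theorem fderiv_comp_apply (S : DiscSetup Ω h U φ) {p : ℝ × ℝ}
    (hp : p ∈ closedBall (0 : ℝ × ℝ) 1) (v : ℝ × ℝ) :
    fderiv ℝ (fun p => h (φ p)) p v = fderiv ℂ h (φ p) (fderiv ℝ φ p v) := by
  rw [(S.hasFDerivAt_comp hp).fderiv]
  rfl

theorem fderiv_comp_ne_zero (S : DiscSetup Ω h U φ) {p : ℝ × ℝ}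
    (hp : p ∈ closedBall (0 : ℝ × ℝ) 1) : fderiv ℝ (fun p => h (φ p)) p ≠ 0 := by
  intro h0
  have hk : ∀ v, fderiv ℂ h (φ p) (fderiv ℝ φ p v) = 0 := fun v => by
    rw [← S.fderiv_comp_apply hp, h0]; rfl
  obtain ⟨i, j, hij, hj⟩ := exists_apply_single_ne (S.noncrit _ (S.maps p hp) (S.norm_eq p hp))
  have hall : ∀ k, k = i ∨ k = j := by clear hj; revert i j; decide
  set l := fderiv ℂ h (φ p)
  have hker : ∀ w : Fin 2 → ℂ, l w = 0 → w i = 0 → w = 0 := by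
    intro w hw hwi
    have hw' : w = w j • Pi.single j 1 := by
      ext k
      rcases hall k with rfl | rfl
      · simp [hwi, hij]
      · simp
    rw [hw', map_smul, smul_eq_zero, or_iff_left hj] at hw
    rw [hw', hw, zero_smul]
  set D := fderiv ℝ φ p
  have hinj : ∀ v, D v = 0 → v = 0 := fun v hv => S.imm p (S.disc_sub hp) (by rw [hv, map_zero])
  have h1 : D (1, 0) i ≠ 0 := by
    intro hc
    have := hinj _ (hker _ (hk _) hc)
    simp at this
  set c := D (0, 1) i / D (1, 0) i with hc
  have h2 : D (0, 1) = c • D (1, 0) := by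
    rw [← sub_eq_zero]
    refine hker _ ?_ ?_
    · rw [map_sub, map_smul, hk, hk, smul_zero, sub_zero]
    · simp [hc, h1]
  have h3 : D ((0, 1) - c.re • (1, 0)) = Complex.I • D (c.im • (1, 0)) := by
    rw [map_sub, h2, map_smul, map_smul]
    ext k
    simp only [Pi.sub_apply, Pi.smul_apply, smul_eq_mul, Complex.real_smul]
    nth_rewrite 1 [← Complex.re_add_im c]
    ring
  have h4 := hinj _ (S.real p (S.disc_sub hp) _ _ h3)
  have h5 := congrArg Prod.snd h4
  simp at h5

theorem re_conj_mul_fderiv (S : DiscSetup Ω h U φ) {p : ℝ × ℝ}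
    (hp : p ∈ closedBall (0 : ℝ × ℝ) 1) (v : ℝ × ℝ) :
    ((starRingEnd ℂ) (h (φ p)) * fderiv ℝ (fun p => h (φ p)) p v).re = 0 := by
  have hd := ((S.contDiffAt_comp hp).differentiableAt one_ne_zero).hasFDerivAt
  set u : ℝ × ℝ → ℂ := fun p => h (φ p) with hu
  have h1 : HasFDerivAt (fun p => ‖u p‖ ^ 2) (2 • (innerSL ℝ (u p)).comp (fderiv ℝ u p)) p :=
    hd.norm_sq
  have h2 : HasFDerivWithinAt (fun p => ‖u p‖ ^ 2) (0 : ℝ × ℝ →L[ℝ] ℝ) (closedBall 0 1) p := by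
    refine (hasFDerivWithinAt_const (1 : ℝ) p _).congr (fun y hy => ?_) ?_
    · simp [hu, S.norm_eq y hy]
    · simp [hu, S.norm_eq p hp]
  have hud : UniqueDiffWithinAt ℝ (closedBall (0 : ℝ × ℝ) 1) p := by
    refine uniqueDiffOn_convex (convex_closedBall _ _) ?_ p hp
    rw [interior_closedBall _ one_ne_zero]
    exact ⟨0, mem_ball_self one_pos⟩
  have h3 := hud.eq h1.hasFDerivWithinAt h2
  have h4 := congrArg (fun l : ℝ × ℝ →L[ℝ] ℝ => l v) h3
  simp only [smul_apply, ContinuousLinearMap.comp_apply, innerSL_apply_apply,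
    zero_apply, smul_eq_zero, OfNat.ofNat_ne_zero, false_or] at h4
  rw [Complex.inner, mul_comm] at h4
  exact h4

/-- The defining function of the level sets of `h ∘ φ`. -/
theorem im_conj_fderiv (S : DiscSetup Ω h U φ) {p : ℝ × ℝ} (hp : p ∈ closedBall (0 : ℝ × ℝ) 1)
    {l : ℂ} (v : ℝ × ℝ) :
    fderiv ℝ (fun p => ((starRingEnd ℂ) l * h (φ p)).im) p v =
      ((starRingEnd ℂ) l * fderiv ℝ (fun p => h (φ p)) p v).im := by
  have hd := ((S.contDiffAt_comp hp).differentiableAt one_ne_zero).hasFDerivAt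
  have h1 := Complex.imCLM.hasFDerivAt.comp p (hd.const_mul ((starRingEnd ℂ) l))
  have h2 : fderiv ℝ (fun p => ((starRingEnd ℂ) l * h (φ p)).im) p = _ := h1.fderiv
  rw [h2]
  rfl

theorem fderiv_comp_eq_zero_of_im (S : DiscSetup Ω h U φ) {p : ℝ × ℝ}
    (hp : p ∈ closedBall (0 : ℝ × ℝ) 1) {v : ℝ × ℝ}
    (hv : ((starRingEnd ℂ) (h (φ p)) * fderiv ℝ (fun p => h (φ p)) p v).im = 0) :
    fderiv ℝ (fun p => h (φ p)) p v = 0 := by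
  have h1 : (starRingEnd ℂ) (h (φ p)) * fderiv ℝ (fun p => h (φ p)) p v = 0 :=
    Complex.ext (S.re_conj_mul_fderiv hp v) hv
  refine (mul_eq_zero.1 h1).resolve_left (norm_ne_zero_iff.1 ?_)
  rw [RCLike.norm_conj, S.norm_eq p hp]
  exact one_ne_zero

theorem isCompact_level (S : DiscSetup Ω h U φ) (l : ℂ) :
    IsCompact {p ∈ closedBall (0 : ℝ × ℝ) 1 | h (φ p) = l} := by
  have hc : ContinuousOn (fun p => h (φ p)) (closedBall (0 : ℝ × ℝ) 1) := fun p hp =>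
    (S.contDiffAt_comp hp).continuousAt.continuousWithinAt
  refine (isCompact_closedBall _ _).of_isClosed_subset ?_ (Set.sep_subset _ _)
  exact hc.preimage_isClosed_of_isClosed isClosed_closedBall isClosed_singleton

theorem isCompact_discLevel (S : DiscSetup Ω h U φ) (l : ℂ) : IsCompact (discLevel h φ l) :=
  (S.isCompact_level l).image_of_continuousOn
    (S.continuousOn_φ.mono ((Set.sep_subset _ _).trans S.disc_sub))

theorem eq_of_mem_polyHull (S : DiscSetup Ω h U φ) {l : ℂ} {y : Fin 2 → ℂ}
    (hy : y ∈ polyHull 2 (discLevel h φ l)) (hyΩ : y ∈ Ω) : h y = l := by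
  have hX := S.isCompact_discLevel l
  have : CompactSpace (discLevel h φ l) := isCompact_iff_compactSpace.1 hX
  have hXΩ : insert y (discLevel h φ l) ⊆ Ω := by
    refine Set.insert_subset hyΩ ?_
    rintro _ ⟨p, hp, rfl⟩
    exact S.maps p hp.1
  rw [← sub_eq_zero, ← norm_le_zero_iff]
  refine le_of_forall_pos_le_add fun ε hε => ?_
  obtain ⟨P, hP⟩ := S.runge.2.2 h S.hol _ hXΩ (hX.insert y) (ε / 2) (by positivity)
  have h1 := norm_eval_le_of_mem_polyHull hy (P - MvPolynomial.C l)
  have h2 : ‖polyMap (discLevel h φ l) (P - MvPolynomial.C l)‖ ≤ ε / 2 := by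
    refine (ContinuousMap.norm_le _ (by positivity)).2 fun x => ?_
    rw [polyMap_apply, map_sub, MvPolynomial.eval_C]
    obtain ⟨p, hp, hpx⟩ := x.2
    have h3 : h x.1 = l := by rw [← hpx]; exact hp.2
    have h4 := hP _ (Set.mem_insert_of_mem _ x.2)
    rw [h3, norm_sub_rev] at h4
    exact h4
  have h4 := hP y (Set.mem_insert _ _)
  rw [map_sub, MvPolynomial.eval_C] at h1
  have h5 : h y - l = (h y - MvPolynomial.eval y P) + (MvPolynomial.eval y P - l) := by ring
  rw [h5]
  refine (norm_add_le _ _).trans ?_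
  linarith

theorem exists_norm_sub_lt (S : DiscSetup Ω h U φ) {p₀ : ℝ × ℝ}
    (hp₀ : p₀ ∈ closedBall (0 : ℝ × ℝ) 1) {N : Set (ℝ × ℝ)} (hN : N ∈ 𝓝 p₀) :
    ∃ ε > 0, ∀ p ∈ closedBall (0 : ℝ × ℝ) 1, ‖φ p - φ p₀‖ ≤ ε → p ∈ N := by
  have hc : IsCompact (closedBall (0 : ℝ × ℝ) 1 \ interior N) :=
    (isCompact_closedBall _ _).diff isOpen_interior
  have hi := hc.image_of_continuousOn
    (S.continuousOn_φ.mono (Set.sdiff_subset.trans S.disc_sub))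
  have hn : φ p₀ ∉ φ '' (closedBall (0 : ℝ × ℝ) 1 \ interior N) := by
    rintro ⟨p, hp, he⟩
    have := S.inj (S.disc_sub hp.1) (S.disc_sub hp₀) he
    exact hp.2 (this ▸ mem_interior_iff_mem_nhds.2 hN)
  obtain ⟨ε, hε, hs⟩ := Metric.nhds_basis_closedBall.mem_iff.1
    (hi.isClosed.isOpen_compl.mem_nhds hn)
  refine ⟨ε, hε, fun p hp hpε => ?_⟩
  by_contra hpN
  exact hs (by rwa [mem_closedBall, dist_eq_norm])
    ⟨p, ⟨hp, fun h => hpN (interior_subset h)⟩, rfl⟩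

theorem exists_levelChart (S : DiscSetup Ω h U φ) {p₀ : ℝ × ℝ}
    (hp₀ : p₀ ∈ closedBall (0 : ℝ × ℝ) 1) {l : ℂ} (hl : h (φ p₀) = l) :
    ∃ c : LevelChart (discLevel h φ l) {z ∈ Ω | h z = l} (φ p₀), ∀ a > 0, ∃ N ∈ 𝓝 p₀, ∀ p ∈ N,
      ((starRingEnd ℂ) l * h (φ p)).im = 0 → ∃ t : ℝ, |t| < a ∧
        (c.σ (graphPt c.ψ t) ∈ discLevel h φ l →
          (p ∈ closedBall (0 : ℝ × ℝ) 1 ∧ h (φ p) = l) ∧ φ p = c.σ (graphPt c.ψ t)) := by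
  have hp₀U := S.disc_sub hp₀
  have hcc : ∀ z : ℂ, ‖z‖ = 1 → (starRingEnd ℂ) z * z = 1 := fun z hz => by
    rw [mul_comm, Complex.mul_conj, Complex.normSq_eq_norm_sq, hz]
    simp
  set v : ℝ × ℝ → ℝ := fun p => ((starRingEnd ℂ) l * h (φ p)).im with hv
  have hvl : ∀ p ∈ closedBall (0 : ℝ × ℝ) 1, h (φ p) = l → v p = 0 := by
    intro p hp he
    have h1 := hcc _ (S.norm_eq p hp)
    rw [he] at h1
    simp only [hv, he, h1, Complex.one_im]
  have hvC : ContDiffAt ℝ 1 v p₀ :=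
    Complex.imCLM.contDiff.contDiffAt.comp p₀ (contDiffAt_const.mul (S.contDiffAt_comp hp₀))
  have hvker : ∀ w, fderiv ℝ v p₀ w = 0 → fderiv ℝ (fun p => h (φ p)) p₀ w = 0 := by
    intro w hw
    rw [hv, S.im_conj_fderiv hp₀, ← hl] at hw
    exact S.fderiv_comp_eq_zero_of_im hp₀ hw
  have hdv : fderiv ℝ v p₀ ≠ 0 := by
    intro h0
    refine S.fderiv_comp_ne_zero hp₀ (ContinuousLinearMap.ext fun w => hvker w ?_)
    rw [h0]; rfl
  set V₀ : ℝ × ℝ := (fderiv ℝ v p₀ (0, 1), - fderiv ℝ v p₀ (1, 0)) with hV₀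
  have hdecomp : ∀ w : ℝ × ℝ, fderiv ℝ v p₀ w =
      w.1 * fderiv ℝ v p₀ (1, 0) + w.2 * fderiv ℝ v p₀ (0, 1) := by
    intro w
    have : w = w.1 • (1, 0) + w.2 • (0, 1) := by ext <;> simp
    conv_lhs => rw [this]
    rw [map_add, map_smul, map_smul]; rfl
  have hvV : fderiv ℝ v p₀ V₀ = 0 := by rw [hdecomp]; simp only [hV₀]; ring
  have hV0 : V₀ ≠ 0 := by
    intro h0
    have h1 : fderiv ℝ v p₀ (0, 1) = 0 := congrArg Prod.fst h0
    have h2 : - fderiv ℝ v p₀ (1, 0) = 0 := congrArg Prod.snd h0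
    refine hdv (ContinuousLinearMap.ext fun w => ?_)
    rw [hdecomp, h1, neg_eq_zero.1 h2]
    simp
  have hnc := S.noncrit _ (S.maps p₀ hp₀) (S.norm_eq p₀ hp₀)
  obtain ⟨i, j, hij, hj⟩ := exists_apply_single_ne hnc
  have hall : ∀ k, k = i ∨ k = j := by clear hj; revert i j; decide
  have hDi : fderiv ℝ φ p₀ V₀ i ≠ 0 := by
    intro h0
    have h1 : fderiv ℂ h (φ p₀) (fderiv ℝ φ p₀ V₀) = 0 := by
      rw [← S.fderiv_comp_apply hp₀]; exact hvker _ hvV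
    have hw' : fderiv ℝ φ p₀ V₀ = fderiv ℝ φ p₀ V₀ j • Pi.single j 1 := by
      ext k
      rcases hall k with rfl | rfl
      · simp [h0, hij]
      · simp
    rw [hw', map_smul, smul_eq_zero, or_iff_left hj] at h1
    rw [h1, zero_smul] at hw'
    exact hV0 (S.imm p₀ hp₀U (by rw [hw', map_zero]))
  set ω := (fderiv ℝ φ p₀ V₀ i)⁻¹ with hω
  have hω0 : ω ≠ 0 := inv_ne_zero hDi
  set F : ℝ × ℝ → ℂ := fun p => ω * (φ p i - φ p₀ i) with hF
  have hφi : ContDiffAt ℝ 1 (fun p => φ p i) p₀ := contDiffAt_pi.1 (S.contDiffAt_φ hp₀U) i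
  have hFC : ContDiffAt ℝ 1 F p₀ := contDiffAt_const.mul (hφi.sub contDiffAt_const)
  have hFV : fderiv ℝ F p₀ V₀ = 1 := by
    have h1 : HasFDerivAt (fun p => φ p i)
        ((ContinuousLinearMap.proj (R := ℝ) (φ := fun _ : Fin 2 => ℂ) i).comp (fderiv ℝ φ p₀)) p₀ :=
      (ContinuousLinearMap.proj (R := ℝ) (φ := fun _ : Fin 2 => ℂ) i).hasFDerivAt.comp p₀
        ((S.contDiffAt_φ hp₀U).differentiableAt one_ne_zero).hasFDerivAt
    have h2 := (h1.sub_const (φ p₀ i)).const_mul ω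
    have h3 : fderiv ℝ F p₀ = _ := h2.fderiv
    rw [h3]
    simp [hω, hDi]
  obtain ⟨N, hN, η, hη, g, ψ, hψ0, hψ, hg0, hgc, hgη, hNg⟩ := exists_graph_chart hFC hvC
    (by simp [hF]) (hvl p₀ hp₀ hl) hFV hvV hdv (κ := 1 / 24) (by norm_num)
  obtain ⟨ε, hε, hεN⟩ := S.exists_norm_sub_lt hp₀ hN
  obtain ⟨r, hr, hrε, δ, hδ, hδε, σ, hσd, hσ0, hσ, hσu⟩ :=
    exists_level_chart S.runge.1 S.hol (S.maps p₀ hp₀) hij hj hε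
  have hnω : 0 < ‖ω‖ := norm_pos_iff.2 hω0
  have hball : ∀ s ∈ ball (0 : ℂ) (‖ω‖ * δ), s / ω ∈ ball (0 : ℂ) δ := by
    intro s hs
    rw [mem_ball, dist_zero_right] at hs ⊢
    rw [norm_div, div_lt_iff₀ hnω, mul_comm]
    exact hs
  have hlt : ∀ w : ℂ, ‖ω * w‖ < ‖ω‖ * δ → ‖w‖ < δ := fun w hw => by
    rw [norm_mul] at hw
    exact lt_of_mul_lt_mul_left hw hnω.le
  have hnear : ∀ p ∈ closedBall (0 : ℝ × ℝ) 1, ‖ω * (φ p i - φ p₀ i)‖ < ‖ω‖ * δ →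
      ‖φ p j - φ p₀ j‖ ≤ r → p ∈ N := by
    intro p hp h1 h2
    refine hεN p hp ((pi_norm_le_iff_of_nonneg hε.le).2 fun k => ?_)
    rcases hall k with rfl | rfl
    · exact (hlt _ h1).le.trans hδε
    · exact h2.trans hrε
  let c : LevelChart (discLevel h φ l) {z ∈ Ω | h z = l} (φ p₀) :=
    { i := i
      j := j
      ω := ω
      r := r
      δ := ‖ω‖ * δ
      σ := fun s => σ (s / ω)
      ψ := ψ
      r_pos := hr
      δ_pos := by positivity
      σ_diff := hσd.comp (by fun_prop) hball
      σ_zero := by simp [hσ0]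
      σ_param := fun s hs => by rw [(hσ _ (hball s hs)).1, mul_div_cancel₀ _ hω0]
      σ_near := fun s hs => (hσ _ (hball s hs)).2.1
      σ_mem := fun s hs => ⟨(hσ _ (hball s hs)).2.2.1, by rw [(hσ _ (hball s hs)).2.2.2, hl]⟩
      σ_unique := fun z hz h1 h2 => by
        rw [mul_div_cancel_left₀ _ hω0]
        exact (hσu z (hlt _ h1) h2).2 (by rw [hz.2, hl])
      hull_sub := fun z hz h1 h2 =>
        have hzΩ := (hσu z (hlt _ h1) h2).1
        ⟨hzΩ, S.eq_of_mem_polyHull hz hzΩ⟩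
      ψ_zero := hψ0
      ψ_lip := hψ
      graph := by
        rintro _ ⟨p, hp, rfl⟩ h1 h2
        exact (hNg p (hnear p hp.1 h1 h2.le) (hvl p hp.1 hp.2)).2.2 }
  refine ⟨c, fun a ha => ?_⟩
  have hcδ : 0 < c.δ := c.δ_pos
  have hFre : ContinuousAt (fun p => |(F p).re|) p₀ :=
    (Complex.continuous_re.continuousAt.comp hFC.continuousAt).abs
  have hF0 : |(F p₀).re| = 0 := by simp [hF]
  refine ⟨N ∩ {p | |(F p).re| < min a (c.δ / 2)}, inter_mem hN
    (hFre.eventually (gt_mem_nhds (by beta_reduce; rw [hF0]; exact lt_min ha (by linarith)))), ?_⟩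
  rintro p ⟨hpN, hpa⟩ hvp
  obtain ⟨-, h2, h3⟩ := hNg p hpN hvp
  have hpa' : |(F p).re| < a ∧ |(F p).re| < c.δ / 2 := lt_min_iff.1 hpa
  refine ⟨(F p).re, hpa'.1, ?_⟩
  rintro ⟨p', hp', he⟩
  set s := graphPt c.ψ (F p).re with hs
  have hsb : s ∈ ball (0 : ℂ) c.δ := by
    rw [mem_ball, dist_zero_right]
    refine (Complex.norm_le_abs_re_add_abs_im s).trans_lt ?_
    have h4 := abs_graph_le hψ0 hψ (F p).re
    have h5 : s.re = (F p).re := by simp [hs, graphPt]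
    have h6 : s.im = ψ (F p).re := by simp [hs, graphPt, c]
    rw [h5, h6]
    have := abs_nonneg (F p).re
    linarith [hpa'.2]
  have hFp' : F p' = s := by
    have := c.σ_param s hsb
    rw [← he] at this
    exact this
  have hp'N : p' ∈ N := by
    refine hnear p' hp'.1 ?_ ?_
    · have h7 : ‖F p'‖ < c.δ := by rw [hFp']; simpa using hsb
      exact h7
    · rw [he]; exact (c.σ_near s hsb).le
  have h8 := (hNg p' hp'N (hvl p' hp'.1 hp'.2)).2.1
  have h9 : (F p').re = (F p).re := by rw [hFp']; simp [hs, graphPt]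
  have h10 : p' = p := by rw [← h8, h9, h2]
  subst h10
  exact ⟨hp', he⟩

end DiscSetup

end DiscLevels

section ClosedLevels

open Filter

theorem exists_circle_lift (g : C(ℝ × ℝ, Circle)) (y : ℝ × ℝ) (e : ℝ) (he : Circle.exp e = g y) :
    ∃ G : ℝ × ℝ → ℝ, Continuous G ∧ G y = e ∧ ∀ p, Circle.exp (G p) = g p := by
  obtain ⟨G, ⟨h1, h2⟩, -⟩ := Circle.isCoveringMap_exp.existsUnique_continuousMap_lifts g y e he
  exact ⟨G, G.continuous, h1, fun p => congrFun h2 p⟩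

/-- A compact set which is locally the zero set of `v` is contained in a global zero set of a
continuous function with the same signs as `v` near a given point. -/
theorem exists_side_function {C U : Set (ℝ × ℝ)} {v : ℝ × ℝ → ℝ} (hC : IsCompact C)
    (hU : IsOpen U) (hCU : C ⊆ U) (hv : ContinuousOn v U) (h0 : ∀ p ∈ U, v p = 0 ↔ p ∈ C)
    {y : ℝ × ℝ} (hy : y ∈ C) : ∃ G : ℝ × ℝ → ℝ, Continuous G ∧ (∀ p, G p = 0 → p ∈ C) ∧
      ∀ᶠ p in 𝓝 y, (0 < G p ↔ 0 < v p) ∧ (G p < 0 ↔ v p < 0) := by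
  classical
  have hpi := Real.pi_pos
  obtain ⟨L, hL, hCL, hLU⟩ := exists_compact_between hC hU hCU
  have hfrL : frontier L ⊆ L := hL.isClosed.frontier_subset
  obtain ⟨d, hd, hdL⟩ := (hL.of_isClosed_subset isClosed_frontier hfrL).exists_forall_le'
    (f := fun p => |v p|) (a := 0) (hv.abs.mono (hfrL.trans hLU)) (fun p hp => abs_pos.2 fun hc =>
      hp.2 (hCL ((h0 p (hLU (hfrL hp))).1 hc)))
  set k : ℝ × ℝ → ℝ := fun p => max (-1) (min 1 (v p / d)) with hk
  have hkL : ContinuousOn k L :=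
    continuousOn_const.sup (continuousOn_const.inf ((hv.mono hLU).div_const d))
  have hkabs : ∀ p, |k p| ≤ 1 := fun p =>
    abs_le.2 ⟨le_max_left _ _, max_le (by norm_num) (min_le_left _ _)⟩
  have hkone : ∀ p, d ≤ |v p| → Circle.exp (Real.pi * k p) = Circle.exp Real.pi := by
    intro p hp
    rcases le_abs.1 hp with h | h
    · have : k p = 1 := by
        have h1 : 1 ≤ v p / d := (one_le_div hd).2 h
        simp [hk, min_eq_left h1]
      rw [this, mul_one]
    · have : k p = -1 := by
        have h1 : v p / d ≤ -1 := by rw [div_le_iff₀ hd]; linarith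
        simp only [hk]
        rw [min_eq_right (by linarith), max_eq_left h1]
      rw [this, Circle.exp_eq_exp]
      exact ⟨-1, by push_cast; ring⟩
  have hkzero : ∀ p, k p = 0 → v p = 0 := by
    intro p hp
    by_contra hne
    rcases lt_or_gt_of_ne hne with h | h
    · have h1 := div_neg_of_neg_of_pos h hd
      have h2 : k p < 0 := max_lt (by norm_num) ((min_le_right _ _).trans_lt h1)
      exact h2.ne hp
    · have h1 := div_pos h hd
      have h2 : 0 < k p := lt_max_of_lt_right (lt_min one_pos h1)
      exact h2.ne' hp
  have hksign : ∀ p, (0 < k p ↔ 0 < v p) ∧ (k p < 0 ↔ v p < 0) := by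
    intro p
    constructor
    · rw [hk, lt_max_iff, lt_min_iff, div_pos_iff_of_pos_right hd]
      norm_num
    · rw [hk, max_lt_iff, min_lt_iff, div_lt_iff₀ hd, zero_mul]
      norm_num
  have hgc : Continuous (L.piecewise (fun p => Circle.exp (Real.pi * k p))
      fun _ => Circle.exp Real.pi) := by
    refine continuous_piecewise (fun p hp => hkone p (hdL p hp)) ?_ continuousOn_const
    rw [hL.isClosed.closure_eq]
    exact Circle.exp.continuous.comp_continuousOn (continuousOn_const.mul hkL)
  have hyL : y ∈ interior L := hCL hy
  have hky : k y = 0 := by simp [hk, (h0 y (hCU hy)).2 hy]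
  obtain ⟨G, hG, hGy, hGe⟩ := exists_circle_lift ⟨_, hgc⟩ y 0 (by
    simp [Set.piecewise_eq_of_mem _ _ _ (interior_subset hyL), hky])
  have hpi1 : Circle.exp Real.pi ≠ 1 := by
    rw [Ne, ← Circle.exp_zero]
    intro hc
    have := Circle.exp_injOn_Ioc (a := -Real.pi) (b := Real.pi) (by linarith)
      ⟨by linarith, le_rfl⟩ ⟨by linarith, hpi.le⟩ hc
    exact hpi.ne' this
  refine ⟨G, hG, fun p hp => ?_, ?_⟩
  · have h1 := hGe p
    rw [hp, Circle.exp_zero] at h1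
    by_cases hpL : p ∈ L
    · refine (h0 p (hLU hpL)).1 (hkzero p ?_)
      have h2 : Circle.exp 0 = Circle.exp (Real.pi * k p) := by
        rw [Circle.exp_zero, h1]
        simp [Set.piecewise_eq_of_mem _ _ _ hpL]
      by_contra hne
      rcases eq_or_lt_of_le (hkabs p) with h3 | h3
      · have h4 : Circle.exp (Real.pi * k p) = Circle.exp Real.pi := by
          rcases abs_eq (zero_le_one) |>.1 h3 with h | h
          · rw [h, mul_one]
          · rw [h, Circle.exp_eq_exp]
            exact ⟨-1, by push_cast; ring⟩
        rw [h4, Circle.exp_zero] at h2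
        exact hpi1 h2.symm
      · obtain ⟨h5, h6⟩ := abs_lt.1 h3
        have := Circle.exp_injOn_Ioc (a := -Real.pi) (b := Real.pi) (by linarith)
          ⟨by linarith, hpi.le⟩ ⟨by nlinarith, by nlinarith⟩ h2
        rcases mul_eq_zero.1 this.symm with h | h
        · exact hpi.ne' h
        · exact hne h
    · exfalso
      apply hpi1
      rw [h1]
      simp [Set.piecewise_eq_of_notMem _ _ _ hpL]
  · have hkc : ContinuousAt k y := hkL.continuousAt (mem_interior_iff_mem_nhds.1 hyL)
    have h1 : ∀ᶠ p in 𝓝 y, |k p| < 1 :=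
      hkc.abs.eventually (gt_mem_nhds (by beta_reduce; rw [hky]; norm_num))
    have h2 : ∀ᶠ p in 𝓝 y, |G p| < Real.pi :=
      hG.continuousAt.abs.eventually (gt_mem_nhds (by beta_reduce; rw [hGy]; simpa using hpi))
    filter_upwards [h1, h2, isOpen_interior.mem_nhds hyL] with p h1 h2 hpL
    have h3 : Circle.exp (G p) = Circle.exp (Real.pi * k p) := by
      rw [hGe p]
      simp [Set.piecewise_eq_of_mem _ _ _ (interior_subset hpL)]
    obtain ⟨h5, h6⟩ := abs_lt.1 h1
    obtain ⟨h7, h8⟩ := abs_lt.1 h2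
    have h4 := Circle.exp_injOn_Ioc (a := -Real.pi) (b := Real.pi) (by linarith)
      ⟨h7, h8.le⟩ ⟨by nlinarith, by nlinarith⟩ h3
    rw [h4, mul_pos_iff_of_pos_left hpi, ← (hksign p).1, ← (hksign p).2]
    refine ⟨Iff.rfl, ⟨fun h => ?_, fun h => mul_neg_of_pos_of_neg hpi h⟩⟩
    by_contra hc
    exact absurd h (not_lt.2 (mul_nonneg hpi.le (not_lt.1 hc)))

theorem isPreconnected_compl_closedBall : IsPreconnected (closedBall (0 : ℝ × ℝ) 1)ᶜ := by
  have hs : IsPreconnected (sphere (0 : ℝ × ℝ) 1) := isPreconnected_sphere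
    (by rw [← Module.finrank_eq_rank]; norm_num) _ _
  have h1 := (hs.prod (isPreconnected_Ioi (a := (1 : ℝ)))).image (fun q => q.2 • q.1)
    (continuous_snd.smul continuous_fst).continuousOn
  convert h1 using 1
  ext p
  simp only [Set.mem_compl_iff, mem_closedBall, dist_zero_right, not_le, Set.mem_image,
    Set.mem_prod, mem_sphere, Set.mem_Ioi]
  constructor
  · intro hp
    have hp0 : 0 < ‖p‖ := by linarith
    exact ⟨(‖p‖⁻¹ • p, ‖p‖), ⟨by rw [norm_smul, norm_inv, norm_norm, inv_mul_cancel₀ hp0.ne'], hp⟩,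
      smul_inv_smul₀ hp0.ne' p⟩
  · rintro ⟨⟨x, t⟩, ⟨hx, ht⟩, rfl⟩
    dsimp only at hx ht ⊢
    rw [norm_smul, hx, mul_one, Real.norm_eq_abs]
    exact ht.trans_le (le_abs_self t)

end ClosedLevels

section ClosedLevels

open Filter

namespace DiscSetup

variable {Ω : Set (Fin 2 → ℂ)} {h : (Fin 2 → ℂ) → ℂ} {U : Set (ℝ × ℝ)}
  {φ : ℝ × ℝ → (Fin 2 → ℂ)}

theorem exists_angle (S : DiscSetup Ω h U φ) : ∃ θ : ℝ × ℝ → ℝ, Continuous θ ∧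
    ∀ p ∈ closedBall (0 : ℝ × ℝ) 1, h (φ p) = Complex.exp (θ p * Complex.I) := by
  set ρ : ℝ × ℝ → ℝ × ℝ := fun p => (max (-1) (min 1 p.1), max (-1) (min 1 p.2)) with hρ
  have hρc : Continuous ρ := by fun_prop
  have hρm : ∀ p, ρ p ∈ closedBall (0 : ℝ × ℝ) 1 := by
    intro p
    rw [mem_closedBall, dist_zero_right, Prod.norm_def]
    have h1 : ∀ x : ℝ, |max (-1) (min 1 x)| ≤ 1 := fun x =>
      abs_le.2 ⟨le_max_left _ _, max_le (by norm_num) (min_le_left _ _)⟩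
    exact max_le (h1 _) (h1 _)
  have hρid : ∀ p ∈ closedBall (0 : ℝ × ℝ) 1, ρ p = p := by
    intro p hp
    rw [mem_closedBall, dist_zero_right, Prod.norm_def, max_le_iff, Real.norm_eq_abs,
      Real.norm_eq_abs, abs_le, abs_le] at hp
    obtain ⟨⟨h1, h2⟩, h3, h4⟩ := hp
    ext
    · simp [hρ, min_eq_right h2, max_eq_right h1]
    · simp [hρ, min_eq_right h4, max_eq_right h3]
  have hc : ContinuousOn (fun p => h (φ p)) (closedBall (0 : ℝ × ℝ) 1) := fun p hp =>
    (S.contDiffAt_comp hp).continuousAt.continuousWithinAt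
  have hcc : Continuous fun p => h (φ (ρ p)) := hc.comp_continuous hρc hρm
  let g : C(ℝ × ℝ, Circle) := ⟨fun p => ⟨h (φ (ρ p)), by
    rw [Submonoid.unitSphere]
    simpa using S.norm_eq _ (hρm p)⟩, by
    exact hcc.subtype_mk _⟩
  obtain ⟨e, he⟩ := Circle.exp_surjective (g 0)
  obtain ⟨θ, hθ, -, hθe⟩ := exists_circle_lift g 0 e he
  refine ⟨θ, hθ, fun p hp => ?_⟩
  have h1 := congrArg (fun z : Circle => (z : ℂ)) (hθe p)
  simp only [Circle.coe_exp] at h1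
  rw [h1]
  show _ = h (φ (ρ p))
  rw [hρid p hp]

theorem fderiv_im_ne_zero (S : DiscSetup Ω h U φ) {p : ℝ × ℝ}
    (hp : p ∈ closedBall (0 : ℝ × ℝ) 1) {l : ℂ} (hl : h (φ p) = l) :
    fderiv ℝ (fun p => ((starRingEnd ℂ) l * h (φ p)).im) p ≠ 0 := by
  intro h0
  refine S.fderiv_comp_ne_zero hp (ContinuousLinearMap.ext fun w =>
    S.fderiv_comp_eq_zero_of_im hp ?_)
  rw [hl, ← S.im_conj_fderiv hp, h0]
  rfl

theorem im_conj_mul_exp (a b : ℝ) :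
    ((starRingEnd ℂ) (Complex.exp (a * Complex.I)) * Complex.exp (b * Complex.I)).im =
      Real.sin (b - a) := by
  rw [← Complex.exp_conj, ← Complex.exp_add, map_mul, Complex.conj_I, Complex.conj_ofReal]
  rw [show (a : ℂ) * -Complex.I + b * Complex.I = ((b - a : ℝ) : ℂ) * Complex.I by
    push_cast; ring, Complex.exp_ofReal_mul_I_im]

theorem not_isLocalExtr_angle (S : DiscSetup Ω h U φ) {θ : ℝ × ℝ → ℝ} (hθ : Continuous θ)
    (he : ∀ p ∈ closedBall (0 : ℝ × ℝ) 1, h (φ p) = Complex.exp (θ p * Complex.I)) {p : ℝ × ℝ}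
    (hp : p ∈ interior (closedBall (0 : ℝ × ℝ) 1)) : ¬ IsLocalExtr θ p := by
  intro hext
  have hpQ := interior_subset hp
  refine S.fderiv_im_ne_zero hpQ (l := h (φ p)) rfl (IsLocalExtr.fderiv_eq_zero ?_)
  have hev : ∀ᶠ x in 𝓝 p, ((starRingEnd ℂ) (h (φ p)) * h (φ x)).im = Real.sin (θ x - θ p) := by
    filter_upwards [mem_interior_iff_mem_nhds.1 hp] with x hx
    rw [he x hx, he p hpQ, im_conj_mul_exp]
  have hp0 : ((starRingEnd ℂ) (h (φ p)) * h (φ p)).im = 0 := by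
    rw [hev.self_of_nhds, sub_self, Real.sin_zero]
  have hsm : ∀ᶠ x in 𝓝 p, |θ x - θ p| < 1 :=
    (hθ.sub continuous_const).abs.continuousAt.eventually (gt_mem_nhds (by simp))
  have hpi := Real.pi_gt_three
  rcases hext with h1 | h1
  · left
    filter_upwards [h1, hev, hsm] with x hx h2 h3
    rw [hp0, h2]
    exact Real.sin_nonneg_of_nonneg_of_le_pi (by linarith) (by linarith [(abs_lt.1 h3).2])
  · right
    filter_upwards [h1, hev, hsm] with x hx h2 h3
    rw [hp0, h2]
    exact Real.sin_nonpos_of_nonpos_of_neg_pi_le (by linarith) (by linarith [(abs_lt.1 h3).1])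

/-- A function negative outside the disc whose zeros lie in a level set of the angle is nowhere
positive. -/
theorem nonpos_of_zeros_subset (S : DiscSetup Ω h U φ) {θ : ℝ × ℝ → ℝ} (hθ : Continuous θ)
    (he : ∀ p ∈ closedBall (0 : ℝ × ℝ) 1, h (φ p) = Complex.exp (θ p * Complex.I))
    {G : ℝ × ℝ → ℝ} (hG : Continuous G) {c : ℝ} (h0 : ∀ p, G p = 0 → θ p = c)
    (hneg : ∀ p ∉ closedBall (0 : ℝ × ℝ) 1, G p < 0) (p : ℝ × ℝ) : G p ≤ 0 := by
  by_contra! hp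
  set O : Set (ℝ × ℝ) := {p | 0 < G p} with hO
  have hOo : IsOpen O := isOpen_lt continuous_const hG
  have hOQ : O ⊆ closedBall 0 1 := fun x hx => by
    by_contra hc
    exact (hneg x hc).not_gt hx
  have hOi : O ⊆ interior (closedBall 0 1) := interior_maximal hOQ hOo
  have hcl : IsCompact (closure O) :=
    (isCompact_closedBall _ _).of_isClosed_subset isClosed_closure
      (closure_minimal hOQ isClosed_closedBall)
  have hext : ∀ x ∈ closure O, (IsMaxOn θ (closure O) x ∨ IsMinOn θ (closure O) x) → θ x = c := by
    intro x hx hm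
    by_cases hxO : x ∈ O
    · exfalso
      have hn : closure O ∈ 𝓝 x := mem_of_superset (hOo.mem_nhds hxO) subset_closure
      refine S.not_isLocalExtr_angle hθ he (hOi hxO) ?_
      rcases hm with hm | hm
      · exact Or.inr (hm.isLocalMax hn)
      · exact Or.inl (hm.isLocalMin hn)
    · refine h0 x (le_antisymm (not_lt.1 hxO) ?_)
      exact closure_lt_subset_le continuous_const hG hx
  obtain ⟨a, ha, ham⟩ := hcl.exists_isMaxOn ⟨p, subset_closure hp⟩ hθ.continuousOn
  obtain ⟨b, hb, hbm⟩ := hcl.exists_isMinOn ⟨p, subset_closure hp⟩ hθ.continuousOn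
  have hac := hext a ha (Or.inl ham)
  have hbc := hext b hb (Or.inr hbm)
  have hcon : ∀ x ∈ O, θ x = c := fun x hx =>
    le_antisymm (hac ▸ ham (subset_closure hx)) (hbc ▸ hbm (subset_closure hx))
  refine S.not_isLocalExtr_angle hθ he (hOi hp) (Or.inr ?_)
  filter_upwards [hOo.mem_nhds hp] with x hx
  rw [hcon x hx, hcon p hp]

/-- A level set of `h ∘ φ` has no compact part which is locally the whole level set. -/
theorem eq_empty_of_isolated (S : DiscSetup Ω h U φ) {l : ℂ} {C : Set (ℝ × ℝ)} (hC : IsCompact C)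
    (hCQ : ∀ p ∈ C, p ∈ closedBall (0 : ℝ × ℝ) 1 ∧ h (φ p) = l)
    (hN : ∀ p₀ ∈ C, ∃ N ∈ 𝓝 p₀, ∀ p ∈ N, ((starRingEnd ℂ) l * h (φ p)).im = 0 → p ∈ C) :
    C = ∅ := by
  by_contra hne
  obtain ⟨y, hy⟩ := Set.nonempty_iff_ne_empty.2 hne
  obtain ⟨θ, hθ, he⟩ := S.exists_angle
  set v : ℝ × ℝ → ℝ := fun p => ((starRingEnd ℂ) l * h (φ p)).im with hv
  set C' : Set (ℝ × ℝ) := C ∩ {p | θ p = θ y} with hC'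
  have hC'c : IsCompact C' := hC.inter_right (isClosed_eq hθ continuous_const)
  have hlc : l = Complex.exp (θ y * Complex.I) := by rw [← he y (hCQ y hy).1, (hCQ y hy).2]
  have hv0 : ∀ p ∈ C, v p = 0 := by
    intro p hp
    simp only [hv]
    rw [(hCQ p hp).2, hlc, im_conj_mul_exp, sub_self, Real.sin_zero]
  have hnb : ∀ p₀ ∈ C', ∀ᶠ p in 𝓝 p₀, v p = 0 → p ∈ C' := by
    rintro p₀ ⟨hp₀, hθ₀⟩
    obtain ⟨N, hN, h1⟩ := hN p₀ hp₀
    have h2 : ∀ᶠ p in 𝓝 p₀, |θ p - θ y| < 1 :=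
      (hθ.sub continuous_const).abs.continuousAt.eventually (gt_mem_nhds (by
        have h3 : θ p₀ = θ y := hθ₀
        simp [h3]))
    filter_upwards [hN, h2] with p hp h3 hvp
    have hpC := h1 p hp hvp
    refine ⟨hpC, ?_⟩
    simp only [hv] at hvp
    rw [he p (hCQ p hpC).1, hlc, im_conj_mul_exp] at hvp
    have hpi := Real.pi_gt_three
    obtain ⟨h4, h5⟩ := abs_lt.1 h3
    have := (Real.sin_eq_zero_iff_of_lt_of_lt (by linarith) (by linarith)).1 hvp
    exact sub_eq_zero.1 this
  have hvc : ∀ p ∈ closedBall (0 : ℝ × ℝ) 1, ContDiffAt ℝ 1 v p := fun p hp =>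
    Complex.imCLM.contDiff.contDiffAt.comp p (contDiffAt_const.mul (S.contDiffAt_comp hp))
  set W : Set (ℝ × ℝ) := interior {p | (v p = 0 → p ∈ C') ∧ ContinuousAt v p} with hW
  have hCW : C' ⊆ W := by
    intro p hp
    refine mem_interior_iff_mem_nhds.2 ?_
    filter_upwards [hnb p hp, (hvc p (hCQ p hp.1).1).eventually (by norm_num)] with x h1 h2
    exact ⟨h1, h2.continuousAt⟩
  obtain ⟨G, hG, hG0, hGv⟩ := exists_side_function hC'c isOpen_interior hCW
    (fun p hp => (interior_subset hp).2.continuousWithinAt)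
    (fun p hp => ⟨(interior_subset hp).1, fun h1 => hv0 p h1.1⟩) ⟨hy, rfl⟩
  have hyQ := (hCQ y hy).1
  have hvy : v y = 0 := hv0 y hy
  have hdv : fderiv ℝ v y ≠ 0 := S.fderiv_im_ne_zero hyQ (hCQ y hy).2
  have hpos : ∃ p, 0 < G p := by
    by_contra! hc
    refine hdv (IsLocalMax.fderiv_eq_zero ?_)
    filter_upwards [hGv] with p hp
    rw [hvy, ← not_lt, ← hp.1, not_lt]
    exact hc p
  have hneg : ∃ p, G p < 0 := by
    by_contra! hc
    refine hdv (IsLocalMin.fderiv_eq_zero ?_)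
    filter_upwards [hGv] with p hp
    rw [hvy, ← not_lt, ← hp.2, not_lt]
    exact hc p
  have hθ0 : ∀ p, G p = 0 → θ p = θ y := fun p hp => (hG0 p hp).2
  have hGQ : ∀ p ∉ closedBall (0 : ℝ × ℝ) 1, G p ≠ 0 := fun p hp h1 =>
    hp (hCQ p (hG0 p h1).1).1
  have hsign : (∀ p ∉ closedBall (0 : ℝ × ℝ) 1, G p < 0) ∨
      ∀ p ∉ closedBall (0 : ℝ × ℝ) 1, 0 < G p := by
    by_contra! hc
    obtain ⟨⟨a, ha, ha'⟩, b, hb, hb'⟩ := hc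
    obtain ⟨x, hx, hx0⟩ := isPreconnected_compl_closedBall.intermediate_value hb ha
      hG.continuousOn ⟨hb', ha'⟩
    exact hGQ x hx hx0
  rcases hsign with hs | hs
  · obtain ⟨p, hp⟩ := hpos
    exact (S.nonpos_of_zeros_subset hθ he hG hθ0 hs p).not_gt hp
  · obtain ⟨p, hp⟩ := hneg
    have := S.nonpos_of_zeros_subset (G := fun p => -G p) hθ he hG.neg (fun p hp => hθ0 p (neg_eq_zero.1 hp))
      (fun p hp => neg_neg_iff_pos.2 (hs p hp)) p
    linarith

theorem essSet_discLevel_eq_empty (S : DiscSetup Ω h U φ) {l : ℂ} [CompactSpace (discLevel h φ l)] :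
    essSet (polyAlg (discLevel h φ l)) = ∅ := by
  set X := discLevel h φ l with hX
  set V : Set (Fin 2 → ℂ) := {z ∈ Ω | h z = l} with hV
  set C : Set (ℝ × ℝ) := {p | (p ∈ closedBall (0 : ℝ × ℝ) 1 ∧ h (φ p) = l) ∧
    (¬ ∀ᶠ z in 𝓝 (φ p), z ∈ V → z ∈ polyHull 2 X) ∧
    ¬ ∀ᶠ z in 𝓝 (φ p), z ∈ polyHull 2 X → z ∈ X} with hCdef
  have hCe : C = ∅ := by
    refine S.eq_empty_of_isolated (l := l) ?_ (fun p hp => hp.1) ?_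
    · refine (S.isCompact_level l).of_isClosed_subset ?_ fun p hp => hp.1
      have hcont : ContinuousOn φ {p ∈ closedBall (0 : ℝ × ℝ) 1 | h (φ p) = l} :=
        S.continuousOn_φ.mono ((Set.sep_subset _ _).trans S.disc_sub)
      have h1 : IsClosed ({z : Fin 2 → ℂ | ¬ ∀ᶠ z' in 𝓝 z, z' ∈ V → z' ∈ polyHull 2 X} ∩
          {z | ¬ ∀ᶠ z' in 𝓝 z, z' ∈ polyHull 2 X → z' ∈ X}) :=
        (isOpen_setOfPred_eventually_nhds).isClosed_compl.inter
          (isOpen_setOfPred_eventually_nhds).isClosed_compl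
      exact hcont.preimage_isClosed_of_isClosed (S.isCompact_level l).isClosed h1
    · rintro p₀ ⟨⟨hp₀, hl⟩, hnf, hne⟩
      obtain ⟨c, hc⟩ := S.exists_levelChart hp₀ hl
      rcases c.full_or_empty_or_half with h1 | h1 | ⟨a, ha, -, h1⟩
      · exact absurd h1 hnf
      · exact absurd h1 hne
      · obtain ⟨N, hN, h2⟩ := hc a ha
        refine ⟨N, hN, fun p hp hvp => ?_⟩
        obtain ⟨t, ht, h3⟩ := h2 p hp hvp
        obtain ⟨h4, h5⟩ := h1 t ht
        obtain ⟨h6, h7⟩ := h3 h4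
        rw [← h7] at h5
        exact ⟨h6, h5⟩
  by_contra hE
  have hEc : IsCompact (essSet (polyAlg X)) := (isClosed_essSet _).isCompact
  have hfc : Continuous fun x : X => ∑ i, ‖x.1 i‖ ^ 2 :=
    continuous_finsetSum _ fun i _ => ((continuous_apply i).comp continuous_subtype_val).norm.pow 2
  obtain ⟨e, heE, hmax⟩ := hEc.exists_isMaxOn (Set.nonempty_iff_ne_empty.2 hE) hfc.continuousOn
  obtain ⟨x, p, ⟨hp, hl⟩, rfl⟩ := e
  obtain ⟨c, -⟩ := S.exists_levelChart hp hl
  rcases c.full_or_empty_or_half with h1 | h1 | ⟨a, ha, -, h1⟩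
  · exact c.not_full h1 fun x hx => hmax hx
  · exact c.notMem_essSet h1 ⟨p, ⟨hp, hl⟩, rfl⟩ heE
  · have h2 := (h1 0 (by simpa using ha)).2
    have h3 : c.σ (graphPt c.ψ 0) = φ p := by
      have : graphPt c.ψ 0 = 0 := by simp [graphPt, c.ψ_zero]
      rw [this, c.σ_zero]
    rw [h3] at h2
    have : p ∈ C := ⟨⟨hp, hl⟩, h2⟩
    rw [hCe] at this
    exact this

theorem polyHull_discLevel (S : DiscSetup Ω h U φ) (l : ℂ) :
    polyHull 2 (discLevel h φ l) = discLevel h φ l := by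
  have : CompactSpace (discLevel h φ l) := isCompact_iff_compactSpace.1 (S.isCompact_discLevel l)
  exact polyHull_eq_of_essSet_eq_empty S.essSet_discLevel_eq_empty

theorem polyAlg_discLevel (S : DiscSetup Ω h U φ) (l : ℂ) [CompactSpace (discLevel h φ l)] :
    polyAlg (discLevel h φ l) = ⊤ :=
  polyAlg_eq_top_iff.2 S.essSet_discLevel_eq_empty

end DiscSetup

end ClosedLevels

section CircleGraph

/-- The lower arc of the unit circle about `I`, cut off to have small slope. -/
def circGraph (x : ℝ) : ℝ := 1 - √(1 - max (-(1 / 25)) (min (1 / 25) x) ^ 2)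

theorem circGraph_zero : circGraph 0 = 0 := by
  have h1 : min (1 / 25 : ℝ) 0 = 0 := min_eq_right (by norm_num)
  have h2 : max (-(1 / 25) : ℝ) 0 = 0 := max_eq_right (by norm_num)
  simp [circGraph]

theorem continuous_circGraph : Continuous circGraph := by
  unfold circGraph
  fun_prop

theorem circGraph_eq {x : ℝ} (hx : |x| ≤ 1 / 25) : circGraph x = 1 - √(1 - x ^ 2) := by
  obtain ⟨h1, h2⟩ := abs_le.1 hx
  rw [circGraph, min_eq_right h2, max_eq_right h1]

theorem abs_circGraph_sub_le (x y : ℝ) : |circGraph x - circGraph y| ≤ 1 / 24 * |x - y| := by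
  set a := max (-(1 / 25)) (min (1 / 25) x) with ha
  set b := max (-(1 / 25)) (min (1 / 25) y) with hb
  have hab : |a - b| ≤ |x - y| := by
    refine (abs_max_sub_max_le_max _ _ _ _).trans (max_le (by simp) ?_)
    exact (abs_min_sub_min_le_max _ _ _ _).trans (max_le (by simp) le_rfl)
  have hbd : ∀ z : ℝ, |max (-(1 / 25)) (min (1 / 25) z)| ≤ 1 / 25 := fun z =>
    abs_le.2 ⟨le_max_left _ _, max_le (by norm_num) (min_le_left _ _)⟩
  have hsq : ∀ z : ℝ, |z| ≤ 1 / 25 → 24 / 25 ≤ √(1 - z ^ 2) := by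
    intro z hz
    refine Real.le_sqrt_of_sq_le ?_
    have : z ^ 2 ≤ (1 / 25) ^ 2 := sq_le_sq' (abs_le.1 hz).1 (abs_le.1 hz).2
    norm_num at this ⊢
    linarith
  have ha' := hbd x
  have hb' := hbd y
  rw [← ha] at ha'
  rw [← hb] at hb'
  have h1 := hsq a ha'
  have h2 := hsq b hb'
  have hpos : ∀ z : ℝ, |z| ≤ 1 / 25 → 0 ≤ 1 - z ^ 2 := by
    intro z hz
    have : z ^ 2 ≤ (1 / 25) ^ 2 := sq_le_sq' (abs_le.1 hz).1 (abs_le.1 hz).2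
    norm_num at this ⊢
    linarith
  have h3 : (√(1 - b ^ 2) - √(1 - a ^ 2)) * (√(1 - b ^ 2) + √(1 - a ^ 2)) = (a - b) * (a + b) := by
    have e1 := Real.mul_self_sqrt (hpos a ha')
    have e2 := Real.mul_self_sqrt (hpos b hb')
    linear_combination e2 - e1
  have h4 := congrArg abs h3
  rw [abs_mul, abs_mul, abs_of_nonneg (by linarith : 0 ≤ √(1 - b ^ 2) + √(1 - a ^ 2))] at h4
  have h5 : |a + b| ≤ 2 / 25 := (abs_add_le _ _).trans (by linarith)
  have h6 : |circGraph x - circGraph y| = |√(1 - b ^ 2) - √(1 - a ^ 2)| := by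
    rw [circGraph, circGraph, ← ha, ← hb]
    congr 1
    ring
  rw [h6]
  have h7 := abs_nonneg (√(1 - b ^ 2) - √(1 - a ^ 2))
  have h8 : |a - b| * |a + b| ≤ |x - y| * (2 / 25) := by gcongr
  nlinarith

theorem norm_sub_I_sq (s : ℂ) : ‖s - Complex.I‖ ^ 2 = s.re ^ 2 + (1 - s.im) ^ 2 := by
  rw [← Complex.normSq_eq_norm_sq, Complex.normSq_apply]
  simp
  ring

theorem lt_circGraph_iff {s : ℂ} (hs : ‖s‖ ≤ 1 / 25) :
    s.im < circGraph s.re ↔ 1 < ‖s - Complex.I‖ := by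
  have h1 := (Complex.abs_re_le_norm s).trans hs
  have h2 := (abs_le.1 ((Complex.abs_im_le_norm s).trans hs)).2
  rw [circGraph_eq h1, lt_sub_comm, Real.sqrt_lt' (by linarith),
    ← one_lt_sq_iff₀ (norm_nonneg (s - Complex.I)), norm_sub_I_sq, sub_lt_iff_lt_add']

theorem circGraph_lt_iff {s : ℂ} (hs : ‖s‖ ≤ 1 / 25) :
    circGraph s.re < s.im ↔ ‖s - Complex.I‖ < 1 := by
  have h1 := (Complex.abs_re_le_norm s).trans hs
  have h2 := (abs_le.1 ((Complex.abs_im_le_norm s).trans hs)).2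
  rw [circGraph_eq h1, sub_lt_comm, Real.lt_sqrt (by linarith),
    ← sq_lt_one_iff₀ (norm_nonneg (s - Complex.I)), norm_sub_I_sq, lt_sub_iff_add_lt']

end CircleGraph

section OneSided

open Filter

variable {X : Type*} [TopologicalSpace X] [CompactSpace X]

theorem eqOn_zero_of_eventually_zero {F : ℂ → ℂ} {B : Set ℂ} (hB : IsOpen B) (hBc : IsPreconnected B)
    (hF : DifferentiableOn ℂ F B) {s : ℂ} (hs : s ∈ B) (h : ∀ᶠ z in 𝓝 s, F z = 0) :
    ∀ z ∈ B, F z = 0 := fun _ hz =>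
  (hF.analyticOnNhd hB).eqOn_zero_of_preconnected_of_eventuallyEq_zero hBc hs h hz

/-- If a Cauchy transform carried by a circular arc vanishes outside the circle and only charges
one half of the arc, then it vanishes inside as well. -/
theorem onesided_kill {β f : C(X, ℂ)} {ν : C(X, ℂ) →L[ℂ] ℂ} {Λ : ℂ → ℂ} {δ : ℝ} (hδ : 0 < δ)
    (hδ' : δ ≤ 1 / 25) (hΛ : DifferentiableOn ℂ Λ (ball 0 δ))
    (hβ : ∀ x ∈ tsupport β, (f x).im = circGraph (f x).re)
    (hν : ∀ g : C(X, ℂ), (∀ x ∈ tsupport β, (f x).re ≤ 0 → g x = 0) →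
      (∀ x ∉ tsupport β, g x = 0) → ν g = 0)
    (hout : ∀ s ∈ ball (0 : ℂ) δ, s.im < circGraph s.re → Λ s + ν (qdiv β f s) = 0) {s : ℂ}
    (hs : s ∈ ball (0 : ℂ) δ) (hne : s.im ≠ circGraph s.re) : Λ s + ν (qdiv β f s) = 0 := by
  let χ : C(X, ℂ) := ⟨fun x => ((max 0 (min 1 (1 - 8 / δ * (f x).re)) : ℝ) : ℂ), by fun_prop⟩
  have hχ1 : ∀ x, (f x).re ≤ 0 → χ x = 1 := by
    intro x hx
    have : 1 ≤ 1 - 8 / δ * (f x).re := by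
      have := mul_nonpos_of_nonneg_of_nonpos (by positivity : 0 ≤ 8 / δ) hx
      linarith
    simp [χ, min_eq_left this]
  have hχ0 : ∀ x, δ / 8 < (f x).re → χ x = 0 := by
    intro x hx
    have : 1 - 8 / δ * (f x).re ≤ 0 := by
      have h1 : 8 / δ * (δ / 8) < 8 / δ * (f x).re := by gcongr
      have h2 : 8 / δ * (δ / 8) = 1 := by field_simp
      linarith
    have h3 : min 1 (1 - 8 / δ * (f x).re) ≤ 0 := (min_le_right _ _).trans this
    simp [χ, max_eq_left h3]
  have hsub : tsupport (β * χ) ⊆ tsupport β := by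
    refine closure_mono fun x hx => ?_
    exact left_ne_zero_of_mul hx
  have hre : ∀ x ∈ tsupport (β * χ), (f x).re ≤ δ / 8 := by
    have hcl : IsClosed {x | (f x).re ≤ δ / 8} := isClosed_le (by fun_prop) continuous_const
    refine fun x hx => closure_minimal (fun x hx => ?_) hcl hx
    by_contra hc
    exact right_ne_zero_of_mul hx (hχ0 x (not_le.1 hc))
  set F : ℂ → ℂ := fun s => Λ s + ν (qdiv (β * χ) f s) with hF
  have hoff : ∀ z : ℂ, z.im ≠ circGraph z.re → z ∉ f '' tsupport β := fun z hz =>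
    notMem_image_of_im_ne hβ hz
  have hFeq : ∀ z : ℂ, z.im ≠ circGraph z.re → Λ z + ν (qdiv β f z) = F z := by
    intro z hz
    have h1 := hoff z hz
    have h2 : z ∉ f '' tsupport (β * χ) := fun h => h1 (Set.image_mono hsub h)
    rw [hF, add_right_inj, ← sub_eq_zero, ← map_sub]
    refine hν _ (fun x hx hx0 => ?_) fun x hx => ?_
    · rw [ContinuousMap.sub_apply, qdiv_apply h1, qdiv_apply h2, ContinuousMap.mul_apply,
        hχ1 x hx0, mul_one, sub_self]
    · have : β x = 0 := image_eq_zero_of_notMem_tsupport hx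
      rw [ContinuousMap.sub_apply, qdiv_apply h1, qdiv_apply h2, ContinuousMap.mul_apply, this]
      simp
  have hFd : ∀ z ∈ ball (0 : ℂ) δ, z ∉ f '' tsupport (β * χ) → DifferentiableAt ℂ F z := by
    intro z hz hz'
    exact (hΛ.differentiableAt (isOpen_ball.mem_nhds hz)).add
      (ν.differentiableAt.comp z ((contDiffAt_qdiv hz').differentiableAt one_ne_zero))
  set s₁ : ℂ := graphPt circGraph (δ / 4) with hs₁
  have hs₁re : s₁.re = δ / 4 := by simp [hs₁, graphPt]
  have hs₁im : s₁.im = circGraph (δ / 4) := by simp [hs₁, graphPt]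
  have hs₁n : ‖s₁‖ < δ / 2 := by
    refine (Complex.norm_le_abs_re_add_abs_im s₁).trans_lt ?_
    have h1 := abs_circGraph_sub_le (δ / 4) 0
    rw [circGraph_zero, sub_zero, sub_zero] at h1
    rw [hs₁re, hs₁im]
    rw [abs_of_pos (by positivity : 0 < δ / 4)] at h1 ⊢
    linarith
  have hBsub : ball s₁ (δ / 8) ⊆ ball 0 δ := ball_subset_ball' (by
    rw [dist_zero_right]
    linarith)
  have hnear : ∀ η : ℝ, |η| < δ / 8 → s₁ + η * Complex.I ∈ ball s₁ (δ / 8) := by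
    intro η hη
    rw [mem_ball, dist_eq_norm, add_sub_cancel_left, norm_mul, Complex.norm_I, mul_one,
      Complex.norm_real]
    exact hη
  have hball : ∀ z ∈ ball s₁ (δ / 8), F z = 0 := by
    refine eqOn_zero_of_eventually_zero isOpen_ball (convex_ball _ _).isPreconnected
      (s := s₁ + ((-(δ / 16) : ℝ) : ℂ) * Complex.I) ?_
      (hnear _ (by rw [abs_neg, abs_of_pos (by positivity)]; linarith)) ?_
    · intro z hz
      refine (hFd z (hBsub hz) ?_).differentiableWithinAt
      rintro ⟨x, hx, hxz⟩
      have h1 := hre x hx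
      rw [hxz] at h1
      have h2 := Complex.abs_re_le_norm (z - s₁)
      rw [mem_ball, dist_eq_norm] at hz
      have h3 := (abs_lt.1 (h2.trans_lt hz)).1
      rw [Complex.sub_re, hs₁re] at h3
      linarith
    · have hlt : ∀ᶠ z : ℂ in 𝓝 (s₁ + ((-(δ / 16) : ℝ) : ℂ) * Complex.I), z.im < circGraph z.re := by
        refine (Complex.continuous_im.continuousAt).eventually_lt
          ((continuous_circGraph.comp Complex.continuous_re).continuousAt) ?_
        simp [hs₁re, hs₁im, hδ]
      filter_upwards [hlt, isOpen_ball.mem_nhds (hnear (-(δ / 16))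
        (by rw [abs_neg, abs_of_pos (by positivity)]; linarith))] with z hz hz'
      rw [← hFeq z hz.ne]
      exact hout z (hBsub hz') hz
  rcases lt_or_gt_of_ne hne with h | h
  · exact hout s hs h
  rw [hFeq s hne]
  have hnb : ∀ z ∈ ball (0 : ℂ) δ, ‖z‖ ≤ 1 / 25 := fun z hz => by
    rw [mem_ball, dist_zero_right] at hz
    linarith
  have hDs : ∀ z ∈ ball (0 : ℂ) δ, (circGraph z.re < z.im ↔ z ∈ ball Complex.I 1) := fun z hz => by
    rw [circGraph_lt_iff (hnb z hz), mem_ball, dist_eq_norm]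
  have hup : circGraph (s₁ + ((δ / 16 : ℝ) : ℂ) * Complex.I).re <
      (s₁ + ((δ / 16 : ℝ) : ℂ) * Complex.I).im := by
    simp [hs₁re, hs₁im, hδ]
  have hup' := hnear (δ / 16) (by rw [abs_of_pos (by positivity)]; linarith)
  refine eqOn_zero_of_eventually_zero (B := ball 0 δ ∩ ball Complex.I 1)
    (isOpen_ball.inter isOpen_ball) ((convex_ball _ _).inter (convex_ball _ _)).isPreconnected ?_
    (s := s₁ + ((δ / 16 : ℝ) : ℂ) * Complex.I) ⟨hBsub hup', (hDs _ (hBsub hup')).1 hup⟩ ?_ s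
    ⟨hs, (hDs s hs).1 h⟩
  · rintro z ⟨hz, hz'⟩
    refine (hFd z hz fun hc => ?_).differentiableWithinAt
    exact hoff z ((hDs z hz).2 hz').ne' (Set.image_mono hsub hc)
  · filter_upwards [isOpen_ball.mem_nhds hup'] with z hz using hball z hz

end OneSided

section AngleMaximum

variable {X : Type*} [TopologicalSpace X] [CompactSpace X] [T2Space X]

/-- An algebra containing a unimodular function with a continuous logarithm, which is dense on the
level sets of that function and has only point evaluations as characters there, is everything. -/
theorem essSet_eq_empty_of_angle (A : Subalgebra ℂ C(X, ℂ)) [CompleteSpace A]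
    (hA : IsClosed (A : Set C(X, ℂ))) {H : C(X, ℂ)} (hH : H ∈ A) {Θ : X → ℝ} (hΘ : Continuous Θ)
    (hHΘ : ∀ x, H x = Complex.exp (Θ x * Complex.I))
    (hfib : ∀ l, ∀ u : C(X, ℂ), ∀ ε > 0, ∃ p ∈ A, ∀ x, H x = l → ‖u x - p x‖ < ε)
    (hchar : ∀ μ, IsCharOn A μ → ‖μ H‖ = 1 → ∃ x, ∀ g ∈ A, μ g = g x) : essSet A = ∅ := by
  by_contra hE
  obtain ⟨x₀, hx₀, hmax⟩ := (isClosed_essSet A).isCompact.exists_isMaxOn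
    (Set.nonempty_iff_ne_empty.2 hE) hΘ.continuousOn
  set c := Θ x₀ with hc
  set l := Complex.exp (c * Complex.I) with hl
  have hl1 : ‖l‖ = 1 := Complex.norm_exp_ofReal_mul_I c
  have hll : (starRingEnd ℂ) l * l = 1 := by
    rw [mul_comm, Complex.mul_conj, Complex.normSq_eq_norm_sq, hl1]
    norm_num
  let u : C(X, ℂ) := ⟨fun x => ((max 0 (1 - |Θ x - c|) : ℝ) : ℂ), by fun_prop⟩
  obtain ⟨q, hqA, hq⟩ := hfib l u (1 / 4) (by norm_num)
  set f : C(X, ℂ) := (-Complex.I) • ((starRingEnd ℂ) l • H - 1) with hf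
  have hfA : f ∈ A := A.smul_mem (A.sub_mem (A.smul_mem hH _) A.one_mem) _
  have hHl : ∀ x, H x = l * Complex.exp ((Θ x - c : ℝ) * Complex.I) := by
    intro x
    rw [hHΘ, hl, ← Complex.exp_add]
    push_cast
    ring_nf
  have hfx : ∀ x, f x = -Complex.I * (Complex.exp ((Θ x - c : ℝ) * Complex.I) - 1) := by
    intro x
    change -Complex.I * ((starRingEnd ℂ) l * H x - 1) = _
    rw [hHl, ← mul_assoc ((starRingEnd ℂ) l), hll, one_mul]
  have hfre : ∀ x, (f x).re = Real.sin (Θ x - c) := by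
    intro x
    rw [hfx]
    simp [Complex.exp_ofReal_mul_I_re, Complex.exp_ofReal_mul_I_im, -Complex.ofReal_sub]
  have hfim : ∀ x, (f x).im = 1 - Real.cos (Θ x - c) := by
    intro x
    rw [hfx]
    simp [Complex.exp_ofReal_mul_I_re, Complex.exp_ofReal_mul_I_im, -Complex.ofReal_sub]
  have hμ : ∀ μ, IsCharOn A μ → μ H = l * (1 + Complex.I * μ f) := by
    intro μ h
    have h1 : μ f = -Complex.I * ((starRingEnd ℂ) l * μ H - 1) := by
      rw [hf, map_smul, map_sub, map_smul, h.2, smul_eq_mul, smul_eq_mul]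
    rw [h1]
    linear_combination (-μ H) * hll + (μ H * ((starRingEnd ℂ) l * l) - l) * Complex.I_sq
  have hu1 : ∀ x, |Θ x - c| < 1 ∨ u x = 0 := by
    intro x
    rcases lt_or_ge |Θ x - c| 1 with h | h
    · exact Or.inl h
    · right
      change ((max 0 (1 - |Θ x - c|) : ℝ) : ℂ) = 0
      rw [max_eq_left (by linarith), Complex.ofReal_zero]
  have hu2 : ∀ x, H x = l → |Θ x - c| < 1 → u x = 1 := by
    intro x hx h
    have h1 : f x = 0 := by
      change -Complex.I * ((starRingEnd ℂ) l * H x - 1) = _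
      rw [hx, hll, sub_self, mul_zero]
    have h2 : Real.sin (Θ x - c) = 0 := by rw [← hfre, h1, Complex.zero_re]
    obtain ⟨h3, h4⟩ := abs_lt.1 h
    have h5 := (Real.sin_eq_zero_iff_of_lt_of_lt (by linarith [Real.pi_gt_three])
      (by linarith [Real.pi_gt_three])).1 h2
    change ((max 0 (1 - |Θ x - c|) : ℝ) : ℂ) = 1
    simp [h5]
  have hf0 : ∀ x, f x = 0 → H x = l := by
    intro x hx
    have h1 : Complex.I * f x = (starRingEnd ℂ) l * H x - 1 := by
      change Complex.I * (-Complex.I * ((starRingEnd ℂ) l * H x - 1)) = _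
      linear_combination -((starRingEnd ℂ) l * H x - 1) * Complex.I_sq
    rw [hx, mul_zero] at h1
    linear_combination l * (-h1) - H x * hll
  have hsheet : ∀ x, f x = 0 → ‖q x - 1‖ ≤ 1 / 2 → |Θ x - c| < 1 := by
    intro x hx h
    refine (hu1 x).resolve_right fun h0 => ?_
    have h1 := hq x (hf0 x hx)
    have h2 := norm_sub_le (q x) (q x - 1)
    rw [sub_sub_cancel, norm_one] at h2
    rw [h0, zero_sub, norm_neg] at h1
    linarith
  obtain ⟨δ, hδ, hδC⟩ : ∃ δ, 0 < δ ∧ ∀ x ∈ {x | ‖q x - 1‖ ≤ 1 / 2 ∧ 1 ≤ |Θ x - c|}, δ ≤ ‖f x‖ := by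
    refine IsCompact.exists_forall_le' (IsClosed.isCompact ?_) (by fun_prop) ?_
    · have h1 : IsClosed {x | ‖q x - 1‖ ≤ 1 / 2} := isClosed_le (by fun_prop) (by fun_prop)
      have h2 : IsClosed {x | 1 ≤ |Θ x - c|} := isClosed_le (by fun_prop) (by fun_prop)
      exact h1.inter h2
    · rintro x ⟨h1, h2⟩
      refine norm_pos_iff.2 fun h => ?_
      exact absurd (hsheet x h h1) (not_lt.2 h2)
  set δ₁ := min δ (1 / 25) with hδ₁
  have hα : ∀ x, ‖q x - 1‖ < 1 / 2 → ‖f x‖ < δ₁ → |Θ x - c| < 1 := by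
    intro x h1 h2
    by_contra! h
    exact absurd (hδC x ⟨h1.le, h⟩) (not_le.2 (h2.trans_le (min_le_left _ _)))
  have hgraph : ∀ x, ‖q x - 1‖ < 1 / 2 → ‖f x‖ < δ₁ → (f x).im = circGraph (f x).re := by
    intro x h1 h2
    obtain ⟨h3, h4⟩ := abs_lt.1 (hα x h1 h2)
    have h5 := Real.pi_gt_three
    rw [circGraph_eq ((Complex.abs_re_le_norm _).trans (h2.trans_le (min_le_right _ _)).le), hfim,
      hfre, ← Real.cos_sq', Real.sqrt_sq (Real.cos_nonneg_of_mem_Icc ⟨by linarith, by linarith⟩)]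
  have hf₀ : f x₀ = 0 := by
    rw [hfx, ← hc, sub_self]
    simp
  have hq₀ : ‖q x₀ - 1‖ < 1 / 2 := by
    have h1 := hf0 _ hf₀
    have h2 := hq _ h1
    rw [hu2 _ h1 (by rw [← hc]; simp), norm_sub_rev] at h2
    linarith
  refine notMem_essSet_of_sheet A hA ⟨f, hfA⟩ ⟨q, hqA⟩ (w₀ := 1) (r := 1 / 2) (δ₁ := δ₁)
    (κ := 1 / 24) (ψ := circGraph) (by norm_num) (lt_min hδ (by norm_num)) ?_ continuous_circGraph
    le_rfl (by norm_num) abs_circGraph_sub_le circGraph_zero hgraph ?_ ?_ hf₀ hq₀ hx₀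
  · intro w hw
    by_contra hun
    obtain ⟨μ, hμc, h1, h2⟩ := exists_isCharOn hun
    have h3 : μ H = l := by
      rw [hμ μ hμc]
      change μ f = 0 at h1
      rw [h1, mul_zero, add_zero, mul_one]
    obtain ⟨x, hx⟩ := hchar μ hμc (by rw [h3, hl1])
    have h4 : H x = l := by rw [← hx H hH, h3]
    have h5 : q x = w := by rw [← hx q hqA]; exact h2
    have h6 : f x = 0 := by rw [← hx f hfA]; exact h1
    rw [mem_sphere, dist_eq_norm, ← h5] at hw
    have h7 := hq x h4
    rw [hu2 x h4 (hsheet x h6 hw.le), norm_sub_rev] at h7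
    linarith
  · intro t ht v ε hε
    obtain ⟨p, hp, h⟩ := hfib (l * Complex.exp ((Real.arcsin t : ℝ) * Complex.I)) v ε hε
    refine ⟨p, hp, fun x h1 h2 h3 => h x ?_⟩
    obtain ⟨h4, h5⟩ := abs_lt.1 (hα x h1 h2)
    have h6 := Real.pi_gt_three
    change (f x).re = t at h3
    rw [hHl, ← h3, hfre, Real.arcsin_sin (by linarith) (by linarith)]
  · intro δ' hδ' hδ'' β hβ _
    refine ⟨δ', hδ', le_rfl, fun ν hν Λ hΛ hout s hs hne => ?_⟩
    have hβ' : ∀ x ∈ tsupport β, (f x).im = circGraph (f x).re :=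
      fun x hx => hgraph x (hβ x hx).1 (hβ x hx).2
    have hδ25 : δ' ≤ 1 / 25 := hδ''.trans (min_le_right _ _)
    refine onesided_kill hδ' hδ25 hΛ hβ' ?_ ?_ hs hne
    · intro g hg hg'
      refine hν g (mem_of_eqOn_essSet hA fun x hx => ?_)
      by_cases hxβ : x ∈ tsupport β
      · refine hg x hxβ ?_
        have h1 : Θ x ≤ c := hmax hx
        have h2 := (abs_lt.1 (hα x (hβ x hxβ).1 (hβ x hxβ).2)).1
        rw [hfre]
        exact Real.sin_nonpos_of_nonpos_of_neg_pi_le (by linarith) (by linarith [Real.pi_gt_three])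
      · exact hg' x hxβ
    · intro s hs hlt
      refine hout s hs (notMem_image_of_im_ne hβ' hlt.ne) fun w _ => ?_
      by_contra hun
      obtain ⟨μ, hμc, h1, -⟩ := exists_isCharOn hun
      change μ f = s at h1
      have hs25 : ‖s‖ ≤ 1 / 25 := by
        rw [mem_ball, dist_zero_right] at hs
        linarith
      have h2 := (lt_circGraph_iff hs25).1 hlt
      have h3 := hμc.norm_le hH
      have h4 : ‖H‖ ≤ 1 := (ContinuousMap.norm_le _ zero_le_one).2 fun x => by
        rw [hHΘ, Complex.norm_exp_ofReal_mul_I]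
      have h5 : (1 + Complex.I * s) = Complex.I * (s - Complex.I) := by
        linear_combination Complex.I_sq
      rw [hμ μ hμc, h1, h5, norm_mul, norm_mul, hl1, Complex.norm_I, one_mul, one_mul] at h3
      linarith

end AngleMaximum

section PeakSets

variable {n : ℕ} {K : Set (Fin n → ℂ)} [CompactSpace K]

/-- A character taking a unimodular value at a contraction is carried by the level set. -/
theorem IsCharOn.mem_polyHull_level {μ : C(K, ℂ) →L[ℂ] ℂ} (hμ : IsCharOn (polyAlg K) μ)
    {H : C(K, ℂ)} (hH : H ∈ polyAlg K) (hH1 : ∀ x, ‖H x‖ ≤ 1) (hμH : ‖μ H‖ = 1)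
    {L : Set (Fin n → ℂ)} [CompactSpace L] (hL : ∀ x : K, H x = μ H → x.1 ∈ L) :
    (fun i => μ (coordFun K i)) ∈ polyHull n L := by
  refine mem_polyHull_of_norm_eval_le fun P => ?_
  set m := ‖polyMap L P‖ with hm
  set y := fun i => μ (coordFun K i) with hy
  set e := ‖MvPolynomial.eval y P‖ with he
  by_contra! hlt
  set l := μ H with hl
  have hm0 : 0 ≤ m := norm_nonneg _
  have hll : (starRingEnd ℂ) l * l = 1 := by
    rw [mul_comm, Complex.mul_conj, Complex.normSq_eq_norm_sq, hμH]
    norm_num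
  set G : C(K, ℂ) := (1 / 2 : ℂ) • (1 + (starRingEnd ℂ) l • H) with hG
  have hGA : G ∈ polyAlg K := Subalgebra.smul_mem _
    (Subalgebra.add_mem _ (Subalgebra.one_mem _) (Subalgebra.smul_mem _ hH _)) _
  have hGx : ∀ x, G x = 1 / 2 * (1 + (starRingEnd ℂ) l * H x) := fun x => rfl
  have hlH : ∀ x, ‖(starRingEnd ℂ) l * H x‖ ≤ 1 := fun x => by
    rw [norm_mul, RCLike.norm_conj, hμH, one_mul]
    exact hH1 x
  have hG1 : ∀ x, ‖G x‖ ≤ 1 := by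
    intro x
    rw [hGx, norm_mul]
    have h1 := norm_add_le 1 ((starRingEnd ℂ) l * H x)
    rw [norm_one] at h1
    have h2 : ‖(1 / 2 : ℂ)‖ = 1 / 2 := by norm_num
    rw [h2]
    linarith [hlH x]
  have hGlt : ∀ x, H x ≠ l → ‖G x‖ < 1 := by
    intro x hx
    refine lt_of_le_of_ne (hG1 x) fun h => hx ?_
    have h2 : ‖(1 / 2 : ℂ)‖ = 1 / 2 := by norm_num
    rw [hGx, norm_mul, h2] at h
    have h3 := parallelogram_law_with_norm ℝ (1 : ℂ) ((starRingEnd ℂ) l * H x)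
    have h4 : ‖1 + (starRingEnd ℂ) l * H x‖ = 2 := by linarith
    rw [h4, norm_one] at h3
    have h5 : ‖1 - (starRingEnd ℂ) l * H x‖ = 0 := by
      nlinarith [hlH x, norm_nonneg ((starRingEnd ℂ) l * H x),
        norm_nonneg (1 - (starRingEnd ℂ) l * H x)]
    rw [norm_eq_zero] at h5
    linear_combination -H x * hll - l * h5
  have hμG : μ G = 1 := by
    rw [hG, map_smul, map_add, hμ.2, map_smul, smul_eq_mul, smul_eq_mul, ← hl, hll]
    norm_num
  have hμP : μ (polyMap K P) = MvPolynomial.eval y P := hμ.apply_polyMap P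
  set b := (m + e) / 2 with hb
  obtain ⟨ρ, hρ, hρC⟩ : ∃ ρ < (1 : ℝ), ∀ x : K, b ≤ ‖polyMap K P x‖ → ‖G x‖ ≤ ρ := by
    have hC : IsClosed {x : K | b ≤ ‖polyMap K P x‖} :=
      isClosed_le continuous_const (polyMap K P).continuous.norm
    obtain ⟨d, hd, hdC⟩ := hC.isCompact.exists_forall_le' (f := fun x => 1 - ‖G x‖) (a := 0)
      (by fun_prop) fun x hx => by
        refine sub_pos.2 (hGlt x fun h => ?_)
        have h1 := (polyMap L P).norm_coe_le_norm ⟨x.1, hL x h⟩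
        rw [polyMap_apply, ← polyMap_apply K P x] at h1
        have h2 : b ≤ ‖polyMap K P x‖ := hx
        linarith
    exact ⟨1 - d, by linarith, fun x hx => by linarith [hdC x hx]⟩
  set ρ' := max ρ 0 with hρ'
  have hρ'1 : ρ' < 1 := max_lt hρ one_pos
  obtain ⟨N, hN⟩ : ∃ N : ℕ, ρ' ^ N * ‖polyMap K P‖ < b := by
    have h1 : Filter.Tendsto (fun N : ℕ => ρ' ^ N * ‖polyMap K P‖) Filter.atTop (𝓝 (0 * _)) :=
      (tendsto_pow_atTop_nhds_zero_of_lt_one (le_max_right _ _) hρ'1).mul_const _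
    rw [zero_mul] at h1
    exact (h1.eventually_lt_const (by linarith : 0 < b)).exists
  have hGN : G ^ N ∈ polyAlg K := Subalgebra.pow_mem _ hGA N
  have h1 := hμ.norm_le (Subalgebra.mul_mem _ hGN (polyMap_mem P))
  rw [hμ.1 _ hGN _ (polyMap_mem P), hμ.pow hGA, hμG, one_pow, one_mul, hμP] at h1
  have h2 : ‖G ^ N * polyMap K P‖ ≤ b := by
    refine (ContinuousMap.norm_le _ (by linarith)).2 fun x => ?_
    rw [ContinuousMap.mul_apply, ContinuousMap.pow_apply, norm_mul, norm_pow]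
    rcases le_or_gt b ‖polyMap K P x‖ with h | h
    · refine le_trans ?_ hN.le
      exact mul_le_mul (pow_le_pow_left₀ (norm_nonneg _) ((hρC x h).trans (le_max_left _ _)) N)
        ((polyMap K P).norm_coe_le_norm x) (norm_nonneg _) (by positivity)
    · refine le_trans ?_ h.le
      exact mul_le_of_le_one_left (norm_nonneg _) (pow_le_one₀ (norm_nonneg _) (hG1 x))
  linarith

theorem IsCharOn.eq_apply {μ : C(K, ℂ) →L[ℂ] ℂ} (hμ : IsCharOn (polyAlg K) μ) {x : K}
    (hx : (fun i => μ (coordFun K i)) = x.1) {g : C(K, ℂ)} (hg : g ∈ polyAlg K) : μ g = g x := by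
  have hc : IsClosed {g : C(K, ℂ) | μ g = g x} :=
    isClosed_eq μ.continuous (continuous_eval_const x)
  have : closure ((polyMap K).range : Set C(K, ℂ)) ⊆ _ := closure_minimal
    (fun g ⟨p, hp⟩ => by
      subst hp
      change μ (polyMap K p) = polyMap K p x
      rw [hμ.apply_polyMap, hx, polyMap_apply]) hc
  exact this hg

end PeakSets

section Disc

namespace DiscSetup

variable {Ω : Set (Fin 2 → ℂ)} {h : (Fin 2 → ℂ) → ℂ} {U : Set (ℝ × ℝ)}
  {φ : ℝ × ℝ → (Fin 2 → ℂ)}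

theorem polyHull_image (S : DiscSetup Ω h U φ) :
    polyHull 2 (φ '' closedBall 0 1) = φ '' closedBall 0 1 := by
  set K := φ '' closedBall (0 : ℝ × ℝ) 1 with hK
  have hφc : ContinuousOn φ (closedBall (0 : ℝ × ℝ) 1) := S.continuousOn_φ.mono S.disc_sub
  have hKc : IsCompact K := (isCompact_closedBall _ _).image_of_continuousOn hφc
  have : CompactSpace K := isCompact_iff_compactSpace.1 hKc
  have hKΩ : K ⊆ Ω := by
    rintro _ ⟨p, hp, rfl⟩
    exact S.maps p hp
  have : CompactSpace (closedBall (0 : ℝ × ℝ) 1) :=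
    isCompact_iff_compactSpace.1 (isCompact_closedBall _ _)
  let e : closedBall (0 : ℝ × ℝ) 1 ≃ K := Equiv.Set.imageOfInjOn φ _ (S.inj.mono S.disc_sub)
  have he : Continuous e := (hφc.domRestrict).subtype_mk _
  let e' := he.homeoOfEquivCompactToT2
  obtain ⟨θ, hθ, hhθ⟩ := S.exists_angle
  have hφe : ∀ x, φ (e'.symm x).1 = x.1 := fun x => congrArg Subtype.val (e'.apply_symm_apply x)
  let H : C(K, ℂ) := ⟨fun x => h x.1, (S.hol.continuousOn.mono hKΩ).domRestrict⟩
  have hHA : H ∈ polyAlg K := mem_polyAlg_iff.2 fun ε hε => by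
    obtain ⟨p, hp⟩ := S.runge.2.2 h S.hol K hKΩ hKc (ε / 2) (half_pos hε)
    refine ⟨p, lt_of_le_of_lt ((ContinuousMap.norm_le _ (half_pos hε).le).2 fun x => ?_)
      (half_lt_self hε)⟩
    rw [ContinuousMap.sub_apply, polyMap_apply]
    exact hp x.1 x.2
  have hlev : ∀ l, ∀ x : K, H x = l → x.1 ∈ discLevel h φ l := by
    rintro l ⟨_, p, hp, rfl⟩ hx
    exact ⟨p, ⟨hp, hx⟩, rfl⟩
  have hlevK : ∀ l, discLevel h φ l ⊆ K := by
    rintro l _ ⟨p, hp, rfl⟩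
    exact ⟨p, hp.1, rfl⟩
  refine polyHull_eq_of_essSet_eq_empty ?_
  refine essSet_eq_empty_of_angle (polyAlg K) (isClosed_polyAlg K) hHA
    (Θ := fun x => θ (e'.symm x).1) (by fun_prop) (fun x => ?_) ?_ ?_
  · rw [← hhθ _ (e'.symm x).2, hφe]
    rfl
  · intro l u ε hε
    have : CompactSpace (discLevel h φ l) := isCompact_iff_compactSpace.1 (S.isCompact_discLevel l)
    let v : C(discLevel h φ l, ℂ) :=
      ⟨fun x => u ⟨x.1, hlevK l x.2⟩, by fun_prop⟩
    have hv : v ∈ polyAlg (discLevel h φ l) := by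
      rw [S.polyAlg_discLevel l]
      trivial
    obtain ⟨P, hP⟩ := mem_polyAlg_iff.1 hv ε hε
    refine ⟨polyMap K P, polyMap_mem P, fun x hx => ?_⟩
    have h1 := ((v - polyMap _ P).norm_coe_le_norm ⟨x.1, hlev l x hx⟩).trans_lt hP
    rw [ContinuousMap.sub_apply, polyMap_apply] at h1
    rw [polyMap_apply]
    exact h1
  · intro μ hμ hμ1
    have : CompactSpace (discLevel h φ (μ H)) :=
      isCompact_iff_compactSpace.1 (S.isCompact_discLevel _)
    have h1 := hμ.mem_polyHull_level hHA (fun x => ?_) hμ1 (hlev (μ H))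
    · rw [S.polyHull_discLevel] at h1
      exact ⟨⟨_, hlevK _ h1⟩, fun g hg => hμ.eq_apply rfl hg⟩
    · obtain ⟨_, p, hp, rfl⟩ := x
      exact (S.norm_eq p hp).le

end DiscSetup

end Disc

end Preliminaries

/-- Let `Ω` be a Runge domain in `ℂ²` and `h` holomorphic on `Ω`.
Let `M := {z ∈ Ω : |h z| = 1}` with `dh(z) ≠ 0` for all `z ∈ M`. Then every
totally real `C²`-smooth disc contained in `M` is polynomially convex. -/
theorem totallyRealDisc_in_modulus_one_levelSet_polyConvex
    (Ω : Set (Fin 2 → ℂ)) (hΩ : RungeDomain 2 Ω)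
    (h : (Fin 2 → ℂ) → ℂ) (hhol : DifferentiableOn ℂ h Ω)
    (M : Set (Fin 2 → ℂ)) (hM : M = {z ∈ Ω | ‖h z‖ = 1})
    (hdh : ∀ z ∈ M, fderiv ℂ h z ≠ 0)
    (K : Set (Fin 2 → ℂ)) (hK : TotallyRealDisc 2 K) (hKM : K ⊆ M) :
    PolyConvex 2 K := by
  subst hM
  obtain ⟨U, φ, hU, hsub, hφ, hinj, himm, hreal, rfl⟩ := hK
  exact DiscSetup.polyHull_image
    { runge := hΩ
      hol := hhol
      noncrit := fun z hz hz1 => hdh z ⟨hz, hz1⟩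
      isOpen_U := hU
      disc_sub := hsub
      smooth := hφ
      inj := hinj
      imm := himm
      real := hreal
      maps := fun p hp => (hKM ⟨p, hp, rfl⟩).1
      norm_eq := fun p hp => (hKM ⟨p, hp, rfl⟩).2 }
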